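/- arXiv:1712.06462 — 12 statements merged into one kernel-verified Lean document; each statement's English description precedes it below -/
import Mathlib

section
/- Let G be a group acting by homeomorphisms on the circle AddCircle ℝ 1, generated by a finite symmetric set S of cardinality k ≥ 2. Then for every real ε > log(k−1) there exists a homeomorphism h of the circle such that for every g ∈ S the conjugate h ∘ g ∘ h⁻¹ is Lipschitz with Lipschitz constant at most e^ε. In particular, every finitely generated group of circle homeomorphisms is topologically conjugate to a group of Lipschitz homeomorphisms. -/
open MeasureTheory

namespace UnitAddCircle

theorem exists_coe_eq_abs_eq_norm (x : AddCircle (1 : ℝ)) :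
    ∃ t : ℝ, (t : AddCircle (1 : ℝ)) = x ∧ |t| = ‖x‖ := by
  obtain ⟨x⟩ := x
  refine ⟨x - round x, ?_, UnitAddCircle.norm_eq.symm⟩
  have : ((round x : ℝ) : AddCircle (1 : ℝ)) = 0 :=
    (AddCircle.coe_eq_zero_iff (1 : ℝ)).2 ⟨round x, by simp⟩
  rw [AddCircle.coe_sub, this, sub_zero]
  rfl

theorem eq_or_eq_neg_of_norm_eq {x y : AddCircle (1 : ℝ)} (h : ‖x‖ = ‖y‖) : x = y ∨ x = -y := by
  obtain ⟨s, rfl, hs⟩ := exists_coe_eq_abs_eq_norm x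
  obtain ⟨t, rfl, ht⟩ := exists_coe_eq_abs_eq_norm y
  rw [← hs, ← ht] at h
  rcases abs_eq_abs.1 h with h | h
  · exact Or.inl (by rw [h])
  · exact Or.inr (by rw [h, AddCircle.coe_neg])

theorem dist_le_volume_of_isPreconnected {D : Set (AddCircle (1 : ℝ))} (hD : IsPreconnected D)
    {x y : AddCircle (1 : ℝ)} (hx : x ∈ D) (hy : y ∈ D) :
    ENNReal.ofReal (dist x y) ≤ volume D := by
  have hsub : Metric.closedBall x (dist x y) ⊆ D ∪ (fun z => x + x - z) ⁻¹' D := by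
    intro z hz
    have hz' : dist z x ∈ Set.Icc (dist x x) (dist y x) := by
      rw [dist_self, dist_comm y x]
      exact ⟨dist_nonneg, hz⟩
    obtain ⟨w, hw, hwz⟩ := hD.intermediate_value hx hy
      (f := fun w => dist w x) (by fun_prop) hz'
    simp only [dist_eq_norm] at hwz
    rcases eq_or_eq_neg_of_norm_eq hwz with h | h
    · left
      rwa [← sub_left_inj.1 h]
    · right
      have : x + x - z = w := by
        rw [sub_eq_iff_eq_add.1 h]; abel
      rwa [Set.mem_preimage, this]
  have hle := (measure_mono hsub).trans (measure_union_le (μ := volume) _ _)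
  rw [(Measure.measurePreserving_sub_left volume (x + x)).measure_preimage_emb
      (MeasurableEquiv.subLeft (x + x)).measurableEmbedding,
    AddCircle.volume_closedBall] at hle
  have hd : dist x y ≤ 1 / 2 := by
    rw [dist_eq_norm]
    simpa using AddCircle.norm_le_half_period (1 : ℝ) (x := x - y) one_ne_zero
  rw [min_eq_right (by linarith), ENNReal.ofReal_mul (by norm_num), ← two_mul] at hle
  rw [ENNReal.ofReal_ofNat] at hle
  exact (ENNReal.mul_le_mul_iff_right two_ne_zero ENNReal.ofNat_ne_top).1 hle

theorem exists_isPreconnected_volume_le_dist (x y : AddCircle (1 : ℝ)) :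
    ∃ D : Set (AddCircle (1 : ℝ)), IsPreconnected D ∧ IsCompact D ∧ x ∈ D ∧ y ∈ D ∧
      volume D ≤ ENNReal.ofReal (dist x y) := by
  obtain ⟨s, rfl⟩ := QuotientAddGroup.mk_surjective x
  obtain ⟨t, hty, ht⟩ := exists_coe_eq_abs_eq_norm (y - (s : AddCircle (1 : ℝ)))
  have hcont : Continuous ((↑) : ℝ → AddCircle (1 : ℝ)) := AddCircle.continuous_mk' 1
  have hmem : ∀ u : ℝ, |u - (s + t / 2)| ≤ |t| / 2 →
      (u : AddCircle (1 : ℝ)) ∈ (↑) '' Metric.closedBall (s + t / 2) (|t| / 2) := fun u hu =>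
    ⟨u, by rwa [Metric.mem_closedBall, Real.dist_eq], rfl⟩
  refine ⟨(↑) '' Metric.closedBall (s + t / 2) (|t| / 2), ?_, ?_, ?_, ?_, ?_⟩
  · exact ((convex_closedBall _ _).isPreconnected).image _ hcont.continuousOn
  · exact (isCompact_closedBall _ _).image hcont
  · exact hmem s (by rw [show s - (s + t / 2) = -(t / 2) by ring, abs_neg, abs_div]; simp)
  · have hy : y = ((s + t : ℝ) : AddCircle (1 : ℝ)) := by
      rw [AddCircle.coe_add, hty]; abel
    rw [hy]
    exact hmem _ (by rw [show s + t - (s + t / 2) = t / 2 by ring, abs_div]; simp)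
  · have hsub : (↑) '' Metric.closedBall (s + t / 2) (|t| / 2) ⊆
        Metric.closedBall ((s + t / 2 : ℝ) : AddCircle (1 : ℝ)) (|t| / 2) := by
      rintro _ ⟨u, hu, rfl⟩
      rw [Metric.mem_closedBall, dist_eq_norm, ← AddCircle.coe_sub]
      rw [Metric.mem_closedBall, Real.dist_eq] at hu
      exact (QuotientAddGroup.norm_mk_le_norm).trans hu
    refine (measure_mono hsub).trans ?_
    rw [AddCircle.volume_closedBall, dist_comm, dist_eq_norm]
    apply ENNReal.ofReal_le_ofReal
    refine (min_le_right _ _).trans (le_of_eq ?_)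
    rw [show ‖y - (s : AddCircle (1 : ℝ))‖ = |t| from ht.symm]
    ring

end UnitAddCircle

theorem continuous_measureReal_Iic (μ : Measure ℝ) [IsProbabilityMeasure μ] [NullSingletonClass μ] :
    Continuous fun t => μ.real (Set.Iic t) := by
  have h : (fun t => μ.real (Set.Iic t)) = ProbabilityTheory.cdf μ :=
    funext fun t => (ProbabilityTheory.cdf_eq_real μ t).symm
  rw [h, continuous_iff_continuousAt]
  intro t
  rw [(ProbabilityTheory.monotone_cdf μ).continuousAt_iff_leftLim_eq_rightLim,
    StieltjesFunction.rightLim_eq]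
  have h0 := (ProbabilityTheory.cdf μ).measure_singleton t
  rw [ProbabilityTheory.measure_cdf, measure_singleton] at h0
  have h1 := ENNReal.ofReal_eq_zero.1 h0.symm
  have h2 := (ProbabilityTheory.monotone_cdf μ).leftLim_le (le_refl t)
  linarith

theorem map_measureReal_Iic_eq_volume (μ : Measure ℝ) [IsProbabilityMeasure μ] [NullSingletonClass μ]
    (hsupp : μ (Set.Ioc 0 1)ᶜ = 0)
    (hstrict : StrictMonoOn (fun t => μ.real (Set.Iic t)) (Set.Icc 0 1))
    (h0 : μ.real (Set.Iic 0) = 0) (h1 : μ.real (Set.Iic 1) = 1) :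
    μ.map (fun t => μ.real (Set.Iic t)) = volume.restrict (Set.Ioc 0 1) := by
  have hcont := continuous_measureReal_Iic μ
  have : IsProbabilityMeasure (volume.restrict (Set.Ioc (0 : ℝ) 1)) := ⟨by simp⟩
  have : IsProbabilityMeasure (μ.map (fun t => μ.real (Set.Iic t))) :=
    Measure.isProbabilityMeasure_map hcont.aemeasurable
  refine Measure.ext_of_Iic _ _ fun a => ?_
  rw [Measure.map_apply hcont.measurable measurableSet_Iic, Measure.restrict_apply measurableSet_Iic,
    Set.inter_comm, Set.Ioc_inter_Iic, Real.volume_Ioc]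
  rcases lt_or_ge a 0 with ha | ha
  · rw [ENNReal.ofReal_of_nonpos (by rw [sub_zero]; exact (min_le_right _ _).trans ha.le)]
    convert measure_empty (μ := μ)
    ext t
    simpa using ha.trans_le measureReal_nonneg
  rcases lt_or_ge 1 a with ha' | ha'
  · rw [min_eq_left ha'.le]
    convert measure_univ (μ := μ)
    · ext t
      simpa using measureReal_le_one.trans ha'.le
    · simp
  obtain ⟨b, hb, hba⟩ := intermediate_value_Icc zero_le_one hcont.continuousOn
    (show a ∈ Set.Icc (μ.real (Set.Iic 0)) (μ.real (Set.Iic 1)) by rw [h0, h1]; exact ⟨ha, ha'⟩)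
  rw [min_eq_right ha', sub_zero, ← hba, ofReal_measureReal]
  refine measure_congr ?_
  have hae : ∀ᵐ t ∂μ, t ∈ Set.Ioc (0 : ℝ) 1 := hsupp
  filter_upwards [hae] with t ht
  exact propext (hstrict.le_iff_le ⟨ht.1.le, ht.2⟩ hb)

namespace UnitAddCircle

theorem exists_homeomorph_map_eq_volume (ν : Measure (AddCircle (1 : ℝ)))
    [IsProbabilityMeasure ν] [NullSingletonClass ν] [ν.IsOpenPosMeasure] :
    ∃ h : AddCircle (1 : ℝ) ≃ₜ AddCircle (1 : ℝ), ν.map h = volume := by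
  let e := AddCircle.measurableEquivIoc (1 : ℝ) 0
  let f : AddCircle (1 : ℝ) → ℝ := fun x => (e x : ℝ)
  have hf : Measurable f := measurable_subtype_coe.comp e.measurable
  have hfinj : Function.Injective f := Subtype.val_injective.comp e.injective
  have hfmem : ∀ x, f x ∈ Set.Ioc (0 : ℝ) 1 := fun x => by
    simpa using (e x).2
  have hfcoe : ∀ x, (f x : AddCircle (1 : ℝ)) = x := fun x => e.symm_apply_apply x
  have hcoef : ∀ t : ℝ, t ∈ Set.Ioc (0 : ℝ) 1 → f t = t := fun t ht =>
    congrArg Subtype.val (AddCircle.equivIoc_coe_eq (p := (1 : ℝ)) (a := 0) (by simpa using ht))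
  let μ := ν.map f
  have : IsProbabilityMeasure μ := Measure.isProbabilityMeasure_map hf.aemeasurable
  have : NullSingletonClass μ := ⟨fun t => by
    rw [Measure.map_apply hf (measurableSet_singleton t)]
    exact (Set.subsingleton_singleton.preimage hfinj).measure_zero ν⟩
  have hsupp : μ (Set.Ioc 0 1)ᶜ = 0 := by
    rw [Measure.map_apply hf measurableSet_Ioc.compl]
    convert measure_empty (μ := ν)
    ext x
    simpa using hfmem x
  let F : ℝ → ℝ := fun t => μ.real (Set.Iic t)
  have hF0 : F 0 = 0 := by
    have hsub : Set.Iic (0 : ℝ) ⊆ (Set.Ioc 0 1)ᶜ := fun t ht h => h.1.not_ge ht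
    have := measure_mono_null hsub hsupp
    simp [F, Measure.real, this]
  have hF1 : F 1 = 1 := by
    have hsub : (Set.Iic (1 : ℝ))ᶜ ⊆ (Set.Ioc 0 1)ᶜ := fun t ht h => ht h.2
    have := (prob_compl_eq_zero_iff measurableSet_Iic).1 (measure_mono_null hsub hsupp)
    simp [F, Measure.real, this]
  have hcont : Continuous F := continuous_measureReal_Iic μ
  have hstrict : StrictMonoOn F (Set.Icc 0 1) := by
    intro s hs t ht hst
    have hpos : 0 < μ (Set.Ioc s t) := by
      rw [Measure.map_apply hf measurableSet_Ioc]
      refine lt_of_lt_of_le (((QuotientAddGroup.isOpenMap_coe _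
        (isOpen_Ioo (a := s) (b := t))).measure_pos ν ((Set.nonempty_Ioo.2 hst).image _)))
        (measure_mono ?_)
      rintro _ ⟨u, hu, rfl⟩
      have : f u = u := hcoef u ⟨hs.1.trans_lt hu.1, hu.2.le.trans ht.2⟩
      rw [Set.mem_preimage, this]
      exact ⟨hu.1, hu.2.le⟩
    have hunion : F t = F s + μ.real (Set.Ioc s t) := by
      rw [← measureReal_union (Set.Iic_disjoint_Ioc le_rfl) measurableSet_Ioc,
        Set.Iic_union_Ioc_eq_Iic hst.le]
    have : 0 < μ.real (Set.Ioc s t) := ENNReal.toReal_pos hpos.ne' (measure_ne_top _ _)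
    linarith
  have hmap := map_measureReal_Iic_eq_volume μ hsupp hstrict hF0 hF1
  have hFmem : ∀ t ∈ Set.Ico (0 : ℝ) 1, F t ∈ Set.Ico (0 : ℝ) 1 := fun t ht =>
    ⟨measureReal_nonneg, by
      rw [← hF1]; exact hstrict ⟨ht.1, ht.2.le⟩ ⟨zero_le_one, le_rfl⟩ ht.2⟩
  let H : AddCircle (1 : ℝ) → AddCircle (1 : ℝ) :=
    AddCircle.liftIco 1 0 fun t => (F t : AddCircle (1 : ℝ))
  have h01 : ((1 : ℝ) : AddCircle (1 : ℝ)) = ((0 : ℝ) : AddCircle (1 : ℝ)) := by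
    rw [AddCircle.coe_period, AddCircle.coe_zero]
  have hHcont : Continuous H := AddCircle.liftIco_zero_continuous
    (by rw [hF0, hF1, h01])
    ((AddCircle.continuous_mk' 1).comp hcont).continuousOn
  have hH : ∀ t ∈ Set.Ico (0 : ℝ) 1, H t = (F t : AddCircle (1 : ℝ)) := fun t ht =>
    AddCircle.liftIco_zero_coe_apply ht
  have hinj : Function.Injective H := by
    intro x y hxy
    obtain ⟨s, hs, rfl⟩ := AddCircle.eq_coe_Ico x
    obtain ⟨t, ht, rfl⟩ := AddCircle.eq_coe_Ico y
    rw [hH s hs, hH t ht, AddCircle.coe_eq_coe_iff_of_mem_Ico (a := 0)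
      (by simpa using hFmem s hs) (by simpa using hFmem t ht)] at hxy
    rw [hstrict.injOn ⟨hs.1, hs.2.le⟩ ⟨ht.1, ht.2.le⟩ hxy]
  have hsurj : Function.Surjective H := by
    intro y
    obtain ⟨a, ha, rfl⟩ := AddCircle.eq_coe_Ico y
    obtain ⟨b, hb, hba⟩ := intermediate_value_Ico zero_le_one hcont.continuousOn
      (show a ∈ Set.Ico (F 0) (F 1) by rwa [hF0, hF1])
    exact ⟨b, by rw [hH b hb, hba]⟩
  refine ⟨Continuous.homeoOfEquivCompactToT2 (f := Equiv.ofBijective H ⟨hinj, hsurj⟩) hHcont, ?_⟩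
  change ν.map H = volume
  have hHf : H = (fun t : ℝ => (t : AddCircle (1 : ℝ))) ∘ F ∘ f := by
    funext x
    have hx := hfmem x
    conv_lhs => rw [← hfcoe x]
    rcases hx.2.lt_or_eq with h | h
    · exact hH _ ⟨hx.1.le, h⟩
    · simp only [Function.comp]
      rw [h, h01, hH 0 (by simp), hF0, hF1, h01]
  have hvol := (AddCircle.measurePreserving_mk (1 : ℝ) 0).map_eq
  rw [zero_add] at hvol
  rw [hHf, ← Measure.map_map AddCircle.measurable_mk' (hcont.measurable.comp hf),
    ← Measure.map_map hcont.measurable hf]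
  exact (congrArg _ hmap).trans hvol

end UnitAddCircle

theorem exists_length_of_closure_eq_top {G : Type*} [Group G] (S : Finset G)
    (hsymm : ∀ g ∈ S, g⁻¹ ∈ S) (hgen : Subgroup.closure (S : Set G) = ⊤) :
    ∃ ℓ : G → ℕ, (∀ g, ℓ g = 0 ↔ g = 1) ∧ (∀ s ∈ S, ∀ g, ℓ (s * g) ≤ ℓ g + 1) ∧
      ∀ g, ℓ g ≠ 0 → ∃ s ∈ S, ℓ (s⁻¹ * g) + 1 = ℓ g := by
  let L : G → Set ℕ := fun g => {n | ∃ l : List G, (∀ x ∈ l, x ∈ S) ∧ l.prod = g ∧ l.length = n}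
  have hne : ∀ g, (L g).Nonempty := by
    intro g
    have hg : g ∈ (Subgroup.closure (S : Set G)).toSubmonoid := by simp [hgen]
    have hS : (S : Set G) ∪ (S : Set G)⁻¹ = S := Set.union_eq_left.2 fun x hx => by
      simpa using hsymm _ (Set.mem_inv.1 hx)
    rw [Subgroup.closure_toSubmonoid, hS] at hg
    obtain ⟨l, hl, hprod⟩ := Submonoid.exists_list_of_mem_closure hg
    exact ⟨l.length, l, hl, hprod, rfl⟩
  have hlen : ∀ s ∈ S, ∀ g, sInf (L (s * g)) ≤ sInf (L g) + 1 := by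
    intro s hs g
    obtain ⟨l, hl, hprod, hn⟩ := Nat.sInf_mem (hne g)
    refine Nat.sInf_le ⟨s :: l, ?_, by simp [hprod], by simp [hn]⟩
    simpa [hs] using hl
  refine ⟨fun g => sInf (L g), fun g => ⟨fun h => ?_, ?_⟩, hlen, fun g hg => ?_⟩
  · obtain ⟨l, -, hprod, hn⟩ := Nat.sInf_mem (hne g)
    have hl : l = [] := List.length_eq_zero_iff.1 (hn.trans h)
    simpa [hl] using hprod.symm
  · rintro rfl
    exact Nat.le_zero.1 (Nat.sInf_le ⟨[], by simp⟩)
  · obtain ⟨l, hl, hprod, hn⟩ := Nat.sInf_mem (hne g)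
    match l, hl, hprod, hn with
    | [], _, _, hn => exact absurd hn.symm hg
    | s :: l, hl, hprod, hn =>
      rw [List.forall_mem_cons] at hl
      rw [List.prod_cons] at hprod
      rw [List.length_cons] at hn
      refine ⟨s, hl.1, le_antisymm ?_ ?_⟩
      · have hmem : l.length ∈ L (s⁻¹ * g) := ⟨l, hl.2, by rw [← hprod]; group, rfl⟩
        exact (Nat.succ_le_succ (Nat.sInf_le hmem)).trans_eq hn
      · simpa using hlen s hl.1 (s⁻¹ * g)

theorem exists_sphere_card_le {G : Type*} [Group G] {S : Finset G} (hsymm : ∀ g ∈ S, g⁻¹ ∈ S)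
    {ℓ : G → ℕ} (hone : ∀ g, ℓ g = 0 ↔ g = 1)
    (hstep : ∀ g, ℓ g ≠ 0 → ∃ s ∈ S, ℓ (s⁻¹ * g) + 1 = ℓ g) (n : ℕ) :
    ∃ A : Finset G, (∀ g, g ∈ A ↔ ℓ g = n + 1) ∧ A.card ≤ S.card * (S.card - 1) ^ n := by
  classical
  induction n with
  | zero =>
    refine ⟨S.filter fun g => ℓ g = 1, fun g => ?_, by simpa using Finset.card_filter_le _ _⟩
    simp only [Finset.mem_filter, zero_add, and_iff_right_iff_imp]
    intro hg
    obtain ⟨s, hs, h⟩ := hstep g (by lia)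
    have h1 : s⁻¹ * g = 1 := (hone _).1 (by lia)
    rwa [← inv_mul_eq_one.1 h1]
  | succ n ih =>
    obtain ⟨A, hA, hcard⟩ := ih
    refine ⟨A.biUnion fun g => (S.image (· * g)).filter fun g' => ℓ g' = n + 1 + 1, fun g => ?_, ?_⟩
    · simp only [Finset.mem_biUnion, Finset.mem_filter, Finset.mem_image]
      refine ⟨fun ⟨_, _, _, h⟩ => h, fun hg => ?_⟩
      obtain ⟨s, hs, h⟩ := hstep g (by lia)
      exact ⟨s⁻¹ * g, (hA _).2 (by lia), ⟨s, hs, by group⟩, hg⟩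
    · refine (Finset.card_biUnion_le_card_mul A _ (S.card - 1) fun g hg => ?_).trans ?_
      · rw [hA] at hg
        obtain ⟨s, hs, h⟩ := hstep g (by lia)
        rw [← Finset.card_erase_of_mem (hsymm s hs)]
        refine (Finset.card_le_card fun x hx => ?_).trans
          (Finset.card_image_le (f := (· * g)))
        rw [Finset.mem_filter, Finset.mem_image] at hx
        obtain ⟨⟨t, ht, rfl⟩, hx⟩ := hx
        refine Finset.mem_image_of_mem _ (Finset.mem_erase.2 ⟨?_, ht⟩)
        rintro rfl
        lia
      · rw [pow_succ, ← mul_assoc]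
        exact Nat.mul_le_mul_right _ hcard

open scoped ENNReal in
theorem tsum_pow_length_lt_top {G : Type*} [Group G] {S : Finset G} (hsymm : ∀ g ∈ S, g⁻¹ ∈ S)
    {ℓ : G → ℕ} (hone : ∀ g, ℓ g = 0 ↔ g = 1)
    (hstep : ∀ g, ℓ g ≠ 0 → ∃ s ∈ S, ℓ (s⁻¹ * g) + 1 = ℓ g) {r : ℝ≥0∞} (hr : r ≠ ∞)
    (hlt : ((S.card - 1 : ℕ) : ℝ≥0∞) * r < 1) : ∑' g, r ^ ℓ g < ∞ := by
  have hfiber : ∀ n, ∑' g : ℓ ⁻¹' {n}, r ^ ℓ (g : G) = (ℓ ⁻¹' {n}).encard * r ^ n := by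
    intro n
    rw [← ENNReal.tsum_set_const]
    exact tsum_congr fun g => by rw [show ℓ (g : G) = n from g.2]
  rw [← ENNReal.tsum_fiberwise _ ℓ, tsum_congr hfiber, tsum_eq_zero_add' ENNReal.summable]
  have hzero : ℓ ⁻¹' {0} = {1} := by
    ext g
    simp [hone]
  refine ENNReal.add_lt_top.2 ⟨by simp [hzero], ?_⟩
  calc ∑' n, ((ℓ ⁻¹' {n + 1}).encard : ℝ≥0∞) * r ^ (n + 1)
      ≤ ∑' n, S.card * r * (((S.card - 1 : ℕ) : ℝ≥0∞) * r) ^ n := by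
        refine ENNReal.tsum_le_tsum fun n => ?_
        obtain ⟨A, hA, hcard⟩ := exists_sphere_card_le hsymm hone hstep n
        have hset : ℓ ⁻¹' {n + 1} = A := by
          ext g
          simp [hA]
        rw [hset, Set.encard_coe_eq_coe_finsetCard]
        calc ((A.card : ℕ∞) : ℝ≥0∞) * r ^ (n + 1)
            ≤ ((S.card * (S.card - 1) ^ n : ℕ) : ℝ≥0∞) * r ^ (n + 1) := by
              rw [ENat.toENNReal_coe]
              gcongr
          _ = _ := by
              rw [Nat.cast_mul, Nat.cast_pow]
              ring
    _ < ∞ := by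
        rw [ENNReal.tsum_mul_left, ENNReal.tsum_geometric]
        refine ENNReal.mul_lt_top (ENNReal.mul_lt_top (by simp) hr.lt_top) ?_
        exact ENNReal.inv_lt_top.2 (tsub_pos_of_lt hlt)

namespace UnitAddCircle

instance : NullSingletonClass (volume : Measure (AddCircle (1 : ℝ))) :=
  ⟨fun x => by simpa using AddCircle.volume_closedBall (1 : ℝ) (x := x) 0⟩

open scoped ENNReal in
theorem exists_quasiInvariant_measure {G : Type*} [Group G]
    (φ : G →* Equiv.Perm (AddCircle (1 : ℝ))) (hcont : ∀ g : G, Continuous (φ g))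
    {S : Finset G} (hsymm : ∀ g ∈ S, g⁻¹ ∈ S) (hgen : Subgroup.closure (S : Set G) = ⊤)
    {K : ℝ≥0∞} (hK : 1 ≤ K) (hKtop : K ≠ ∞) (hlt : ((S.card - 1 : ℕ) : ℝ≥0∞) < K) :
    ∃ ν : Measure (AddCircle (1 : ℝ)), IsProbabilityMeasure ν ∧ NullSingletonClass ν ∧
      ν.IsOpenPosMeasure ∧ ∀ s ∈ S, ∀ A, MeasurableSet A → ν (φ s ⁻¹' A) ≤ K * ν A := by
  obtain ⟨ℓ, hone, hmul, hstep⟩ := exists_length_of_closure_eq_top S hsymm hgen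
  have hK0 : K ≠ 0 := (zero_lt_one.trans_le hK).ne'
  let ν := Measure.sum fun g => (K⁻¹ ^ ℓ g) • (volume : Measure (AddCircle (1 : ℝ))).map (φ g)
  have hν : ∀ A, MeasurableSet A → ν A = ∑' g, K⁻¹ ^ ℓ g * volume (φ g ⁻¹' A) := by
    intro A hA
    rw [Measure.sum_apply _ hA]
    refine tsum_congr fun g => ?_
    rw [Measure.smul_apply, Measure.map_apply (hcont g).measurable hA, smul_eq_mul]
  have huniv : ν Set.univ ≠ ∞ := by
    rw [hν _ MeasurableSet.univ]
    refine ne_of_lt ?_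
    convert tsum_pow_length_lt_top hsymm hone hstep (ENNReal.inv_ne_top.2 hK0) ?_ using 3
    · simp
    · rw [← div_eq_mul_inv]
      exact ENNReal.div_lt_of_lt_mul (by rwa [one_mul])
  have hfin : IsFiniteMeasure ν := ⟨huniv.lt_top⟩
  have hvol : volume ≤ ν := by
    refine Measure.le_iff.2 fun A hA => ?_
    rw [hν A hA]
    refine le_trans (le_of_eq ?_) (ENNReal.le_tsum 1)
    simp [(hone 1).2 rfl]
  have hne : NeZero ν := ⟨fun h => by
    have := hvol Set.univ
    simp [h] at this⟩
  have hnull : NullSingletonClass ν := ⟨fun x => by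
    rw [hν _ (measurableSet_singleton x), ENNReal.tsum_eq_zero]
    intro g
    rw [(Set.subsingleton_singleton.preimage (φ g).injective).measure_zero volume,
      mul_zero]⟩
  have hpos : ν.IsOpenPosMeasure := (Measure.absolutelyContinuous_of_le hvol).isOpenPosMeasure
  have hquasi : ∀ s ∈ S, ∀ A, MeasurableSet A → ν (φ s ⁻¹' A) ≤ K * ν A := by
    intro s hs A hA
    rw [hν A hA, hν _ (hA.preimage (hcont s).measurable), ← ENNReal.tsum_mul_left,
      ← (Equiv.mulLeft s).tsum_eq fun g => K * (K⁻¹ ^ ℓ g * volume (φ g ⁻¹' A))]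
    refine ENNReal.tsum_le_tsum fun g => ?_
    rw [Equiv.coe_mulLeft, map_mul, Equiv.Perm.coe_mul, Set.preimage_comp, ← mul_assoc]
    gcongr
    calc K⁻¹ ^ ℓ g = K * K⁻¹ ^ (ℓ g + 1) := by
          rw [pow_succ', ← mul_assoc, ENNReal.mul_inv_cancel hK0 hKtop, one_mul]
      _ ≤ K * K⁻¹ ^ ℓ (s * g) := by
          gcongr K * ?_
          exact pow_le_pow_right_of_le_one' (ENNReal.inv_le_one.2 hK) (hmul s hs g)
  refine ⟨(ν Set.univ)⁻¹ • ν, inferInstance, ?_, ?_, fun s hs A hA => ?_⟩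
  · exact ⟨fun x => by simp⟩
  · exact Measure.isOpenPosMeasure_smul ν (ENNReal.inv_ne_zero.2 huniv)
  · simp only [Measure.smul_apply, smul_eq_mul]
    rw [mul_left_comm]
    gcongr
    exact hquasi s hs A hA

end UnitAddCircle

/-- A group acting by homeomorphisms on the circle `AddCircle ℝ 1`,
generated by a finite symmetric set `S` of cardinality `k ≥ 2`, is topologically conjugate
to a group of Lipschitz homeomorphisms: for every `ε > log (k-1)` there is a homeomorphism
`h` of the circle such that every conjugate `h ∘ g ∘ h⁻¹`, `g ∈ S`, is Lipschitz with
constant at most `exp ε`. -/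
theorem lipschitz_conjugate_of_finitely_generated_circle_action
    {G : Type*} [Group G] (φ : G →* Equiv.Perm (AddCircle (1 : ℝ)))
    (hcont : ∀ g : G, Continuous (φ g))
    (S : Finset G) (hsymm : ∀ g ∈ S, g⁻¹ ∈ S)
    (hgen : Subgroup.closure (S : Set G) = ⊤)
    (k : ℕ) (hk : 2 ≤ k) (hcard : S.card = k) :
    ∀ ε : ℝ, Real.log ((k : ℝ) - 1) < ε →
      ∃ h : AddCircle (1 : ℝ) ≃ₜ AddCircle (1 : ℝ),
        ∀ g ∈ S, LipschitzWith (Real.exp ε).toNNReal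
          (fun x => h (φ g (h.symm x))) := by
  intro ε hε
  have hk1 : (1 : ℝ) ≤ (k : ℝ) - 1 := by
    have : (2 : ℝ) ≤ k := by exact_mod_cast hk
    linarith
  have hkε : (k : ℝ) - 1 < Real.exp ε := (Real.log_lt_iff_lt_exp (by linarith)).1 hε
  have hK : 1 ≤ ENNReal.ofReal (Real.exp ε) := ENNReal.one_le_ofReal.2 (by linarith)
  have hlt : ((S.card - 1 : ℕ) : ENNReal) < ENNReal.ofReal (Real.exp ε) := by
    rw [← ENNReal.ofReal_natCast, ENNReal.ofReal_lt_ofReal_iff (Real.exp_pos ε), hcard,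
      Nat.cast_sub (by lia), Nat.cast_one]
    exact hkε
  obtain ⟨ν, hprob, hnull, hpos, hquasi⟩ := UnitAddCircle.exists_quasiInvariant_measure φ hcont
    hsymm hgen hK ENNReal.ofReal_ne_top hlt
  obtain ⟨h, hh⟩ := UnitAddCircle.exists_homeomorph_map_eq_volume ν
  have hvol : ∀ A, MeasurableSet A → volume A = ν (h ⁻¹' A) := fun A hA => by
    rw [← hh, Measure.map_apply h.continuous.measurable hA]
  refine ⟨h, fun g hg x y => ?_⟩
  obtain ⟨D, hconn, hcomp, hx, hy, hD⟩ := UnitAddCircle.exists_isPreconnected_volume_le_dist x y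
  have hf : Continuous fun x => h (φ g (h.symm x)) :=
    h.continuous.comp ((hcont g).comp h.symm.continuous)
  have hpre : h ⁻¹' ((fun x => h (φ g (h.symm x))) '' D) = φ g⁻¹ ⁻¹' (h ⁻¹' D) := by
    ext z
    simp only [Set.mem_preimage, Set.mem_image, EmbeddingLike.apply_eq_iff_eq, map_inv]
    constructor
    · rintro ⟨w, hw, rfl⟩
      simpa using hw
    · intro hz
      exact ⟨_, hz, by simp⟩
  calc edist (h (φ g (h.symm x))) (h (φ g (h.symm y)))
      = ENNReal.ofReal (dist (h (φ g (h.symm x))) (h (φ g (h.symm y)))) := edist_dist _ _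
    _ ≤ volume ((fun x => h (φ g (h.symm x))) '' D) :=
        UnitAddCircle.dist_le_volume_of_isPreconnected (hconn.image _ hf.continuousOn)
          ⟨x, hx, rfl⟩ ⟨y, hy, rfl⟩
    _ = ν (φ g⁻¹ ⁻¹' (h ⁻¹' D)) := by rw [hvol _ (hcomp.image hf).measurableSet, hpre]
    _ ≤ ENNReal.ofReal (Real.exp ε) * ν (h ⁻¹' D) :=
        hquasi _ (hsymm g hg) _ (hcomp.measurableSet.preimage h.continuous.measurable)
    _ = ENNReal.ofReal (Real.exp ε) * volume D := by rw [hvol D hcomp.measurableSet]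
    _ ≤ ENNReal.ofReal (Real.exp ε) * ENNReal.ofReal (dist x y) := by gcongr
    _ = (Real.exp ε).toNNReal * edist x y := by rw [edist_dist, ENNReal.ofReal]
end

section
/- Let G be a countable group acting by homeomorphisms on the circle AddCircle ℝ 1, generated by a finite symmetric set S, and let ‖·‖ be the word length with respect to S. Fix ε > 0 and let μ̄_ε be the Borel measure on the circle defined as the sum over f ∈ G of e^{−ε‖f‖} times the pushforward f_*(Leb) of the Haar (Lebesgue) measure Leb by f. Then for every generator g ∈ S one has the inequality of measures g_*(μ̄_ε) ≤ e^ε · μ̄_ε. -/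
open MeasureTheory

/-- The word length of `f` with respect to a generating set `S`: the least `n` such that
`f` is a product of `n` elements of `S` (with the empty product giving `‖1‖ = 0`). -/
noncomputable def wordLength {G : Type*} [Group G] (S : Set G) (f : G) : ℕ :=
  sInf {n | ∃ l : List G, l.length = n ∧ (∀ x ∈ l, x ∈ S) ∧ l.prod = f}

/-- Every element of a group generated by a symmetric set `S` is spelled by a word in `S` of
length `wordLength S f`. -/
theorem exists_list_length_eq_wordLength {G : Type*} [Group G] {S : Set G}
    (hsymm : ∀ g ∈ S, g⁻¹ ∈ S) (hgen : Subgroup.closure S = ⊤) (f : G) :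
    ∃ l : List G, l.length = wordLength S f ∧ (∀ x ∈ l, x ∈ S) ∧ l.prod = f := by
  have hf : f ∈ Submonoid.closure (S ∪ S⁻¹) := by
    rw [← Subgroup.closure_toSubmonoid, hgen]
    trivial
  obtain ⟨l, hl, hprod⟩ := Submonoid.exists_list_of_mem_closure hf
  refine Nat.sInf_mem (s := {n | ∃ l : List G, l.length = n ∧ (∀ x ∈ l, x ∈ S) ∧ l.prod = f})
    ⟨l.length, l, rfl, fun x hx => ?_, hprod⟩
  rcases hl x hx with h | h
  · exact h
  · simpa using hsymm _ h

/-- Multiplying by a generator on the left increases the word length by at most one. -/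
theorem wordLength_mul_le_add_one {G : Type*} [Group G] {S : Set G}
    (hsymm : ∀ g ∈ S, g⁻¹ ∈ S) (hgen : Subgroup.closure S = ⊤) {g : G} (hg : g ∈ S) (f : G) :
    wordLength S (g * f) ≤ wordLength S f + 1 := by
  obtain ⟨l, hlen, hl, hprod⟩ := exists_list_length_eq_wordLength hsymm hgen f
  exact Nat.sInf_le ⟨g :: l, by simp [hlen], by simpa using ⟨hg, hl⟩, by simp [hprod]⟩

/-- For a countable group acting by homeomorphisms on the circle with
finite symmetric generating set `S`, word length `‖·‖` and `ε > 0`, the measure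
`μ̄_ε := ∑_{f ∈ G} e^{-ε ‖f‖} f_*(Leb)` satisfies `g_*(μ̄_ε) ≤ e^ε μ̄_ε` for every
generator `g ∈ S`. -/
theorem pushforward_sum_measure_le
    {G : Type*} [Group G] [Countable G]
    (φ : G →* Equiv.Perm (AddCircle (1 : ℝ)))
    (hcont : ∀ g : G, Continuous (φ g))
    (S : Finset G) (hsymm : ∀ g ∈ S, g⁻¹ ∈ S)
    (hgen : Subgroup.closure (S : Set G) = ⊤)
    (ε : ℝ) (hε : 0 < ε)
    (μbar : Measure (AddCircle (1 : ℝ)))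
    (hμbar : μbar = Measure.sum fun f : G =>
      ENNReal.ofReal (Real.exp (-ε * wordLength (S : Set G) f)) •
        Measure.map (φ f) volume) :
    ∀ g ∈ S, Measure.map (φ g) μbar ≤ ENNReal.ofReal (Real.exp ε) • μbar := by
  intro g hg
  have hmeas : ∀ f : G, Measurable (φ f) := fun f => (hcont f).measurable
  refine Measure.le_iff.2 fun A hA => ?_
  have hgA : MeasurableSet (φ g ⁻¹' A) := hmeas g hA
  rw [Measure.map_apply (hmeas g) hA, hμbar, Measure.smul_apply, Measure.sum_apply _ hgA,
    Measure.sum_apply _ hA, smul_eq_mul, ← ENNReal.tsum_mul_left]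
  conv_rhs => rw [← (Equiv.mulLeft g).tsum_eq]
  refine ENNReal.tsum_le_tsum fun f => ?_
  have hpre : φ (g * f) ⁻¹' A = φ f ⁻¹' (φ g ⁻¹' A) := by
    rw [map_mul, Equiv.Perm.coe_mul, Set.preimage_comp]
  simp only [Equiv.coe_mulLeft, Measure.smul_apply, smul_eq_mul]
  rw [Measure.map_apply (hmeas _) hgA, Measure.map_apply (hmeas _) hA, hpre, ← mul_assoc,
    ← ENNReal.ofReal_mul (Real.exp_nonneg _), ← Real.exp_add]
  gcongr
  have hlen : (wordLength (S : Set G) (g * f) : ℝ) ≤ wordLength (S : Set G) f + 1 := by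
    exact_mod_cast wordLength_mul_le_add_one hsymm hgen hg f
  nlinarith
end

section
/- Let μ be a Borel probability measure on the circle AddCircle ℝ 1 that has no atoms and has full topological support. Then there exists a homeomorphism h of the circle such that the pushforward h_*(μ) equals the Haar (Lebesgue) probability measure. -/
open MeasureTheory Set Filter ProbabilityTheory

theorem ProbabilityTheory.continuous_cdf_of_nullSingletonClass (ν : Measure ℝ)
    [IsProbabilityMeasure ν] [NullSingletonClass ν] : Continuous (cdf ν) := by
  refine continuous_iff_continuousAt.2 fun a ↦ continuousAt_iff_continuous_left'_right'.2
    ⟨?_, ((cdf ν).right_continuous a).mono Ioi_subset_Ici_self⟩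
  rw [(cdf ν).mono.continuousWithinAt_Iio_iff_leftLim_eq]
  have h : (cdf ν).measure {a} = 0 := by rw [measure_cdf, measure_singleton]
  rw [StieltjesFunction.measure_singleton, ENNReal.ofReal_eq_zero] at h
  linarith [(cdf ν).mono.leftLim_le (le_refl a)]

/-- The probability integral transform: an atomless law is sent to the uniform law on `(0, 1]` by
its cumulative distribution function. -/
theorem ProbabilityTheory.map_cdf_eq_restrict_volume (ν : Measure ℝ) [IsProbabilityMeasure ν]
    [NullSingletonClass ν] : ν.map (cdf ν) = volume.restrict (Ioc 0 1) := by
  have hcont := continuous_cdf_of_nullSingletonClass ν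
  have : IsProbabilityMeasure (ν.map (cdf ν)) :=
    Measure.isProbabilityMeasure_map hcont.measurable.aemeasurable
  refine Measure.ext_of_Iic _ _ fun t ↦ ?_
  rw [Measure.map_apply hcont.measurable measurableSet_Iic,
    Measure.restrict_apply measurableSet_Iic, inter_comm, Ioc_inter_Iic, Real.volume_Ioc, sub_zero]
  rcases le_or_gt 1 t with ht | ht
  · have h : cdf ν ⁻¹' Iic t = univ := eq_univ_of_forall fun x ↦ (cdf_le_one ν x).trans ht
    simp [h, ht]
  rw [min_eq_right ht.le]
  rcases (cdf ν ⁻¹' Iic t).eq_empty_or_nonempty with h | h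
  · have ht0 : t ≤ 0 := by
      by_contra! ht0
      obtain ⟨x, hx⟩ := ((tendsto_cdf_atBot ν).eventually_le_const ht0).exists
      exact (h ▸ hx : x ∈ (∅ : Set ℝ))
    rw [h, measure_empty, ENNReal.ofReal_of_nonpos ht0]
  obtain ⟨b, hb⟩ := ((tendsto_cdf_atTop ν).eventually_const_lt ht).exists
  have hbdd : BddAbove (cdf ν ⁻¹' Iic t) :=
    ⟨b, fun x hx ↦ le_of_not_gt fun hbx ↦ (hb.trans_le (monotone_cdf ν hbx.le)).not_ge hx⟩
  have hmem := (isClosed_Iic.preimage hcont).csSup_mem h hbdd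
  set m := sSup (cdf ν ⁻¹' Iic t)
  have hIic : cdf ν ⁻¹' Iic t = Iic m :=
    Subset.antisymm (fun x hx ↦ le_csSup hbdd hx) fun x hx ↦ (monotone_cdf ν hx).trans hmem
  obtain ⟨x, hx⟩ := mem_range_of_exists_le_of_exists_ge hcont h ⟨b, hb.le⟩
  have hxm : x ≤ m := le_csSup hbdd hx.le
  rw [hIic, ← ofReal_cdf, le_antisymm hmem (hx.symm.trans_le (monotone_cdf ν hxm))]

/-- Every atomless Borel probability measure of full support on the circle
`AddCircle ℝ 1` is the pushforward image, under some homeomorphism of the circle, of the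
Haar (Lebesgue) probability measure: there is a homeomorphism `h` with `h_*(μ) = Leb`. -/
theorem exists_homeomorph_map_eq_haar_of_atomless_fullSupport
    (μ : Measure (AddCircle (1 : ℝ))) [IsProbabilityMeasure μ]
    (hatoms : ∀ x : AddCircle (1 : ℝ), μ {x} = 0)
    (hsupp : ∀ U : Set (AddCircle (1 : ℝ)), IsOpen U → U.Nonempty → 0 < μ U) :
    ∃ h : AddCircle (1 : ℝ) ≃ₜ AddCircle (1 : ℝ),
      Measure.map h μ = volume := by
  let g : AddCircle (1 : ℝ) → ℝ := fun x ↦ AddCircle.equivIoc 1 0 x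
  have hg_meas : Measurable g :=
    measurable_subtype_coe.comp (AddCircle.measurableEquivIoc (1 : ℝ) 0).measurable
  have hg_mem (x) : g x ∈ Ioc (0 : ℝ) 1 := by
    simpa using (AddCircle.equivIoc (1 : ℝ) 0 x).2
  have hg_inj : Function.Injective g :=
    Subtype.val_injective.comp (AddCircle.equivIoc (1 : ℝ) 0).injective
  have hg_coe {y : ℝ} (hy : y ∈ Ioc (0 : ℝ) 1) : g y = y :=
    congrArg Subtype.val (AddCircle.equivIoc_coe_eq (p := (1 : ℝ)) (a := 0) (by simpa using hy))
  let ν := μ.map g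
  have : IsProbabilityMeasure ν := Measure.isProbabilityMeasure_map hg_meas.aemeasurable
  have : NullSingletonClass ν := ⟨fun x ↦ by
    rw [Measure.map_apply hg_meas (measurableSet_singleton x)]
    exact (subsingleton_singleton.preimage hg_inj).induction_on (p := (μ · = 0))
      measure_empty hatoms⟩
  have hcont : Continuous (cdf ν) := continuous_cdf_of_nullSingletonClass ν
  have h0 : cdf ν 0 = 0 := by
    have h : g ⁻¹' Iic 0 = ∅ := eq_empty_of_forall_notMem fun x hx ↦ (hg_mem x).1.not_ge hx
    rw [cdf_eq_real, map_measureReal_apply hg_meas measurableSet_Iic, h, measureReal_empty]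
  have h1 : cdf ν 1 = 1 := by
    have h : g ⁻¹' Iic 1 = univ := eq_univ_of_forall fun x ↦ (hg_mem x).2
    rw [cdf_eq_real, map_measureReal_apply hg_meas measurableSet_Iic, h, probReal_univ]
  have hmono : StrictMonoOn (cdf ν) (Icc 0 1) := by
    intro x hx y hy hxy
    have hpos : 0 < ν (Ioc x y) := by
      rw [Measure.map_apply hg_meas measurableSet_Ioc]
      refine (hsupp ((↑) '' Ioo x y) (QuotientAddGroup.isOpenMap_coe _ isOpen_Ioo)
        ((nonempty_Ioo.2 hxy).image _)).trans_le (measure_mono ?_)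
      rintro _ ⟨z, hz, rfl⟩
      rw [mem_preimage, hg_coe ⟨hx.1.trans_lt hz.1, hz.2.le.trans hy.2⟩]
      exact Ioo_subset_Ioc_self hz
    rw [← measure_cdf ν, StieltjesFunction.measure_Ioc, ENNReal.ofReal_pos] at hpos
    exact sub_pos.1 hpos
  have hmaps {y : ℝ} (hy : y ∈ Ioc (0 : ℝ) 1) : cdf ν y ∈ Ioc (0 : ℝ) 1 :=
    ⟨h0 ▸ hmono (by simp) (Ioc_subset_Icc_self hy) hy.1, cdf_le_one ν y⟩
  let f : AddCircle (1 : ℝ) → AddCircle (1 : ℝ) := fun x ↦ (cdf ν (g x) : ℝ)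
  have hf_cont : Continuous f :=
    AddCircle.liftIoc_zero_continuous (p := (1 : ℝ))
      (f := fun y ↦ ((cdf ν y : ℝ) : AddCircle (1 : ℝ)))
      (by simp [h0, h1, AddCircle.coe_period])
      ((AddCircle.continuous_mk' 1).comp hcont).continuousOn
  have hf_inj : Function.Injective f := by
    intro x y hxy
    have h := congrArg g hxy
    rw [hg_coe (hmaps (hg_mem x)), hg_coe (hmaps (hg_mem y))] at h
    exact hg_inj (hmono.injOn (Ioc_subset_Icc_self (hg_mem x)) (Ioc_subset_Icc_self (hg_mem y)) h)
  have hf_surj : Function.Surjective f := by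
    intro z
    obtain ⟨t, ht, rfl⟩ := AddCircle.eq_coe_Ioc z
    obtain ⟨y, hy, rfl⟩ := intermediate_value_Ioc zero_le_one hcont.continuousOn
      (by rwa [h0, h1] : t ∈ Ioc (cdf ν 0) (cdf ν 1))
    exact ⟨y, by simp only [f, hg_coe hy]⟩
  refine ⟨(isHomeomorph_iff_continuous_bijective.2 ⟨hf_cont, hf_inj, hf_surj⟩).homeomorph, ?_⟩
  change μ.map ((fun y : ℝ ↦ (y : AddCircle (1 : ℝ))) ∘ cdf ν ∘ g) = volume
  rw [← Measure.map_map AddCircle.measurable_mk' (hcont.measurable.comp hg_meas),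
    ← Measure.map_map hcont.measurable hg_meas, map_cdf_eq_restrict_volume]
  simpa using (AddCircle.measurePreserving_mk (1 : ℝ) 0).map_eq
end

section
/- Let g be a homeomorphism of the circle AddCircle ℝ 1 and let C ≥ 1 be a real number such that the pushforward g_*(Leb) of the Haar (Lebesgue) measure satisfies g_*(Leb) ≤ C·Leb as measures. Then the inverse homeomorphism g⁻¹ is Lipschitz with Lipschitz constant C. -/
open MeasureTheory

namespace AddCircle

theorem norm_coe_le_abs (T t : ℝ) : ‖(t : AddCircle T)‖ ≤ |t| :=
  QuotientAddGroup.norm_mk_le_norm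

theorem lipschitzWith_coe (T : ℝ) : LipschitzWith 1 ((↑) : ℝ → AddCircle T) :=
  LipschitzWith.of_dist_le_mul fun s t => by
    rw [dist_eq_norm, ← coe_sub, NNReal.coe_one, one_mul, Real.dist_eq]
    exact norm_coe_le_abs T (s - t)

/-- A connected measurable subset of the circle has measure at least the distance between any two
of its points. -/
theorem ofReal_dist_le_volume {T : ℝ} [hT : Fact (0 < T)] {s : Set (AddCircle T)}
    (hs : IsPreconnected s) (hm : MeasurableSet s) {x y : AddCircle T} (hx : x ∈ s) (hy : y ∈ s) :
    ENNReal.ofReal (dist x y) ≤ volume s := by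
  set A : Set ℝ := ((↑) : ℝ → AddCircle T) ⁻¹' s ∩ Set.Ioc 0 (0 + T)
  have hlip : LipschitzWith 1 (fun t : ℝ => dist (t : AddCircle T) x) := by
    simpa [Function.comp_def] using (LipschitzWith.dist_left x).comp (lipschitzWith_coe T)
  have hsub : Set.Icc 0 (dist x y) ⊆ (fun t : ℝ => dist (t : AddCircle T) x) '' A := by
    intro r hr
    have hmem : r ∈ (fun z => dist z x) '' s :=
      hs.intermediate_value hx hy (by fun_prop) (by simpa [dist_comm] using hr)
    obtain ⟨z, hz, rfl⟩ := hmem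
    have hz' : z ∈ ((↑) : ℝ → AddCircle T) '' Set.Ioc 0 (0 + T) := by
      rw [coe_image_Ioc_eq]
      trivial
    obtain ⟨t, ht, rfl⟩ := hz'
    exact ⟨t, ⟨hz, ht⟩, rfl⟩
  calc ENNReal.ofReal (dist x y) = volume (Set.Icc 0 (dist x y)) := by simp
    _ ≤ volume ((fun t : ℝ => dist (t : AddCircle T) x) '' A) := measure_mono hsub
    _ ≤ volume A := by
      simpa [← hausdorffMeasure_real] using hlip.hausdorffMeasure_image_le zero_le_one A
    _ = volume s := (add_projection_respects_measure T 0 hm).symm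

/-- Any two points of the circle lie on a compact arc of measure at most their distance. -/
theorem exists_isCompact_isPreconnected_volume_le {T : ℝ} [hT : Fact (0 < T)] (x y : AddCircle T) :
    ∃ s : Set (AddCircle T), IsCompact s ∧ IsPreconnected s ∧ x ∈ s ∧ y ∈ s ∧
      volume s ≤ ENNReal.ofReal (dist x y) := by
  obtain ⟨a, rfl⟩ := QuotientAddGroup.mk_surjective x
  obtain ⟨b₀, rfl⟩ := QuotientAddGroup.mk_surjective y
  obtain ⟨b, hb, hab⟩ : ∃ b : ℝ, (b : AddCircle T) = b₀ ∧
      dist (a : AddCircle T) b₀ = |a - b| := by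
    refine ⟨b₀ + round (T⁻¹ * (a - b₀)) * T, ?_, ?_⟩
    · rw [coe_add, add_eq_left, coe_eq_zero_iff]
      exact ⟨_, zsmul_eq_mul _ _⟩
    · rw [dist_eq_norm, ← coe_sub, norm_eq, sub_add_eq_sub_sub]
  refine ⟨(↑) '' Set.uIcc a b, isCompact_uIcc.image (AddCircle.continuous_mk' T),
    isPreconnected_uIcc.image _ (AddCircle.continuous_mk' T).continuousOn,
    ⟨a, Set.left_mem_uIcc, rfl⟩, ⟨b, Set.right_mem_uIcc, hb⟩, ?_⟩
  have hsub : ((↑) : ℝ → AddCircle T) '' Set.uIcc a b ⊆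
      Metric.closedBall (((a + b) / 2 : ℝ) : AddCircle T) (|a - b| / 2) := by
    rintro _ ⟨t, ht, rfl⟩
    rw [Metric.mem_closedBall, dist_eq_norm, ← coe_sub]
    refine (norm_coe_le_abs T _).trans ?_
    rcases Set.mem_uIcc.1 ht with h | h <;> rw [abs_le] <;>
      constructor <;> cases abs_cases (a - b) <;> linarith
  refine (measure_mono hsub).trans ?_
  rw [volume_closedBall]
  refine ENNReal.ofReal_le_ofReal ((min_le_right _ _).trans ?_)
  exact (mul_div_cancel₀ _ two_ne_zero).le.trans hab.ge

end AddCircle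

/-- If a homeomorphism `g` of the circle `AddCircle ℝ 1` satisfies
`g_*(Leb) ≤ C · Leb` for some real `C ≥ 1`, then `g⁻¹` is Lipschitz with constant `C`. -/
theorem lipschitzWith_symm_of_map_volume_le
    (g : AddCircle (1 : ℝ) ≃ₜ AddCircle (1 : ℝ)) (C : ℝ) (hC : 1 ≤ C)
    (h : Measure.map g volume ≤ ENNReal.ofReal C • volume) :
    LipschitzWith C.toNNReal ⇑g.symm := by
  intro x y
  obtain ⟨s, hsc, hsp, hx, hy, hvol⟩ := AddCircle.exists_isCompact_isPreconnected_volume_le x y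
  rw [edist_dist, edist_dist]
  calc ENNReal.ofReal (dist (g.symm x) (g.symm y))
      ≤ volume (g.symm '' s) :=
        AddCircle.ofReal_dist_le_volume (hsp.image _ g.symm.continuous.continuousOn)
          (hsc.image g.symm.continuous).measurableSet ⟨x, hx, rfl⟩ ⟨y, hy, rfl⟩
    _ = Measure.map g volume s := by
      rw [Measure.map_apply g.continuous.measurable hsc.measurableSet, g.image_symm]
    _ ≤ ENNReal.ofReal C * volume s := by simpa using h s
    _ ≤ C.toNNReal * ENNReal.ofReal (dist x y) := mul_le_mul_right hvol _
end

section
/- Every homeomorphism of the circle AddCircle ℝ 1 has zero topological entropy. -/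
open Dynamics

open Filter Set Topology

/-- A map with finitely many values, each of whose fibers consists of points that remain
`U`-close up to time `n`, bounds the minimal cardinality of a dynamical cover. -/
lemma coverMincard_univ_le_of_fiber_subset {X : Type*} (T : X → X) (U : SetRel X X) (n m : ℕ)
    (φ : X → ℕ) (hφ : ∀ x, φ x < m) (h : ∀ x y, φ x = φ y → (x, y) ∈ dynEntourage T U n) :
    coverMincard T univ U n ≤ m := by
  classical
  obtain _ | ⟨⟨x₀⟩⟩ := isEmpty_or_nonempty X
  · rw [univ_eq_empty_iff.2 ‹_›, coverMincard_empty]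
    exact zero_le
  let g : ℕ → X := fun i ↦ if hi : ∃ x, φ x = i then hi.choose else x₀
  have hg (x : X) : φ (g (φ x)) = φ x := by
    have hi : ∃ y, φ y = φ x := ⟨x, rfl⟩
    simpa only [g, dif_pos hi] using hi.choose_spec
  have hcover : IsDynCoverOf T univ U n ((Finset.range m).image g : Finset X) := fun x _ ↦
    ⟨g (φ x), by simpa using ⟨φ x, hφ x, rfl⟩, h _ _ (hg x).symm⟩
  refine hcover.coverMincard_le_card.trans ?_
  exact_mod_cast Finset.card_image_le.trans_eq (Finset.card_range m)

/-- A sequence bounded by an affine function of `n` has nonpositive exponential growth rate. -/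
lemma expGrowthSup_nonpos_of_le_affine (u : ℕ → ENNReal) (C : ℕ)
    (h : ∀ n, u n ≤ ((C * n + 1 : ℕ) : ENNReal)) : ExpGrowth.expGrowthSup u ≤ 0 := by
  rw [ExpGrowth.expGrowthSup_le_iff]
  intro b hb
  obtain ⟨c, hc, hcb⟩ := EReal.lt_iff_exists_real_btwn.1 hb
  have hc0 : 0 < c := by exact_mod_cast hc
  filter_upwards [eventually_ge_atTop ⌈2 * C / c ^ 2⌉₊] with n hn
  have hn' : 2 * C / c ^ 2 ≤ n := Nat.ceil_le.1 hn
  rw [div_le_iff₀ (by positivity)] at hn'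
  have hexp := Real.quadratic_le_exp_of_nonneg (x := c * n) (by positivity)
  have hreal : ((C * n + 1 : ℕ) : ℝ) ≤ Real.exp (c * n) := by
    push_cast
    nlinarith [mul_le_mul_of_nonneg_right hn' n.cast_nonneg,
      mul_nonneg hc0.le (n.cast_nonneg' (α := ℝ))]
  calc u n ≤ ((C * n + 1 : ℕ) : ENNReal) := h n
    _ = ENNReal.ofReal ((C * n + 1 : ℕ) : ℝ) := (ENNReal.ofReal_natCast _).symm
    _ ≤ ENNReal.ofReal (Real.exp (c * n)) := ENNReal.ofReal_le_ofReal hreal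
    _ = EReal.exp ((c : EReal) * n) := by
      rw [← EReal.exp_coe]
      push_cast
      rfl
    _ ≤ EReal.exp (b * n) := by gcongr

/-- The points of a finite set `Q` partition a linear order into at most `2 * #Q + 1` points and
intervals: there is a labelling such that an interval between two points with the same label
avoids `Q`. -/
lemma exists_label_of_finset {α : Type*} [LinearOrder α] (Q : Finset α) :
    ∃ s : α → ℕ, (∀ x, s x < 2 * Q.card + 1) ∧
      ∀ x y, x < y → s x = s y → ∀ q ∈ Icc x y, q ∉ Q := by
  refine ⟨fun x ↦ (Q.filter (· ≤ x)).card + (Q.filter (· < x)).card, fun x ↦ ?_, ?_⟩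
  · have h₁ := Finset.card_filter_le Q (· ≤ x)
    have h₂ := Finset.card_filter_le Q (· < x)
    change _ + _ < _
    omega
  · intro x y hxy hs q hq hqQ
    have hle : Q.filter (· ≤ x) ⊆ Q.filter (· ≤ y) :=
      Finset.monotone_filter_right _ fun _ _ h ↦ h.trans hxy.le
    have hlt : Q.filter (· < x) ⊆ Q.filter (· < y) :=
      Finset.monotone_filter_right _ fun _ _ h ↦ h.trans hxy
    have hcle := Finset.card_le_card hle
    have hclt := Finset.card_le_card hlt
    have hele := Finset.eq_of_subset_of_card_le hle (by simp only at hs; omega)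
    have helt := Finset.eq_of_subset_of_card_le hlt (by simp only at hs; omega)
    rcases hq.1.eq_or_lt with rfl | hxq
    · have : x ∈ Q.filter (· < y) := by simp [hqQ, hxy]
      simp [← helt] at this
    · have : q ∈ Q.filter (· ≤ y) := by simp [hqQ, hq.2]
      rw [← hele] at this
      exact (Finset.mem_filter.1 this).2.not_gt hxq

lemma continuousAt_intFloor_of_ne {x : ℝ} (hx : (⌊x⌋ : ℝ) ≠ x) :
    ContinuousAt (Int.floor : ℝ → ℤ) x := by
  have hmem : Ioo (⌊x⌋ : ℝ) (⌊x⌋ + 1) ∈ 𝓝 x :=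
    Ioo_mem_nhds ((Int.floor_le x).lt_of_ne hx) (Int.lt_floor_add_one x)
  refine ContinuousAt.congr (f := fun _ ↦ ⌊x⌋) continuousAt_const ?_
  filter_upwards [hmem] with y hy
  exact (Int.floor_eq_on_Ico ⌊x⌋ y ⟨hy.1.le, hy.2⟩).symm

namespace AddCircle

/-- The finite set of `N`-division points of the circle. -/
noncomputable def divisionPoints (N : ℕ) : Finset (AddCircle (1 : ℝ)) :=
  open Classical in (Finset.range N).image fun k : ℕ ↦ ((k / N : ℝ) : AddCircle (1 : ℝ))

lemma card_divisionPoints_le (N : ℕ) : (divisionPoints N).card ≤ N := by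
  classical
  exact Finset.card_image_le.trans_eq (Finset.card_range N)

/-- A connected subset of the circle avoiding the `N`-division points has diameter at most
`1 / N`. -/
lemma dist_le_of_isPreconnected {N : ℕ} (hN : 0 < N) {S : Set (AddCircle (1 : ℝ))}
    (hS : IsPreconnected S) (hd : ∀ a ∈ divisionPoints N, a ∉ S)
    {u v : AddCircle (1 : ℝ)} (hu : u ∈ S) (hv : v ∈ S) : dist u v ≤ 1 / N := by
  classical
  have hN' : (0 : ℝ) < N := by exact_mod_cast hN
  let r : AddCircle (1 : ℝ) → ℝ := fun w ↦ equivIco 1 0 w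
  have hr (w) : (r w : AddCircle (1 : ℝ)) = w := coe_equivIco
  have hr0 (w) : 0 ≤ r w := (equivIco 1 0 w).2.1
  have hr1 (w) : r w < 1 := by simpa using (equivIco 1 0 w).2.2
  have hcont : ContinuousOn (fun w ↦ ⌊N * r w⌋) S := by
    intro w hw
    have hne : (⌊N * r w⌋ : ℝ) ≠ N * r w := by
      intro heq
      have h0 : 0 ≤ ⌊N * r w⌋ := Int.floor_nonneg.2 (mul_nonneg hN'.le (hr0 w))
      obtain ⟨k, hk⟩ := Int.eq_ofNat_of_zero_le h0
      rw [hk, Int.cast_natCast] at heq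
      have hkN : k < N := by
        have : (k : ℝ) < N := by nlinarith [hr1 w]
        exact_mod_cast this
      refine hd w (Finset.mem_image.2 ⟨k, Finset.mem_range.2 hkN, ?_⟩) hw
      rw [heq, mul_div_cancel_left₀ _ hN'.ne', hr]
    have hw0 : w ≠ ((0 : ℝ) : AddCircle (1 : ℝ)) := by
      rintro rfl
      exact hd _ (Finset.mem_image.2 ⟨0, Finset.mem_range.2 hN, by simp⟩) hw
    have hrc : ContinuousAt r w :=
      continuous_subtype_val.continuousAt.comp (continuousAt_equivIco 1 0 hw0)
    exact (ContinuousAt.comp (f := fun w ↦ N * r w) (continuousAt_intFloor_of_ne hne)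
      (hrc.const_mul _)).continuousWithinAt
  have heq : ⌊N * r u⌋ = ⌊N * r v⌋ := hS.constant hcont hu hv
  have habs := Int.abs_sub_lt_one_of_floor_eq_floor heq
  calc dist u v = ‖((r u - r v : ℝ) : AddCircle (1 : ℝ))‖ := by
        rw [coe_sub, hr, hr, dist_eq_norm]
    _ ≤ |r u - r v| := by
        simpa using QuotientAddGroup.norm_mk_le_norm (S := AddSubgroup.zmultiples (1 : ℝ))
          (m := r u - r v)
    _ ≤ 1 / N := by
        rw [← mul_sub, abs_mul, abs_of_pos hN'] at habs
        rw [le_div_iff₀ hN', mul_comm]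
        exact habs.le

end AddCircle

open AddCircle

lemma coverMincard_homeomorph_addCircle_le (f : AddCircle (1 : ℝ) ≃ₜ AddCircle (1 : ℝ))
    {N : ℕ} (hN : 0 < N) {U : SetRel (AddCircle (1 : ℝ)) (AddCircle (1 : ℝ))}
    (hU : ∀ u v, dist u v ≤ 1 / N → (u, v) ∈ U) (n : ℕ) :
    coverMincard f univ U n ≤ (2 * N * n + 1 : ℕ) := by
  classical
  let r : AddCircle (1 : ℝ) → ℝ := fun w ↦ equivIco 1 0 w
  have hr (w) : (r w : AddCircle (1 : ℝ)) = w := coe_equivIco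
  let Q : Finset ℝ := (Finset.range n ×ˢ divisionPoints N).image fun p ↦ r (f.symm^[p.1] p.2)
  have hQ : Q.card ≤ N * n := by
    refine Finset.card_image_le.trans ?_
    rw [Finset.card_product, Finset.card_range, mul_comm]
    exact Nat.mul_le_mul_right n (card_divisionPoints_le N)
  obtain ⟨s, hs, hsQ⟩ := exists_label_of_finset Q
  have key (x y) (hxy : r x < r y) (h : s (r x) = s (r y)) (k : ℕ) (hk : k < n) :
      dist (f^[k] x) (f^[k] y) ≤ 1 / N := by
    have hpre : IsPreconnected (f^[k] '' ((↑) '' Icc (r x) (r y))) :=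
      (isPreconnected_Icc.image _ (AddCircle.continuous_mk' 1).continuousOn).image _
        (f.continuous.iterate k).continuousOn
    refine dist_le_of_isPreconnected hN hpre ?_ (mem_image_of_mem _ ⟨r x, ⟨le_rfl, hxy.le⟩, hr x⟩)
      (mem_image_of_mem _ ⟨r y, ⟨hxy.le, le_rfl⟩, hr y⟩)
    rintro a ha ⟨_, ⟨t, ht, rfl⟩, rfl⟩
    have htr : r t = t := by
      have hmem : t ∈ Ico (0 : ℝ) (0 + 1) :=
        ⟨(equivIco 1 0 x).2.1.trans ht.1, ht.2.trans_lt (equivIco 1 0 y).2.2⟩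
      exact congrArg Subtype.val (equivIco_coe_eq hmem)
    refine hsQ _ _ hxy h t ht (Finset.mem_image.2
      ⟨(k, _), Finset.mem_product.2 ⟨Finset.mem_range.2 hk, ha⟩, ?_⟩)
    rw [Function.LeftInverse.iterate f.symm_apply_apply k, htr]
  refine coverMincard_univ_le_of_fiber_subset f U n _ (fun x ↦ s (r x))
    (fun x ↦ (hs _).trans_le (by linarith)) fun x y h ↦ mem_dynEntourage.2 fun k hk ↦ hU _ _ ?_
  rcases lt_trichotomy (r x) (r y) with hlt | heq | hgt
  · exact key x y hlt h k hk
  · rw [← hr x, ← hr y, heq, dist_self]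
    positivity
  · rw [dist_comm]
    exact key y x hgt h.symm k hk

/-- Every homeomorphism of the circle `AddCircle ℝ 1` has zero
topological entropy (Bowen–Dinaburg cover entropy). -/
theorem coverEntropy_homeomorph_addCircle_eq_zero
    (f : AddCircle (1 : ℝ) ≃ₜ AddCircle (1 : ℝ)) :
    coverEntropy (⇑f) Set.univ = 0 := by
  refine le_antisymm (iSup₂_le fun U hU ↦ ?_) (coverEntropy_nonneg _ univ_nonempty)
  obtain ⟨ε, hε, hεU⟩ := Metric.mem_uniformity_dist.1 hU
  obtain ⟨N, hN⟩ := exists_nat_one_div_lt hε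
  refine expGrowthSup_nonpos_of_le_affine _ (2 * (N + 1)) fun n ↦ ?_
  have hle := coverMincard_homeomorph_addCircle_le f N.succ_pos (U := U)
    (fun u v huv ↦ hεU (huv.trans_lt (by exact_mod_cast hN))) n
  exact_mod_cast ENat.toENNReal_mono hle
end

section
/- Let f be a Lipschitz self-map of the circle AddCircle ℝ 1 with Lipschitz constant L ≥ 1. Then the topological entropy of f is at most log L. -/
open Dynamics

/-- Every point of the unit circle lies within `1 / N` of one of the points `i / N`, `i < N`. -/
lemma exists_dist_div_le_one_div (N : ℕ) (hN : 0 < N) (x : AddCircle (1 : ℝ)) :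
    ∃ i < N, dist x (((i : ℝ) / N : ℝ) : AddCircle (1 : ℝ)) ≤ 1 / N := by
  have : Fact ((0 : ℝ) < 1) := ⟨one_pos⟩
  obtain ⟨y, ⟨hy0, hy1⟩, rfl⟩ :
      ∃ y ∈ Set.Ico (0 : ℝ) 1, (y : AddCircle (1 : ℝ)) = x := by
    have hx : x ∈ ((↑) : ℝ → AddCircle (1 : ℝ)) '' Set.Ico 0 (0 + 1) := by
      rw [AddCircle.coe_image_Ico_eq]
      trivial
    simpa using hx
  have hN' : (0 : ℝ) < N := by exact_mod_cast hN
  refine ⟨⌊y * N⌋₊, (Nat.floor_lt (by positivity)).2 (by nlinarith), ?_⟩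
  have h1 := Nat.floor_le (show 0 ≤ y * N by positivity)
  have h2 := Nat.lt_floor_add_one (y * N)
  rw [dist_eq_norm, ← AddCircle.coe_sub]
  refine (QuotientAddGroup.norm_mk_le_norm).trans ?_
  rw [Real.norm_eq_abs, abs_le]
  have h3 : y - (⌊y * N⌋₊ : ℝ) / N = (y * N - ⌊y * N⌋₊) / N := by field_simp
  rw [h3]
  constructor
  · have : 0 ≤ (y * N - ⌊y * N⌋₊) / N := div_nonneg (by linarith) hN'.le
    have : (0 : ℝ) ≤ 1 / N := by positivity
    linarith
  · gcongr
    linarith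

/-- If a set is `r`-dense with `L ^ n * r < ε`, then it is an `(ε, n)`-dynamical cover for every
`L`-Lipschitz map with `1 ≤ L`. -/
lemma LipschitzWith.isDynCoverOf {X : Type*} [PseudoMetricSpace X] {f : X → X} {L : NNReal}
    (hL : 1 ≤ L) (hf : LipschitzWith L f) {F s : Set X} {r ε : ℝ} {n : ℕ}
    (hs : ∀ x ∈ F, ∃ y ∈ s, dist x y ≤ r) (hr : (L : ℝ) ^ n * r < ε) :
    IsDynCoverOf f F {p : X × X | dist p.1 p.2 < ε} n s := by
  intro x hx
  obtain ⟨y, hy, hxy⟩ := hs x hx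
  refine ⟨y, hy, mem_dynEntourage.2 fun k hk ↦ ?_⟩
  have hL' : (1 : ℝ) ≤ L := by exact_mod_cast hL
  calc dist (f^[k] x) (f^[k] y) ≤ (L : ℝ) ^ k * dist x y := by
        simpa using (hf.iterate k).dist_le_mul x y
    _ ≤ (L : ℝ) ^ n * r := by gcongr
    _ < ε := hr

lemma coverMincard_circle_le (f : AddCircle (1 : ℝ) → AddCircle (1 : ℝ)) (L : NNReal)
    (hL : 1 ≤ L) (hf : LipschitzWith L f) {ε : ℝ} (hε : 0 < ε) (n : ℕ) :
    ((coverMincard f Set.univ {p | dist p.1 p.2 < ε} n : ℕ∞) : ENNReal) ≤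
      ENNReal.ofReal (ε⁻¹ + 1) * (L : ENNReal) ^ n := by
  classical
  have hL' : (1 : ℝ) ≤ (L : ℝ) ^ n := one_le_pow₀ (by exact_mod_cast hL)
  set N := ⌊(L : ℝ) ^ n / ε⌋₊ + 1 with hN
  have hN0 : (0 : ℝ) < N := by positivity
  have hNlt : (L : ℝ) ^ n / ε < N := by
    simpa [hN] using Nat.lt_floor_add_one ((L : ℝ) ^ n / ε)
  have hNle : (N : ℝ) ≤ (ε⁻¹ + 1) * (L : ℝ) ^ n := by
    have := Nat.floor_le (show 0 ≤ (L : ℝ) ^ n / ε by positivity)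
    rw [hN, Nat.cast_add_one, add_mul, one_mul, inv_mul_eq_div]
    linarith
  let s : Finset (AddCircle (1 : ℝ)) :=
    (Finset.range N).image fun i : ℕ ↦ (((i : ℝ) / N : ℝ) : AddCircle (1 : ℝ))
  have hcover : IsDynCoverOf f Set.univ {p | dist p.1 p.2 < ε} n (s : Set (AddCircle (1 : ℝ))) := by
    refine hf.isDynCoverOf hL (r := 1 / N) (fun x _ ↦ ?_) ?_
    · obtain ⟨i, hi, hxi⟩ := exists_dist_div_le_one_div N (Nat.succ_pos _) x
      exact ⟨_, Finset.mem_coe.2 (Finset.mem_image_of_mem _ (Finset.mem_range.2 hi)), hxi⟩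
    · rw [mul_one_div, div_lt_iff₀ hN0]
      rwa [div_lt_iff₀' hε] at hNlt
  have hcard : s.card ≤ N := Finset.card_image_le.trans_eq (Finset.card_range N)
  have hle : coverMincard f Set.univ {p | dist p.1 p.2 < ε} n ≤ (N : ℕ∞) :=
    hcover.coverMincard_le_card.trans (by exact_mod_cast hcard)
  calc ((coverMincard f Set.univ {p | dist p.1 p.2 < ε} n : ℕ∞) : ENNReal)
      ≤ ((N : ℕ∞) : ENNReal) := ENat.toENNReal_mono hle
    _ = ENNReal.ofReal N := by simp
    _ ≤ ENNReal.ofReal ((ε⁻¹ + 1) * (L : ℝ) ^ n) := ENNReal.ofReal_le_ofReal hNle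
    _ = ENNReal.ofReal (ε⁻¹ + 1) * (L : ENNReal) ^ n := by
        rw [ENNReal.ofReal_mul (by positivity), ENNReal.ofReal_pow L.coe_nonneg,
          ENNReal.ofReal_coe_nnreal]

/-- A Lipschitz self-map of the circle `AddCircle ℝ 1` with Lipschitz
constant `L ≥ 1` has topological entropy (Bowen–Dinaburg cover entropy) at most `log L`. -/
theorem coverEntropy_le_log_lipschitz_constant
    (f : AddCircle (1 : ℝ) → AddCircle (1 : ℝ)) (L : NNReal) (hL : 1 ≤ L)
    (hf : LipschitzWith L f) :
    coverEntropy f Set.univ ≤ (Real.log L : EReal) := by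
  rw [coverEntropy_eq_iSup_basis Metric.uniformity_basis_dist]
  refine iSup₂_le fun ε hε ↦ ?_
  have hlog : ENNReal.log (L : ENNReal) = (Real.log L : EReal) := by
    rw [ENNReal.log_pos_real' (by simpa using one_pos.trans_le hL), ENNReal.coe_toReal]
  rw [← hlog, ← ExpGrowth.expGrowthSup_pow]
  exact ExpGrowth.expGrowthSup_le_of_eventually_le ENNReal.ofReal_ne_top
    (Filter.Eventually.of_forall (coverMincard_circle_le f L hL hf hε))
end

section
/- Let F : ℝ → ℝ be a continuously differentiable, strictly increasing bijection with everywhere positive derivative satisfying F(x+1) = F(x)+1 for all x (i.e., F is the lift of a C¹ orientation-preserving circle diffeomorphism), and suppose the translation (rotation) number ρ = lim_{n→∞} F^n(x)/n is irrational. Then the Birkhoff means of log F′ along orbits converge uniformly to zero: sup_{x ∈ ℝ} |(1/n) ∑_{i=0}^{n−1} log F′(F^i(x))| → 0 as n → ∞; equivalently, (1/n) log (F^n)′(x) → 0 uniformly in x. -/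
open Filter

theorem Irrational.exists_nat_int_mul_sub_mem_Ioo {ρ : ℝ} (hρ : Irrational ρ) {δ : ℝ}
    (hδ : 0 < δ) : ∃ (q : ℕ) (p : ℤ), 0 < q * ρ - p ∧ q * ρ - p < δ := by
  obtain ⟨n, hn⟩ := exists_nat_one_div_lt hδ
  obtain ⟨k, hk0, -, hk⟩ := Real.exists_nat_abs_mul_sub_round_le ρ n.succ_pos
  set r := round (k * ρ)
  have hirr (m : ℕ) (j : ℤ) (hm : 0 < m) : m * ρ - j ≠ 0 :=
    ((hρ.natCast_mul hm.ne').sub_intCast j).ne_zero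
  have hkδ : |k * ρ - r| < δ := by
    refine hk.trans_lt (lt_of_le_of_lt ?_ hn)
    push_cast
    gcongr
    linarith
  rcases (hirr k r hk0).lt_or_gt with hneg | hpos
  · set b := k * ρ - r with hb
    have hm₁ : (⌊1 / -b⌋₊ : ℝ) * -b ≤ 1 :=
      (le_div_iff₀ (neg_pos.2 hneg)).1 (Nat.floor_le (by have := neg_pos.2 hneg; positivity))
    have hm₂ : 1 < ((⌊1 / -b⌋₊ : ℝ) + 1) * -b :=
      (div_lt_iff₀ (neg_pos.2 hneg)).1 (Nat.lt_floor_add_one _)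
    generalize ⌊1 / -b⌋₊ = m at hm₁ hm₂
    have heq : ((m * k : ℕ) : ℝ) * ρ - ((m * r - 1 : ℤ) : ℝ) = 1 - m * -b := by
      rw [hb]
      push_cast
      ring
    refine ⟨m * k, m * r - 1, ?_, ?_⟩
    · rcases m.eq_zero_or_pos with rfl | hm
      · simp
      · refine lt_of_le_of_ne ?_ (hirr (m * k) (m * r - 1) (Nat.mul_pos hm hk0)).symm
        linarith
    · linarith [neg_le_abs b]
  · exact ⟨k, r, hpos, (le_abs_self _).trans_lt hkδ⟩

theorem Function.Periodic.exists_abs_sub_le_add_mul {φ : ℝ → ℝ} (hφ : Function.Periodic φ 1)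
    (hc : Continuous φ) {ε : ℝ} (hε : 0 < ε) :
    ∃ C : ℝ, 0 ≤ C ∧ ∀ a b, |φ a - φ b| ≤ ε + C * |a - b| := by
  obtain ⟨M, hM⟩ := hφ.isBounded_of_continuous one_ne_zero hc |>.exists_norm_le
  have hM' (x : ℝ) : |φ x| ≤ M := hM _ ⟨x, rfl⟩
  have hu := (isCompact_Icc (a := (-1 : ℝ)) (b := 2)).uniformContinuousOn_of_continuous
    hc.continuousOn
  obtain ⟨δ, hδ, h⟩ := Metric.uniformContinuousOn_iff.1 hu ε hε
  have hM0 : 0 ≤ M := (abs_nonneg _).trans (hM' 0)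
  set d := min δ 1
  have hd : 0 < d := lt_min hδ one_pos
  refine ⟨2 * M / d, by positivity, fun a b => ?_⟩
  rcases lt_or_ge |a - b| d with hab | hab
  · have h1 : |a - b| < 1 := hab.trans_le (min_le_right _ _)
    rw [abs_lt] at h1
    have ha0 := Int.floor_le a
    have ha1 := Int.lt_floor_add_one a
    have := h (a - ⌊a⌋) ⟨by linarith, by linarith⟩ (b - ⌊a⌋) ⟨by linarith, by linarith⟩
      (by simpa [Real.dist_eq] using hab.trans_le (min_le_left _ _))
    have hper (x : ℝ) : φ (x - ⌊a⌋) = φ x := by simpa using hφ.sub_int_mul_eq ⌊a⌋ (x := x)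
    rw [hper, hper, Real.dist_eq] at this
    have : 0 ≤ 2 * M / d * |a - b| := by positivity
    linarith
  · have h1 : 2 * M ≤ 2 * M / d * |a - b| := by
      rw [div_mul_eq_mul_div, le_div_iff₀ hd]
      gcongr
    have := abs_sub (φ a) (φ b)
    linarith [hM' a, hM' b]

theorem birkhoffSum_iterate_sub_birkhoffSum {α G : Type*} [AddCommGroup G] (f : α → α) (g : α → G)
    (m n : ℕ) (x : α) :
    birkhoffSum f g n (f^[m] x) - birkhoffSum f g n x =
      birkhoffSum f g m (f^[n] x) - birkhoffSum f g m x := by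
  have h := birkhoffSum_add f g m n x
  rw [add_comm m n, birkhoffSum_add f g n m x] at h
  rw [sub_eq_sub_iff_add_eq_add, add_comm, ← h, add_comm]

theorem abs_birkhoffSum_le {α : Type*} (f : α → α) {g : α → ℝ} {M : ℝ} (hM : ∀ x, |g x| ≤ M)
    (n : ℕ) (x : α) : |birkhoffSum f g n x| ≤ n * M := by
  refine (Finset.abs_sum_le_sum_abs _ _).trans ?_
  simpa using Finset.sum_le_card_nsmul (Finset.range n) _ M fun i _ => hM (f^[i] x)

namespace CircleDeg1Lift

variable (f : CircleDeg1Lift)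

theorem abs_iterate_sub_sub_le (n : ℕ) (x : ℝ) :
    |f^[n] x - x - n * f.translationNumber| ≤ 1 := by
  rw [← coe_pow, ← translationNumber_pow]
  have h₁ := (f ^ n).map_lt_add_translationNumber_add_one x
  have h₂ := (f ^ n).translationNumber_le_ceil_sub x
  have h₃ := Int.ceil_lt_add_one ((f ^ n) x - x)
  rw [abs_le]
  constructor <;> linarith

theorem iterate_sub_int (n : ℕ) (x : ℝ) (p : ℤ) : f^[n] (x - p) = f^[n] x - p := by
  rw [← coe_pow, map_sub_int]

theorem birkhoffSum_sub_int {φ : ℝ → ℝ} (hφ : Function.Periodic φ 1) (n : ℕ) (x : ℝ) (p : ℤ) :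
    birkhoffSum f φ n (x - p) = birkhoffSum f φ n x := by
  refine Finset.sum_congr rfl fun i _ => ?_
  rw [iterate_sub_int]
  simpa using hφ.sub_int_mul_eq p (x := f^[i] x)

/-- The gaps between the orbit of `z` and its translate under `f^[q] - p` have small mean. -/
theorem sum_iterate_sub_iterate_le (q : ℕ) (p : ℤ) (n : ℕ) (z : ℝ) :
    ∑ i ∈ Finset.range n, (f^[i] (f^[q] z - p) - f^[i] z) ≤
      n * (q * f.translationNumber - p) + q := by
  have h := birkhoffSum_iterate_sub_birkhoffSum f id q n z
  simp only [birkhoffSum, id, ← Finset.sum_sub_distrib] at h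
  have h₁ : ∑ i ∈ Finset.range q, (f^[i] (f^[n] z) - f^[i] z) ≤
      q * (n * f.translationNumber + 1) := by
    have := Finset.sum_le_card_nsmul (Finset.range q) (fun i => f^[i] (f^[n] z) - f^[i] z)
      (n * f.translationNumber + 1) fun i _ => by
        rw [← Function.iterate_add_apply, add_comm i n, Function.iterate_add_apply]
        linarith [(abs_le.1 (f.abs_iterate_sub_sub_le n (f^[i] z))).2]
    rwa [Finset.card_range, nsmul_eq_mul] at this
  calc ∑ i ∈ Finset.range n, (f^[i] (f^[q] z - p) - f^[i] z)
      = ∑ i ∈ Finset.range n, (f^[i] (f^[q] z) - f^[i] z) - n * p := by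
        simp only [iterate_sub_int, sub_right_comm _ (p : ℝ),
          Finset.sum_sub_distrib _ (fun _ => (p : ℝ)), Finset.sum_const, Finset.card_range, nsmul_eq_mul]
    _ ≤ _ := by linarith

theorem exists_nat_iterate_le_lt {q : ℕ} {p : ℤ} {K : ℕ}
    (hK : 2 ≤ K * (q * f.translationNumber - p)) {x y : ℝ} (hxy : x ≤ y) (hyx : y < x + 1) :
    ∃ k < K, f^[k * q] x - (k * p : ℤ) ≤ y ∧ y < f^[(k + 1) * q] x - ((k + 1) * p : ℤ) := by
  have hlast : y < f^[K * q] x - (K * p : ℤ) := by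
    have := (abs_le.1 (f.abs_iterate_sub_sub_le (K * q) x)).1
    push_cast at this ⊢
    nlinarith
  classical
  have hex : ∃ k : ℕ, y < f^[k * q] x - (k * p : ℤ) := ⟨K, hlast⟩
  obtain ⟨k, hk⟩ : ∃ k, Nat.find hex = k + 1 := by
    refine Nat.exists_eq_succ_of_ne_zero fun h0 => ?_
    have := Nat.find_spec hex
    rw [h0] at this
    simp at this
    linarith
  refine ⟨k, ?_, ?_, ?_⟩
  · have := Nat.find_min' hex hlast
    omega
  · exact not_lt.1 (Nat.find_min hex (m := k) (by omega))
  · have := Nat.find_spec hex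
    rw [hk] at this
    exact_mod_cast this

theorem eventually_abs_birkhoffSum_sub_le (hf : Irrational f.translationNumber) {φ : ℝ → ℝ}
    (hφ : Function.Periodic φ 1) (hc : Continuous φ) {ε : ℝ} (hε : 0 < ε) :
    ∀ᶠ n : ℕ in atTop, ∀ x y, |birkhoffSum f φ n y - birkhoffSum f φ n x| ≤ n * ε := by
  obtain ⟨C, hC, hφC⟩ := hφ.exists_abs_sub_le_add_mul hc (show 0 < ε / 3 by positivity)
  obtain ⟨M, hM⟩ := hφ.isBounded_of_continuous one_ne_zero hc |>.exists_norm_le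
  replace hM (x : ℝ) : |φ x| ≤ M := hM _ ⟨x, rfl⟩
  have hM0 : 0 ≤ M := (abs_nonneg _).trans (hM 0)
  obtain ⟨q, p, ha, haδ⟩ :=
    hf.exists_nat_int_mul_sub_mem_Ioo (show 0 < ε / 3 / (C + 1) by positivity)
  set a := q * f.translationNumber - p with ha_def
  have hCa : C * a ≤ ε / 3 := by
    rw [lt_div_iff₀ (by positivity)] at haδ
    nlinarith
  obtain ⟨K, hK⟩ := exists_nat_ge (2 / a)
  rw [div_le_iff₀ ha] at hK
  have hlarge : ∀ᶠ n : ℕ in atTop, C * q + 2 * (K * q * M) ≤ n * (ε / 3) :=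
    (tendsto_natCast_atTop_atTop.atTop_mul_const (by positivity)).eventually_ge_atTop _
  filter_upwards [hlarge] with n hn x y
  wlog hxy : x ≤ y ∧ y < x + 1 generalizing y
  · have h := this (y - ⌊y - x⌋)
      ⟨by linarith [Int.floor_le (y - x)], by linarith [Int.lt_floor_add_one (y - x)]⟩
    rwa [f.birkhoffSum_sub_int hφ] at h
  obtain ⟨k, hkK, hky, hyk⟩ := f.exists_nat_iterate_le_lt hK hxy.1 hxy.2
  set z := f^[k * q] x - (k * p : ℤ) with hz
  have hz' : f^[(k + 1) * q] x - ((k + 1) * p : ℤ) = f^[q] z - p := by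
    rw [hz, iterate_sub_int, ← Function.iterate_add_apply, add_mul, one_mul, add_comm q]
    push_cast
    ring
  rw [hz'] at hyk
  have hzx : |birkhoffSum f φ n z - birkhoffSum f φ n x| ≤ 2 * (K * q * M) := by
    rw [hz, f.birkhoffSum_sub_int hφ, birkhoffSum_iterate_sub_birkhoffSum]
    have h₁ := abs_birkhoffSum_le f hM (k * q) (f^[n] x)
    have h₂ := abs_birkhoffSum_le f hM (k * q) x
    have h₃ : ((k * q : ℕ) : ℝ) * M ≤ K * q * M := by
      push_cast
      gcongr
    linarith [abs_sub (birkhoffSum f φ (k * q) (f^[n] x)) (birkhoffSum f φ (k * q) x)]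
  have hyz : |birkhoffSum f φ n y - birkhoffSum f φ n z| ≤ n * (ε / 3) + C * (n * a + q) := by
    rw [birkhoffSum, birkhoffSum, ← Finset.sum_sub_distrib]
    calc _ ≤ ∑ i ∈ Finset.range n, |φ (f^[i] y) - φ (f^[i] z)| := Finset.abs_sum_le_sum_abs _ _
      _ ≤ ∑ i ∈ Finset.range n, (ε / 3 + C * (f^[i] (f^[q] z - p) - f^[i] z)) := by
        refine Finset.sum_le_sum fun i _ => (hφC _ _).trans ?_
        have h₁ := f.monotone.iterate i hky
        have h₂ := f.monotone.iterate i hyk.le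
        rw [abs_of_nonneg (sub_nonneg.2 h₁)]
        gcongr
      _ = n * (ε / 3) + C * ∑ i ∈ Finset.range n, (f^[i] (f^[q] z - p) - f^[i] z) := by
        simp [Finset.sum_add_distrib, ← Finset.mul_sum]
      _ ≤ _ := by
        gcongr
        exact f.sum_iterate_sub_iterate_le q p n z
  have htri := abs_sub_le (birkhoffSum f φ n y) (birkhoffSum f φ n z) (birkhoffSum f φ n x)
  have : n * (C * a) ≤ n * (ε / 3) := by gcongr
  linarith

end CircleDeg1Lift

theorem hasDerivAt_iterate_exp_birkhoffSum {F : ℝ → ℝ} (hF : Differentiable ℝ F)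
    (hpos : ∀ x, 0 < deriv F x) (n : ℕ) (x : ℝ) :
    HasDerivAt F^[n] (Real.exp (birkhoffSum F (fun y => Real.log (deriv F y)) n x)) x := by
  induction n with
  | zero => simpa using hasDerivAt_id x
  | succ n ih =>
    rw [birkhoffSum_succ, Real.exp_add, Real.exp_log (hpos _), Function.iterate_succ', mul_comm]
    exact (hF _).hasDerivAt.comp x ih

theorem exists_birkhoffSum_log_deriv_eq_zero {F : ℝ → ℝ} (hF : Differentiable ℝ F)
    (hpos : ∀ x, 0 < deriv F x) (hper : ∀ x, F (x + 1) = F x + 1) (n : ℕ) :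
    ∃ x, birkhoffSum F (fun y => Real.log (deriv F y)) n x = 0 := by
  obtain ⟨c, -, hc⟩ := exists_hasDerivAt_eq_slope F^[n] _ zero_lt_one
    (hF.iterate n).continuous.continuousOn
    fun x _ => hasDerivAt_iterate_exp_birkhoffSum hF hpos n x
  have h1 : F^[n] 1 = F^[n] 0 + 1 := by
    simpa using (Function.Commute.iterate_left (f := F) (g := (· + 1)) hper n) 0
  refine ⟨c, ?_⟩
  simpa [h1] using hc

/-- Let `F` be the lift of a `C¹` orientation-preserving circle
diffeomorphism (a `C¹` strictly increasing bijection of `ℝ` with positive derivative and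
`F(x+1) = F(x)+1`) whose translation number `ρ = lim F^n(x)/n` is irrational. Then the
Birkhoff means of `log F'` converge uniformly to zero:
`(1/n) ∑_{i<n} log F'(F^i(x)) → 0` uniformly in `x`. -/
theorem birkhoff_means_log_deriv_tendstoUniformly_zero
    (F : ℝ → ℝ) (hC1 : ContDiff ℝ 1 F) (hmono : StrictMono F)
    (hbij : Function.Bijective F) (hpos : ∀ x : ℝ, 0 < deriv F x)
    (hper : ∀ x : ℝ, F (x + 1) = F x + 1)
    (ρ : ℝ) (hirr : Irrational ρ)
    (hrot : ∀ x : ℝ, Tendsto (fun n : ℕ => F^[n] x / n) atTop (nhds ρ)) :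
    TendstoUniformly
      (fun (n : ℕ) (x : ℝ) => (∑ i ∈ Finset.range n, Real.log (deriv F (F^[i] x))) / n)
      (fun _ => 0) atTop := by
  have hF : Differentiable ℝ F := hC1.differentiable one_ne_zero
  let f : CircleDeg1Lift := ⟨⟨F, hmono.monotone⟩, hper⟩
  have hτ : f.translationNumber = ρ := f.translationNumber_eq_of_tendsto₀ (hrot 0)
  have hφ : Function.Periodic (fun y => Real.log (deriv F y)) 1 := fun x => by
    have h : (fun x => F (x + 1)) = fun x => F x + 1 := funext hper
    have h' := congrFun (congrArg deriv h) x
    rw [deriv_comp_add_const, deriv_add_const] at h'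
    simp only [h']
  have hc : Continuous fun y => Real.log (deriv F y) :=
    (hC1.continuous_deriv le_rfl).log fun x => (hpos x).ne'
  rw [Metric.tendstoUniformly_iff]
  intro ε hε
  filter_upwards [f.eventually_abs_birkhoffSum_sub_le (hτ ▸ hirr) hφ hc (half_pos hε),
    eventually_gt_atTop 0] with n hn hn0 y
  obtain ⟨x, hx⟩ := exists_birkhoffSum_log_deriv_eq_zero hF hpos hper n
  have h := hn x y
  have hn0' : (0 : ℝ) < n := Nat.cast_pos.2 hn0
  rw [show birkhoffSum f (fun y => Real.log (deriv F y)) n x = 0 from hx, sub_zero] at h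
  rw [dist_comm, Real.dist_eq, sub_zero, abs_div, Nat.abs_cast, div_lt_iff₀ hn0']
  refine lt_of_le_of_lt h ?_
  nlinarith
end

section
/- Let F : ℝ → ℝ be a continuously differentiable, strictly increasing bijection with everywhere positive derivative satisfying F(x+1) = F(x)+1 for all x, and suppose its translation (rotation) number ρ = lim_{n→∞} F^n(x)/n is irrational. Then there exists a sequence (H_n) of continuously differentiable, strictly increasing bijections of ℝ with everywhere positive derivative and H_n(x+1) = H_n(x)+1, such that the conjugates G_n := H_n ∘ F ∘ H_n⁻¹ converge to the translation x ↦ x + ρ in the C¹ topology: sup_x |G_n(x) − (x+ρ)| → 0 and sup_x |G_n′(x) − 1| → 0 as n → ∞. In other words, a C¹ circle diffeomorphism of irrational rotation number ρ has the rigid rotation R_ρ in the C¹-closure of its conjugacy class. -/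
open Filter

/-- A real sequence whose increments are `n * τ` up to a bounded error has shifts whose summed
differences are linear up to a bounded error. -/
theorem abs_sum_shift_sub_le {b : ℤ → ℝ} {τ C : ℝ}
    (hb : ∀ (m : ℤ) (n : ℕ), |b (m + n) - b m - n * τ| ≤ C) (n : ℕ) (i : ℤ) :
    |∑ k ∈ Finset.range n, (b (i + k) - b k) - n * (i * τ)| ≤ C * |(i : ℝ)| := by
  have tele (i : ℤ) : ∑ k ∈ Finset.range n, (b (i + 1 + k) - b k) =
      ∑ k ∈ Finset.range n, (b (i + k) - b k) + (b (i + n) - b i) := by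
    have h := Finset.sum_range_sub (fun k : ℕ => b (i + k)) n
    simp only [Nat.cast_add, Nat.cast_one, Nat.cast_zero, add_zero] at h
    rw [← h, ← Finset.sum_add_distrib]
    refine Finset.sum_congr rfl fun k _ => ?_
    rw [show i + 1 + (k : ℤ) = i + (k + 1) by ring]
    ring
  induction i using Int.induction_on with
  | zero => simp
  | succ i ih =>
    rw [tele]
    have h := hb i n
    have h1 : |((i : ℤ) : ℝ)| = i := by simp
    have h2 : |(((i : ℤ) + 1 : ℤ) : ℝ)| = i + 1 := by
      push_cast; exact abs_of_nonneg (by positivity)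
    rw [h1] at ih
    rw [h2]
    push_cast at *
    rw [abs_le] at *
    constructor <;> linarith
  | pred i ih =>
    have ht := tele (-i - 1)
    rw [sub_add_cancel] at ht
    have h := hb (-i - 1) n
    have h1 : |((-i : ℤ) : ℝ)| = i := by simp
    have h2 : |((-(i : ℤ) - 1 : ℤ) : ℝ)| = i + 1 := by
      push_cast
      rw [abs_of_nonpos (by linarith [Nat.cast_nonneg (α := ℝ) i])]
      ring
    rw [h1, ht] at ih
    rw [h2]
    push_cast at *
    rw [abs_le] at *
    constructor <;> linarith

theorem Function.Periodic.uniformContinuous {φ : ℝ → ℝ} {T : ℝ} (h : Function.Periodic φ T)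
    (hT : 0 < T) (hφ : Continuous φ) : UniformContinuous φ := by
  have : Fact (0 < T) := ⟨hT⟩
  have hlift : Continuous (h.lift : AddCircle T → ℝ) := continuous_coinduced_dom.2 hφ
  exact (CompactSpace.uniformContinuous_of_continuous hlift).comp
    (uniformContinuous_of_continuousAt_zero (QuotientAddGroup.mk' (AddSubgroup.zmultiples T))
      continuous_quotient_mk'.continuousAt)

namespace CircleDeg1Lift

theorem abs_floor_map_sub_le (f : CircleDeg1Liftˣ) (x : ℝ) :
    |(⌊f x⌋ : ℝ) - ⌊x⌋ - translationNumber f| ≤ 2 := by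
  have h1 := map_lt_add_translationNumber_add_one (f : CircleDeg1Lift) x
  have h2 := map_lt_add_translationNumber_add_one (f⁻¹ : CircleDeg1Liftˣ) (f x)
  rw [units_inv_apply_apply, translationNumber_units_inv] at h2
  have := Int.floor_le (f x)
  have := Int.lt_floor_add_one (f x)
  have := Int.floor_le x
  have := Int.lt_floor_add_one x
  rw [abs_le]
  constructor <;> linarith

theorem zpow_add_apply (f : CircleDeg1Liftˣ) (i j : ℤ) (x : ℝ) :
    (f ^ (i + j) : CircleDeg1Liftˣ) x
      = (f ^ i : CircleDeg1Liftˣ) ((f ^ j : CircleDeg1Liftˣ) x) := by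
  rw [zpow_add, Units.val_mul, mul_apply]

theorem zpow_natCast_apply (f : CircleDeg1Liftˣ) (n : ℕ) (x : ℝ) :
    (f ^ (n : ℤ) : CircleDeg1Liftˣ) x = f^[n] x := by
  rw [zpow_natCast, Units.val_pow_eq_pow_val, coe_pow]

theorem abs_sum_floor_zpow_sub_le (f : CircleDeg1Liftˣ) (n : ℕ) (i : ℤ) (x : ℝ) :
    |∑ k ∈ Finset.range n, ((⌊(f ^ i : CircleDeg1Liftˣ) (f^[k] x)⌋ : ℝ) - ⌊f^[k] x⌋)
      - n * (i * translationNumber f)| ≤ 2 * |(i : ℝ)| := by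
  have := abs_sum_shift_sub_le (b := fun m => (⌊(f ^ m : CircleDeg1Liftˣ) x⌋ : ℝ))
    (τ := translationNumber f) (C := 2) (fun m n => ?_) n i
  · simpa only [zpow_add_apply, zpow_natCast_apply] using this
  · have h := abs_floor_map_sub_le (f ^ (n : ℤ)) ((f ^ m : CircleDeg1Liftˣ) x)
    rw [translationNumber_zpow, ← zpow_add_apply, add_comm] at h
    simpa using h

theorem floor_sub_map_zero (g : CircleDeg1Liftˣ) (l : ℤ) (x : ℝ) :
    ⌊x - (g 0 + l)⌋ = ⌊(g⁻¹ : CircleDeg1Liftˣ) x⌋ - l := by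
  have key (r : ℤ) : r ≤ ⌊x - (g 0 + l)⌋ ↔ r ≤ ⌊(g⁻¹ : CircleDeg1Liftˣ) x⌋ - l := by
    rw [Int.le_floor, le_sub_iff_add_le, le_sub_iff_add_le, Int.le_floor]
    have h : (r : ℝ) + (g 0 + l) = g ((r + l : ℤ) : ℝ) := by
      rw [map_int_of_map_zero]; push_cast; ring
    have h2 := (toOrderIso g).le_symm_apply (x := ((r + l : ℤ) : ℝ)) (y := x)
    rw [coe_toOrderIso, coe_toOrderIso_symm] at h2
    rw [h, h2]
  exact le_antisymm ((key _).1 le_rfl) ((key _).2 le_rfl)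

theorem exists_zpow_bracket (f : CircleDeg1Liftˣ) (hf : Irrational (translationNumber f))
    (t : ℝ) {η : ℝ} (hη : 0 < η) :
    ∃ i l i' l' : ℤ, (f ^ i : CircleDeg1Liftˣ) 0 + l ≤ t ∧ t ≤ (f ^ i' : CircleDeg1Liftˣ) 0 + l' ∧
      (i' * translationNumber f + l') - (i * translationNumber f + l) ≤ η := by
  set τ := translationNumber f
  obtain ⟨j, l, hpos, hle⟩ : ∃ j l : ℤ, 0 < j * τ + l ∧ j * τ + l ≤ η := by
    obtain ⟨n, hn⟩ := exists_nat_one_div_lt hη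
    obtain ⟨l, j, hj, -, hjl⟩ := Real.exists_int_int_abs_mul_sub_le τ (Nat.succ_pos n)
    have hlt : |(j : ℝ) * τ - l| ≤ η := by
      refine hjl.trans (le_trans ?_ hn.le)
      exact one_div_le_one_div_of_le (by positivity) (by push_cast; linarith)
    have hne : (j : ℝ) * τ - l ≠ 0 := by
      have h := (hf.intCast_mul hj.ne').sub_intCast l
      exact h.ne_zero
    rw [abs_le] at hlt
    rcases lt_or_gt_of_ne hne with h | h
    · refine ⟨-j, l, ?_, ?_⟩ <;> push_cast <;> linarith
    · refine ⟨j, -l, ?_, ?_⟩ <;> push_cast <;> linarith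
  have hs (m : ℤ) : |(f ^ (j * m) : CircleDeg1Liftˣ) 0 + ((l * m : ℤ) : ℝ) - m * (j * τ + l)| ≤ 1 := by
    have h := dist_map_zero_translationNumber_le (f ^ (j * m) : CircleDeg1Liftˣ)
    rw [translationNumber_zpow, Real.dist_eq] at h
    convert h using 2
    push_cast; ring
  set s : ℤ → ℝ := fun m => (f ^ (j * m) : CircleDeg1Liftˣ) 0 + ((l * m : ℤ) : ℝ)
  set σ := (j : ℝ) * τ + l
  obtain ⟨m, hm, hmax⟩ := Int.exists_greatest_of_bdd (P := fun m => s m ≤ t)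
    ⟨⌈(t + 1) / σ⌉, fun m hm => by
      have h := (abs_le.1 (hs m)).1
      have h' : (m : ℝ) ≤ (t + 1) / σ := by
        rw [le_div_iff₀ hpos]; change s m ≤ t at hm; change -1 ≤ s m - _ at h; linarith
      exact_mod_cast h'.trans (Int.le_ceil _)⟩
    ⟨⌊(t - 1) / σ⌋, by
      have h := (abs_le.1 (hs ⌊(t - 1) / σ⌋)).2
      have h' : (⌊(t - 1) / σ⌋ : ℝ) * σ ≤ t - 1 := by
        rw [← le_div_iff₀ hpos]; exact Int.floor_le _
      change s _ - _ ≤ 1 at h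
      linarith⟩
  refine ⟨j * m, l * m, j * (m + 1), l * (m + 1), hm, ?_, ?_⟩
  · by_contra! h
    have := hmax (m + 1) h.le
    lia
  · push_cast
    linarith

/-- The functions whose Birkhoff sums along `f` differ by a uniform `o(n)` between orbits. -/
def uniformBirkhoff (f : ℝ → ℝ) : Submodule ℝ (ℝ → ℝ) where
  carrier := {φ | ∀ ε > 0, ∃ C, ∀ n x y,
    |birkhoffSum f φ n x - birkhoffSum f φ n y| ≤ n * ε + C}
  zero_mem' := fun ε hε => ⟨0, fun n x y => by simp [birkhoffSum]; positivity⟩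
  add_mem' := fun {φ ψ} hφ hψ ε hε => by
    obtain ⟨C, hC⟩ := hφ (ε / 2) (by positivity)
    obtain ⟨D, hD⟩ := hψ (ε / 2) (by positivity)
    refine ⟨C + D, fun n x y => ?_⟩
    have h (x : ℝ) : birkhoffSum f (φ + ψ) n x = birkhoffSum f φ n x + birkhoffSum f ψ n x := by
      simp [birkhoffSum, Finset.sum_add_distrib]
    rw [h, h, add_sub_add_comm]
    refine (abs_add_le _ _).trans ((add_le_add (hC n x y) (hD n x y)).trans_eq ?_)
    ring
  smul_mem' := fun c φ hφ ε hε => by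
    obtain ⟨C, hC⟩ := hφ (ε / (|c| + 1)) (by positivity)
    refine ⟨|c| * C, fun n x y => ?_⟩
    have h (x : ℝ) : birkhoffSum f (c • φ) n x = c * birkhoffSum f φ n x := by
      simp [birkhoffSum, Finset.mul_sum]
    rw [h, h, ← mul_sub, abs_mul]
    refine (mul_le_mul_of_nonneg_left (hC n x y) (abs_nonneg c)).trans ?_
    rw [mul_add, add_le_add_iff_right]
    have h2 : |c| / (|c| + 1) ≤ 1 := by rw [div_le_one (by positivity)]; linarith
    calc |c| * (n * (ε / (|c| + 1))) = |c| / (|c| + 1) * (n * ε) := by ring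
      _ ≤ 1 * (n * ε) := by gcongr
      _ = n * ε := one_mul _

theorem floor_sub_mem_uniformBirkhoff (f : CircleDeg1Liftˣ)
    (hf : Irrational (translationNumber f)) (t : ℝ) :
    (fun x : ℝ => (⌊x - t⌋ : ℝ) - ⌊x⌋) ∈ uniformBirkhoff f := by
  intro ε hε
  obtain ⟨i, l, i', l', h1, h2, h3⟩ := exists_zpow_bracket f hf t hε
  have key (j : ℤ) (n : ℕ) (x : ℝ) := abs_le.1 (abs_sum_floor_zpow_sub_le f n (-j) x)
  have hsum (j m : ℤ) (n : ℕ) (x : ℝ) :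
      ∑ k ∈ Finset.range n,
        ((⌊f^[k] x - ((f ^ j : CircleDeg1Liftˣ) 0 + m)⌋ : ℝ) - ⌊f^[k] x⌋) =
      ∑ k ∈ Finset.range n, ((⌊(f ^ (-j) : CircleDeg1Liftˣ) (f^[k] x)⌋ : ℝ) - ⌊f^[k] x⌋)
        - n * m := by
    simp only [floor_sub_map_zero, zpow_neg, Int.cast_sub, sub_right_comm _ (m : ℝ)]
    rw [Finset.sum_sub_distrib (g := fun _ => (m : ℝ))]
    simp
  have up (n : ℕ) (x : ℝ) : birkhoffSum f (fun x : ℝ => (⌊x - t⌋ : ℝ) - ⌊x⌋) n x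
      ≤ -n * (i * translationNumber f + l) + 2 * |(i : ℝ)| := by
    have h5 : birkhoffSum f (fun x : ℝ => (⌊x - t⌋ : ℝ) - ⌊x⌋) n x ≤
        ∑ k ∈ Finset.range n,
          ((⌊f^[k] x - ((f ^ i : CircleDeg1Liftˣ) 0 + l)⌋ : ℝ) - ⌊f^[k] x⌋) :=
      Finset.sum_le_sum fun k _ =>
        sub_le_sub_right (Int.cast_le.2 (Int.floor_le_floor (by linarith))) _
    rw [hsum] at h5
    have h := (key i n x).2
    push_cast at h
    rw [abs_neg] at h
    linarith
  have low (n : ℕ) (x : ℝ) : -n * (i' * translationNumber f + l') - 2 * |(i' : ℝ)| ≤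
      birkhoffSum f (fun x : ℝ => (⌊x - t⌋ : ℝ) - ⌊x⌋) n x := by
    have h5 : ∑ k ∈ Finset.range n,
        ((⌊f^[k] x - ((f ^ i' : CircleDeg1Liftˣ) 0 + l')⌋ : ℝ) - ⌊f^[k] x⌋) ≤
        birkhoffSum f (fun x : ℝ => (⌊x - t⌋ : ℝ) - ⌊x⌋) n x :=
      Finset.sum_le_sum fun k _ =>
        sub_le_sub_right (Int.cast_le.2 (Int.floor_le_floor (by linarith))) _
    rw [hsum] at h5
    have h := (key i' n x).1
    push_cast at h
    rw [abs_neg] at h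
    linarith
  refine ⟨2 * |(i : ℝ)| + 2 * |(i' : ℝ)|, fun n x y => ?_⟩
  have h4 : (n : ℝ) * ((i' * translationNumber f + l') - (i * translationNumber f + l)) ≤ n * ε := by
    gcongr
  have := up n x
  have := up n y
  have := low n x
  have := low n y
  rw [abs_le]
  constructor <;> linarith

/-- Unique ergodicity: along a lift of irrational translation number, the Birkhoff sums of a
continuous periodic function differ by a uniform `o(n)` between orbits. -/
theorem mem_uniformBirkhoff_of_continuous (f : CircleDeg1Liftˣ)
    (hf : Irrational (translationNumber f)) {φ : ℝ → ℝ} (hφ : Continuous φ)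
    (hper : Function.Periodic φ 1) : φ ∈ uniformBirkhoff f := by
  intro ε hε
  obtain ⟨δ, hδ, huc⟩ := Metric.uniformContinuous_iff.1
    (hper.uniformContinuous one_pos hφ) (ε / 3) (by positivity)
  obtain ⟨N, hN⟩ := exists_nat_one_div_lt hδ
  set g : ℝ → ℝ → ℝ := fun t x => (⌊x - t⌋ : ℝ) - ⌊x⌋ with hg
  set a : ℕ → ℝ := fun i => i / (N + 1) with ha
  set ψ : ℝ → ℝ := ∑ i ∈ Finset.range (N + 1), φ (a i) • (g (a i) - g (a (i + 1))) with hψ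
  have hψmem : ψ ∈ uniformBirkhoff f := Submodule.sum_mem _ fun i _ =>
    Submodule.smul_mem _ _ (Submodule.sub_mem _ (floor_sub_mem_uniformBirkhoff f hf _)
      (floor_sub_mem_uniformBirkhoff f hf _))
  have hastep (i : ℕ) : a (i + 1) = a i + 1 / (N + 1) := by
    simp only [ha]; push_cast; ring
  have hclose (x : ℝ) : |φ x - ψ x| ≤ ε / 3 := by
    have hone : ∑ i ∈ Finset.range (N + 1), (g (a i) x - g (a (i + 1)) x) = 1 := by
      rw [Finset.sum_range_sub' (fun i => g (a i) x)]
      have h0 : a 0 = 0 := by simp [ha]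
      have h1 : a (N + 1) = 1 := by simp only [ha]; push_cast; field_simp
      rw [h0, h1]
      simp [hg]
    have hdiff : φ x - ψ x =
        ∑ i ∈ Finset.range (N + 1), (φ x - φ (a i)) * (g (a i) x - g (a (i + 1)) x) := by
      simp only [sub_mul, Finset.sum_sub_distrib (f := fun i => φ x * _), ← Finset.mul_sum, hone]
      simp [hψ]
    rw [hdiff]
    calc |∑ i ∈ Finset.range (N + 1), (φ x - φ (a i)) * (g (a i) x - g (a (i + 1)) x)|
        ≤ ∑ i ∈ Finset.range (N + 1), ε / 3 * (g (a i) x - g (a (i + 1)) x) := by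
          refine (Finset.abs_sum_le_sum_abs _ _).trans (Finset.sum_le_sum fun i _ => ?_)
          have hle : ⌊x - a (i + 1)⌋ ≤ ⌊x - a i⌋ := by
            refine Int.floor_le_floor ?_
            rw [hastep]
            have : (0 : ℝ) < 1 / (N + 1) := by positivity
            linarith
          have hgs : g (a i) x - g (a (i + 1)) x = (⌊x - a i⌋ : ℝ) - ⌊x - a (i + 1)⌋ := by
            simp [hg]
          rcases hle.eq_or_lt with h | h
          · rw [hgs, h]; simp
          · have hnn : 0 ≤ g (a i) x - g (a (i + 1)) x := by
              rw [hgs, sub_nonneg]; exact_mod_cast hle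
            rw [abs_mul, abs_of_nonneg hnn]
            refine mul_le_mul_of_nonneg_right ?_ hnn
            have h1 := Int.floor_lt.1 h
            have h2 := Int.floor_le (x - a i)
            rw [hastep] at h1
            have h3 : φ x = φ (x - ⌊x - a i⌋) := by
              have := hper.sub_int_mul_eq ⌊x - a i⌋ (x := x)
              rw [mul_one] at this
              exact this.symm
            rw [h3, ← Real.dist_eq]
            refine (huc ?_).le
            rw [Real.dist_eq, abs_lt]
            constructor <;> linarith
      _ = ε / 3 := by rw [← Finset.mul_sum, hone, mul_one]
  have hS (n : ℕ) (x : ℝ) : |birkhoffSum f φ n x - birkhoffSum f ψ n x| ≤ n * (ε / 3) := by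
    rw [birkhoffSum, birkhoffSum, ← Finset.sum_sub_distrib]
    refine (Finset.abs_sum_le_sum_abs _ _).trans ?_
    refine (Finset.sum_le_sum fun k _ => hclose _).trans_eq ?_
    simp
  obtain ⟨C, hC⟩ := hψmem (ε / 3) (by positivity)
  refine ⟨C, fun n x y => ?_⟩
  have h1 := abs_le.1 (hS n x)
  have h2 := abs_le.1 (hS n y)
  have h3 := abs_le.1 (hC n x y)
  rw [abs_le]
  constructor <;> linarith [h1.1, h1.2, h2.1, h2.2, h3.1, h3.2]


theorem hasDerivAt_iterate {f f' : ℝ → ℝ} (hf : ∀ x, HasDerivAt f (Real.exp (f' x)) x) (n : ℕ)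
    (x : ℝ) : HasDerivAt f^[n] (Real.exp (birkhoffSum f f' n x)) x := by
  induction n with
  | zero => simpa using hasDerivAt_id x
  | succ n ih =>
    rw [Function.iterate_succ', birkhoffSum_succ, add_comm, Real.exp_add]
    exact (hf _).comp x ih

/-- The Birkhoff sums of the logarithmic derivative of a circle diffeomorphism of irrational
rotation number are uniformly `o(n)`. -/
theorem exists_abs_birkhoffSum_le (f : CircleDeg1Liftˣ) (hf : Irrational (translationNumber f))
    {φ : ℝ → ℝ} (hφ : Continuous φ) (hper : Function.Periodic φ 1)
    (hderiv : ∀ x, HasDerivAt f (Real.exp (φ x)) x) {ε : ℝ} (hε : 0 < ε) :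
    ∃ n : ℕ, 0 < n ∧ ∀ x, |birkhoffSum f φ n x| ≤ n * ε := by
  obtain ⟨C, hC⟩ := mem_uniformBirkhoff_of_continuous f hf hφ hper (ε / 2) (by positivity)
  obtain ⟨n, hn⟩ := exists_nat_gt (max 0 (2 * C / ε))
  have hn0 : (0 : ℝ) < n := (le_max_left _ _).trans_lt hn
  have hnC : 2 * C < n * ε := (div_lt_iff₀ hε).1 ((le_max_right _ _).trans_lt hn)
  refine ⟨n, by exact_mod_cast hn0, fun x => ?_⟩
  have hd := hasDerivAt_iterate hderiv n
  obtain ⟨y, -, hy⟩ := exists_hasDerivAt_eq_slope f^[n] _ (zero_lt_one' ℝ)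
    (fun z _ => (hd z).continuousAt.continuousWithinAt) (fun z _ => hd z)
  have h1 : f^[n] 1 = f^[n] 0 + 1 := by
    have := ((f : CircleDeg1Lift) ^ n).map_add_one 0
    rwa [zero_add, coe_pow] at this
  rw [h1] at hy
  have hy0 : birkhoffSum f φ n y = 0 := by
    rw [← Real.exp_eq_one_iff, hy]; ring
  have := hC n x y
  rw [hy0, sub_zero] at this
  linarith

/-- A lift whose displacement has small derivative is uniformly close to the translation by its
translation number. -/
theorem abs_sub_add_translationNumber_le (g : CircleDeg1Lift) {g' : ℝ → ℝ} {ε : ℝ}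
    (hg : ∀ x, HasDerivAt g (g' x) x) (hε : ∀ x, |g' x - 1| ≤ ε) (x : ℝ) :
    |g x - (x + translationNumber g)| ≤ ε := by
  have hcont : Continuous g := continuous_iff_continuousAt.2 fun x => (hg x).continuousAt
  obtain ⟨y, hy⟩ := exists_eq_add_translationNumber g hcont
  have hε0 : 0 ≤ ε := (abs_nonneg _).trans (hε 0)
  have h := convex_univ.norm_image_sub_le_of_norm_hasDerivWithin_le
    (f := fun x => g x - x) (fun z _ => ((hg z).sub (hasDerivAt_id z)).hasDerivWithinAt)
    (fun z _ => hε z) (Set.mem_univ y) (Set.mem_univ (x - ⌊x - y⌋))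
  have h2 : |x - ⌊x - y⌋ - y| ≤ 1 := by
    rw [abs_le]
    constructor <;> linarith [Int.floor_le (x - y), Int.lt_floor_add_one (x - y)]
  rw [Real.norm_eq_abs, Real.norm_eq_abs, map_sub_int] at h
  calc |g x - (x + translationNumber g)|
      = |g x - ⌊x - y⌋ - (x - ⌊x - y⌋) - (g y - y)| := by rw [hy]; ring_nf
    _ ≤ ε * |x - ⌊x - y⌋ - y| := h
    _ ≤ ε * 1 := by gcongr
    _ = ε := mul_one ε

/-- The lift obtained by integrating a continuous periodic density of total mass one. -/
theorem exists_hasDerivAt_of_periodic {w : ℝ → ℝ} (hw : Continuous w) (hpos : ∀ x, 0 < w x)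
    (hper : Function.Periodic w 1) (hint : ∫ x in (0 : ℝ)..1, w x = 1) :
    ∃ h : CircleDeg1Liftˣ, ∀ x, HasDerivAt h (w x) x := by
  set H : ℝ → ℝ := fun x => ∫ t in (0 : ℝ)..x, w t
  have hd (x : ℝ) : HasDerivAt H (w x) x := (hw.integral_hasStrictDerivAt 0 x).hasDerivAt
  have hmono : StrictMono H := strictMono_of_deriv_pos fun x => (hd x).deriv.symm ▸ hpos x
  have hadd (x : ℝ) : H (x + 1) = H x + 1 := by
    rw [← sub_eq_iff_eq_add', intervalIntegral.integral_interval_sub_left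
      (hw.intervalIntegrable _ _) (hw.intervalIntegrable _ _),
      hper.intervalIntegral_add_eq x 0, zero_add, hint]
  let h : CircleDeg1Lift := ⟨⟨H, hmono.monotone⟩, hadd⟩
  have hcont : Continuous h := continuous_iff_continuousAt.2 fun x => (hd x).continuousAt
  obtain ⟨u, hu⟩ := isUnit_iff_bijective.2
    ⟨hmono.injective, (continuous_iff_surjective h).1 hcont⟩
  exact ⟨u, fun x => by rw [hu]; exact hd x⟩

/-- Conjugating by the lift with density proportional to the exponential of the average of the
first `n` Birkhoff sums of `log (deriv f)` turns the derivative of `f` into the `n`-th root of the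
derivative of its `n`-th iterate. -/
theorem exists_conj_hasDerivAt (f : CircleDeg1Liftˣ) {φ : ℝ → ℝ} (hφ : Continuous φ)
    (hper : Function.Periodic φ 1) (hderiv : ∀ x, HasDerivAt f (Real.exp (φ x)) x)
    {n : ℕ} (hn : 0 < n) :
    ∃ (h : CircleDeg1Liftˣ) (w : ℝ → ℝ), Continuous w ∧ (∀ x, 0 < w x) ∧
      (∀ x, HasDerivAt h (w x) x) ∧
      ∀ y, HasDerivAt (fun y => h (f ((h⁻¹ : CircleDeg1Liftˣ) y)))
        (Real.exp (birkhoffSum f φ n ((h⁻¹ : CircleDeg1Liftˣ) y) / n)) y := by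
  have hfc : Continuous f := (toOrderIso f).continuous
  have hScont (k : ℕ) : Continuous (birkhoffSum f φ k) :=
    continuous_finsetSum _ fun i _ => hφ.comp (hfc.iterate i)
  have hSper (k : ℕ) : Function.Periodic (birkhoffSum f φ k) 1 := fun x => by
    refine Finset.sum_congr rfl fun i _ => ?_
    rw [← coe_pow, map_add_one, hper]
  set u : ℝ → ℝ := fun x => (∑ k ∈ Finset.range n, birkhoffSum f φ k x) / n
  have hucont : Continuous u := (continuous_finsetSum _ fun k _ => hScont k).div_const _
  have huper : Function.Periodic u 1 := fun x => by simp only [u, hSper _ x]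
  have hu (x : ℝ) : u (f x) + φ x - u x = birkhoffSum f φ n x / n := by
    have hn' : (n : ℝ) ≠ 0 := by positivity
    have h1 (k : ℕ) : birkhoffSum f φ k (f x) = birkhoffSum f φ (k + 1) x - φ x := by
      rw [birkhoffSum_succ']; ring
    have h2 := Finset.sum_range_sub (fun k => birkhoffSum f φ k x) n
    rw [Finset.sum_sub_distrib, birkhoffSum_zero, sub_zero] at h2
    simp only [u, h1, Finset.sum_sub_distrib, Finset.sum_const, Finset.card_range, nsmul_eq_mul]
    rw [← h2]
    field_simp
    ring
  set c := ∫ x in (0 : ℝ)..1, Real.exp (u x)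
  have hexp : Continuous fun x => Real.exp (u x) := Real.continuous_exp.comp hucont
  have hc : 0 < c := intervalIntegral.intervalIntegral_pos_of_pos
    (hexp.intervalIntegrable _ _) (fun x => Real.exp_pos _) zero_lt_one
  have hwpos (x : ℝ) : 0 < Real.exp (u x) / c := div_pos (Real.exp_pos _) hc
  obtain ⟨h, hh⟩ := exists_hasDerivAt_of_periodic (hexp.div_const c) hwpos
    (fun x => by simp only [huper x])
    (by rw [intervalIntegral.integral_div]; exact div_self hc.ne')
  refine ⟨h, _, hexp.div_const c, hwpos, hh, fun y => ?_⟩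
  set x := (h⁻¹ : CircleDeg1Liftˣ) y
  have hinv : HasDerivAt (h⁻¹ : CircleDeg1Liftˣ) (Real.exp (u x) / c)⁻¹ y :=
    HasDerivAt.of_local_left_inverse (toOrderIso h⁻¹).continuous.continuousAt (hh x)
      (hwpos x).ne' (Eventually.of_forall (units_apply_inv_apply h))
  have hcomp := (hh (f x)).comp y ((hderiv x).comp y hinv)
  refine hcomp.congr_deriv ?_
  rw [← hu, Real.exp_sub, Real.exp_add]
  have := hc.ne'
  field_simp

end CircleDeg1Lift

/-- A `C¹` circle diffeomorphism of irrational rotation number `ρ`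
(described by its lift `F`, a `C¹` strictly increasing bijection of `ℝ` with positive
derivative commuting with `x ↦ x+1`) has the rigid rotation `R_ρ` in the `C¹`-closure of
its conjugacy class: there are lifts `H_n` of `C¹` diffeomorphisms such that the
conjugates `G_n = H_n ∘ F ∘ H_n⁻¹` satisfy `G_n → x + ρ` and `G_n' → 1` uniformly. -/
theorem conjugates_tendsto_rotation_C1
    (F : ℝ → ℝ) (hC1 : ContDiff ℝ 1 F) (hmono : StrictMono F)
    (hbij : Function.Bijective F) (hpos : ∀ x : ℝ, 0 < deriv F x)
    (hper : ∀ x : ℝ, F (x + 1) = F x + 1)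
    (ρ : ℝ) (hirr : Irrational ρ)
    (hrot : ∀ x : ℝ, Tendsto (fun n : ℕ => F^[n] x / n) atTop (nhds ρ)) :
    ∃ H : ℕ → ℝ → ℝ,
      (∀ n : ℕ, ContDiff ℝ 1 (H n) ∧ StrictMono (H n) ∧ Function.Bijective (H n) ∧
        (∀ x : ℝ, 0 < deriv (H n) x) ∧ (∀ x : ℝ, H n (x + 1) = H n x + 1)) ∧
      TendstoUniformly
        (fun (n : ℕ) (x : ℝ) => H n (F (Function.invFun (H n) x)))
        (fun x => x + ρ) atTop ∧
      TendstoUniformly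
        (fun (n : ℕ) (x : ℝ) => deriv (fun y => H n (F (Function.invFun (H n) y))) x)
        (fun _ => 1) atTop := by
  obtain ⟨f, hf⟩ := CircleDeg1Lift.isUnit_iff_bijective (f := ⟨⟨F, hmono.monotone⟩, hper⟩).2 hbij
  obtain rfl : ⇑(f : CircleDeg1Lift) = F := by rw [hf]; rfl
  have hτ : CircleDeg1Lift.translationNumber f = ρ :=
    tendsto_nhds_unique (by simpa only [CircleDeg1Lift.coe_pow] using
      CircleDeg1Lift.tendsto_translation_number₀ (f : CircleDeg1Lift)) (hrot 0)
  have hdiff : Differentiable ℝ f := hC1.differentiable one_ne_zero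
  set φ : ℝ → ℝ := fun x => Real.log (deriv f x) with hφ
  have hφc : Continuous φ := (hC1.continuous_deriv le_rfl).log fun x => (hpos x).ne'
  have hφper : Function.Periodic φ 1 := fun x => by
    have h : (fun x => f (x + 1)) = fun x => f x + 1 := funext hper
    have h2 := congrArg (fun g => deriv g x) h
    simp only [deriv_comp_add_const, deriv_add_const] at h2
    simp only [hφ, h2]
  have hderiv (x : ℝ) : HasDerivAt f (Real.exp (φ x)) x := by
    rw [hφ, Real.exp_log (hpos x)]; exact (hdiff x).hasDerivAt
  have key (ε : ℝ) (hε : 0 < ε) (hε1 : ε ≤ 1) : ∃ H : ℝ → ℝ,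
      (ContDiff ℝ 1 H ∧ StrictMono H ∧ Function.Bijective H ∧
        (∀ x : ℝ, 0 < deriv H x) ∧ (∀ x : ℝ, H (x + 1) = H x + 1)) ∧
      (∀ x, |H (f (Function.invFun H x)) - (x + ρ)| ≤ 2 * ε) ∧
      ∀ x, |deriv (fun y => H (f (Function.invFun H y))) x - 1| ≤ 2 * ε := by
    obtain ⟨n, hn, hS⟩ := CircleDeg1Lift.exists_abs_birkhoffSum_le f (hτ ▸ hirr) hφc hφper hderiv hε
    obtain ⟨h, w, hwc, hwpos, hhw, hG⟩ :=
      CircleDeg1Lift.exists_conj_hasDerivAt f hφc hφper hderiv hn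
    have hdw : deriv h = w := funext fun x => (hhw x).deriv
    have hinv : Function.invFun h = (h⁻¹ : CircleDeg1Liftˣ) := funext fun y => by
      apply (CircleDeg1Lift.toOrderIso h).injective
      rw [CircleDeg1Lift.coe_toOrderIso, CircleDeg1Lift.units_apply_inv_apply]
      exact Function.invFun_eq ⟨_, CircleDeg1Lift.units_apply_inv_apply h y⟩
    have hbound (x : ℝ) : |Real.exp
        (birkhoffSum f φ n ((h⁻¹ : CircleDeg1Liftˣ) x) / n) - 1| ≤ 2 * ε := by
      have hs : |birkhoffSum f φ n ((h⁻¹ : CircleDeg1Liftˣ) x) / n| ≤ ε := by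
        rw [abs_div, Nat.abs_cast, div_le_iff₀ (by positivity), mul_comm]
        exact hS _
      exact (Real.abs_exp_sub_one_le (hs.trans hε1)).trans (by gcongr)
    refine ⟨h, ⟨contDiff_one_iff_deriv.2 ⟨fun x => (hhw x).differentiableAt, hdw ▸ hwc⟩,
      (CircleDeg1Lift.toOrderIso h).strictMono, (CircleDeg1Lift.toOrderIso h).bijective,
      fun x => hdw ▸ hwpos x, fun x => CircleDeg1Lift.map_add_one _ x⟩, fun x => ?_, fun x => ?_⟩
    · have hconj := CircleDeg1Lift.translationNumber_conj_eq h f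
      rw [hτ] at hconj
      rw [hinv, ← hconj]
      exact CircleDeg1Lift.abs_sub_add_translationNumber_le
        (h * f * (h⁻¹ : CircleDeg1Liftˣ)) hG hbound x
    · rw [hinv, (hG x).deriv]
      exact hbound x
  choose! H hH hH0 hH1 using key
  have hε (n : ℕ) : (0 : ℝ) < 1 / (n + 1) ∧ (1 : ℝ) / (n + 1) ≤ 1 :=
    ⟨by positivity, by rw [div_le_one (by positivity)]; linarith [Nat.cast_nonneg (α := ℝ) n]⟩
  have hlim : Tendsto (fun n : ℕ => 2 * ((1 : ℝ) / (n + 1))) atTop (nhds 0) := by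
    simpa using tendsto_one_div_add_atTop_nhds_zero_nat.const_mul (2 : ℝ)
  refine ⟨fun n => H (1 / (n + 1)), fun n => hH _ (hε n).1 (hε n).2, ?_, ?_⟩ <;>
    refine Metric.tendstoUniformly_iff.2 fun δ hδ => ?_ <;>
    filter_upwards [hlim.eventually_lt_const hδ] with n hn x <;>
    rw [dist_comm, Real.dist_eq]
  · exact (hH0 _ (hε n).1 (hε n).2 x).trans_lt hn
  · exact (hH1 _ (hε n).1 (hε n).2 x).trans_lt hn
end

section
/- Every countable group G admitting a left-invariant strict total order embeds into the group of order-automorphisms of the real line: there exists an injective group homomorphism from G into the group of order-preserving bijections ℝ ≃o ℝ (equivalently, orientation-preserving homeomorphisms of ℝ). -/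
/-- The image of `x` under the extension to `ℝ` of an order automorphism `f` of `ℚ`. -/
noncomputable def ratOrderAutExtend (f : ℚ ≃o ℚ) (x : ℝ) : ℝ :=
  sSup ((fun q : ℚ => ((f q : ℚ) : ℝ)) '' {q : ℚ | (q : ℝ) < x})

theorem ratCast_lt_ratOrderAutExtend (f : ℚ ≃o ℚ) (x : ℝ) (q : ℚ) :
    (q : ℝ) < ratOrderAutExtend f x ↔ ((f.symm q : ℚ) : ℝ) < x := by
  have hne : ((fun q : ℚ => ((f q : ℚ) : ℝ)) '' {q : ℚ | (q : ℝ) < x}).Nonempty := by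
    obtain ⟨p, hp⟩ := exists_rat_lt x
    exact ⟨_, p, hp, rfl⟩
  have hbdd : BddAbove ((fun q : ℚ => ((f q : ℚ) : ℝ)) '' {q : ℚ | (q : ℝ) < x}) := by
    obtain ⟨p, hp⟩ := exists_rat_gt x
    refine ⟨(f p : ℚ), ?_⟩
    rintro _ ⟨s, hs, rfl⟩
    exact Rat.cast_le.2 (f.monotone (Rat.cast_le.1 (hs.trans hp).le))
  rw [ratOrderAutExtend, lt_csSup_iff hbdd hne]
  constructor
  · rintro ⟨_, ⟨p, hp, rfl⟩, hqp⟩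
    have : f.symm q < p := f.symm_apply_lt.2 (Rat.cast_lt.1 hqp)
    exact (Rat.cast_lt.2 this).trans hp
  · intro h
    obtain ⟨p, hqp, hpx⟩ := exists_rat_btwn h
    exact ⟨_, ⟨p, hpx, rfl⟩, Rat.cast_lt.2 (f.symm_apply_lt.1 (Rat.cast_lt.1 hqp))⟩

theorem Real.le_of_forall_ratCast_lt {x y : ℝ} (h : ∀ q : ℚ, (q : ℝ) < x → (q : ℝ) < y) :
    x ≤ y := by
  by_contra! hyx
  obtain ⟨q, hyq, hqx⟩ := exists_rat_btwn hyx
  exact (h q hqx).not_gt hyq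

theorem Real.eq_of_forall_ratCast_lt_iff {x y : ℝ}
    (h : ∀ q : ℚ, (q : ℝ) < x ↔ (q : ℝ) < y) : x = y :=
  le_antisymm (le_of_forall_ratCast_lt fun q => (h q).1)
    (le_of_forall_ratCast_lt fun q => (h q).2)

theorem ratOrderAutExtend_monotone (f : ℚ ≃o ℚ) : Monotone (ratOrderAutExtend f) := by
  intro x y hxy
  refine Real.le_of_forall_ratCast_lt fun q hq => ?_
  rw [ratCast_lt_ratOrderAutExtend] at hq ⊢
  exact hq.trans_le hxy

theorem ratOrderAutExtend_one (x : ℝ) : ratOrderAutExtend 1 x = x :=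
  Real.eq_of_forall_ratCast_lt_iff fun q => ratCast_lt_ratOrderAutExtend 1 x q

theorem ratOrderAutExtend_mul (f g : ℚ ≃o ℚ) (x : ℝ) :
    ratOrderAutExtend (f * g) x = ratOrderAutExtend f (ratOrderAutExtend g x) :=
  Real.eq_of_forall_ratCast_lt_iff fun q => by
    simp only [ratCast_lt_ratOrderAutExtend]
    rfl

/-- Extension of order automorphisms from `ℚ` to `ℝ`, as a group homomorphism. -/
noncomputable def ratOrderAutExtendHom : (ℚ ≃o ℚ) →* (ℝ ≃o ℝ) where
  toFun f :=
    (Equiv.mk (ratOrderAutExtend f) (ratOrderAutExtend f⁻¹)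
      (fun x => by rw [← ratOrderAutExtend_mul, inv_mul_cancel, ratOrderAutExtend_one])
      (fun x => by
        rw [← ratOrderAutExtend_mul, mul_inv_cancel, ratOrderAutExtend_one])).toOrderIso
      (ratOrderAutExtend_monotone f) (ratOrderAutExtend_monotone f⁻¹)
  map_one' := RelIso.ext ratOrderAutExtend_one
  map_mul' f g := RelIso.ext (ratOrderAutExtend_mul f g)

theorem ratOrderAutExtendHom_injective : Function.Injective ratOrderAutExtendHom := by
  intro f g hfg
  have hext (x : ℝ) : ratOrderAutExtend f x = ratOrderAutExtend g x := DFunLike.congr_fun hfg x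
  have hsymm : f.symm = g.symm := by
    ext q
    refine eq_of_forall_gt_iff fun c => ?_
    rw [← Rat.cast_lt (K := ℝ), ← Rat.cast_lt (K := ℝ), ← ratCast_lt_ratOrderAutExtend,
      ← ratCast_lt_ratOrderAutExtend, hext]
  simpa using congrArg OrderIso.symm hsymm

/-- Left translation on the first factor of `G ×ₗ α`, as an order automorphism. -/
def lexMulLeft {G : Type*} (α : Type*) [Group G] [LinearOrder G] [MulLeftStrictMono G]
    [LinearOrder α] : G →* ((G ×ₗ α) ≃o (G ×ₗ α)) where
  toFun g :=
    { toFun x := toLex (g * (ofLex x).1, (ofLex x).2)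
      invFun x := toLex (g⁻¹ * (ofLex x).1, (ofLex x).2)
      left_inv x := by simp
      right_inv x := by simp
      map_rel_iff' := by simp [Prod.Lex.le_iff] }
  map_one' := by ext x; simp
  map_mul' g h := by ext x; simp [mul_assoc]

theorem lexMulLeft_injective {G : Type*} (α : Type*) [Group G] [LinearOrder G]
    [MulLeftStrictMono G] [LinearOrder α] [Nonempty α] :
    Function.Injective (lexMulLeft α : G →* _) := by
  intro g h hgh
  obtain ⟨a⟩ := ‹Nonempty α›
  have := DFunLike.congr_fun hgh (toLex (1, a))
  simpa [lexMulLeft] using this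

/-- Conjugation by an order isomorphism, as a homomorphism of automorphism groups. -/
def OrderIso.conjHom {α β : Type*} [LE α] [LE β] (e : α ≃o β) : (α ≃o α) →* (β ≃o β) where
  toFun f := (e.symm.trans f).trans e
  map_one' := by ext x; simp
  map_mul' f g := by ext x; simp

theorem OrderIso.conjHom_injective {α β : Type*} [LE α] [LE β] (e : α ≃o β) :
    Function.Injective e.conjHom := by
  intro f g hfg
  ext x
  simpa [OrderIso.conjHom] using DFunLike.congr_fun hfg (e x)

/-- Every countable group admitting a left-invariant strict total order
embeds into the group of order-automorphisms of the real line: there is an injective group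
homomorphism `G →* (ℝ ≃o ℝ)`. -/
theorem countable_left_orderable_embeds_in_orderAut_real
    {G : Type*} [Group G] [Countable G]
    (r : G → G → Prop) (hto : IsStrictTotalOrder G r)
    (hleft : ∀ h f g : G, r f g → r (h * f) (h * g)) :
    ∃ Φ : G →* (ℝ ≃o ℝ), Function.Injective Φ := by
  classical
  let : LinearOrder G := linearOrderOfSTO r
  have : MulLeftStrictMono G := ⟨fun h _ _ hfg => hleft h _ _ hfg⟩
  have : Countable (G ×ₗ ℚ) := inferInstanceAs (Countable (G × ℚ))
  obtain ⟨e⟩ := Order.iso_of_countable_dense (G ×ₗ ℚ) ℚ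
  exact ⟨(ratOrderAutExtendHom.comp e.conjHom).comp (lexMulLeft ℚ),
    (ratOrderAutExtendHom_injective.comp e.conjHom_injective).comp (lexMulLeft_injective ℚ)⟩
end

section
/- Let G be a group acting on ℝ by order-preserving bijections (a group homomorphism φ : G → (ℝ ≃o ℝ)), and let μ be a Borel measure on ℝ, finite on compact sets, that is invariant under the action: (φ g)_*(μ) = μ for all g ∈ G. Fix x ∈ ℝ and define τ : G → ℝ by τ(g) = μ([x, g·x)) if g·x ≥ x and τ(g) = −μ([g·x, x)) if g·x < x. Then τ is a group homomorphism from G to (ℝ, +), and its value is independent of the choice of the base point x. -/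
open MeasureTheory

/-- The signed measure of the half-open interval between `a` and `b`. -/
noncomputable def signedIco (μ : Measure ℝ) (a b : ℝ) : ℝ :=
  μ.real (Set.Ico a b) - μ.real (Set.Ico b a)

theorem signedIco_of_le (μ : Measure ℝ) {a b : ℝ} (h : a ≤ b) :
    signedIco μ a b = μ.real (Set.Ico a b) := by
  simp [signedIco, Set.Ico_eq_empty_of_le h]

theorem signedIco_swap (μ : Measure ℝ) (a b : ℝ) : signedIco μ b a = -signedIco μ a b := by
  simp [signedIco]

theorem measureReal_Ico_add_Ico (μ : Measure ℝ) [IsFiniteMeasureOnCompacts μ] {a b c : ℝ}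
    (hab : a ≤ b) (hbc : b ≤ c) :
    μ.real (Set.Ico a b) + μ.real (Set.Ico b c) = μ.real (Set.Ico a c) := by
  rw [← Set.Ico_union_Ico_eq_Ico hab hbc,
    measureReal_union (Set.Ico_disjoint_Ico_same) measurableSet_Ico
      measure_Ico_lt_top.ne measure_Ico_lt_top.ne]

theorem signedIco_add (μ : Measure ℝ) [IsFiniteMeasureOnCompacts μ] (a b c : ℝ) :
    signedIco μ a b + signedIco μ b c = signedIco μ a c := by
  have key : ∀ {x y z : ℝ}, x ≤ y → y ≤ z →
      signedIco μ x y + signedIco μ y z = signedIco μ x z := fun hxy hyz => by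
    rw [signedIco_of_le μ hxy, signedIco_of_le μ hyz, signedIco_of_le μ (hxy.trans hyz),
      measureReal_Ico_add_Ico μ hxy hyz]
  have hab := signedIco_swap μ a b
  have hbc := signedIco_swap μ b c
  have hac := signedIco_swap μ a c
  rcases le_total a b with h₁ | h₁ <;> rcases le_total b c with h₂ | h₂ <;>
    rcases le_total a c with h₃ | h₃
  · linarith [key h₁ h₂]
  · linarith [key h₁ h₂]
  · linarith [key h₃ h₂]
  · linarith [key h₃ h₁]
  · linarith [key h₁ h₃]
  · linarith [key h₂ h₃]
  · linarith [key h₂ h₁]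
  · linarith [key h₂ h₁]

theorem signedIco_map_orderIso {μ : Measure ℝ} {e : ℝ ≃o ℝ} (he : Measure.map e μ = μ)
    (a b : ℝ) : signedIco μ (e a) (e b) = signedIco μ a b := by
  have key : ∀ x y : ℝ, μ.real (Set.Ico (e x) (e y)) = μ.real (Set.Ico x y) := fun x y => by
    conv_lhs => rw [← he]
    rw [map_measureReal_apply e.continuous.measurable measurableSet_Ico,
      e.preimage_Ico, e.symm_apply_apply, e.symm_apply_apply]
  rw [signedIco, signedIco, key, key]

/-- Given an action `φ : G →* (ℝ ≃o ℝ)` of a group on the line by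
order-preserving bijections and an invariant Borel measure `μ` finite on compact sets, the
translation number `τ(g, x) = μ([x, g·x))` (with a minus sign if `g·x < x`) defines, for
each base point `x`, a group homomorphism `G → ℝ`, and its value does not depend on `x`. -/
theorem translation_number_homomorphism
    {G : Type*} [Group G] (φ : G →* (ℝ ≃o ℝ))
    (μ : Measure ℝ) [IsFiniteMeasureOnCompacts μ]
    (hinv : ∀ g : G, Measure.map (φ g) μ = μ)
    (τ : G → ℝ → ℝ)
    (hτpos : ∀ (g : G) (x : ℝ), x ≤ φ g x → τ g x = (μ (Set.Ico x (φ g x))).toReal)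
    (hτneg : ∀ (g : G) (x : ℝ), φ g x < x → τ g x = -(μ (Set.Ico (φ g x) x)).toReal) :
    (∀ (x : ℝ) (g g' : G), τ (g * g') x = τ g x + τ g' x) ∧
      (∀ (g : G) (x y : ℝ), τ g x = τ g y) := by
  have hτ : ∀ g x, τ g x = signedIco μ x (φ g x) := fun g x => by
    rcases le_or_gt x (φ g x) with h | h
    · rw [hτpos g x h, signedIco_of_le μ h, measureReal_def]
    · rw [hτneg g x h, signedIco_swap, signedIco_of_le μ h.le, measureReal_def]
  refine ⟨fun x g g' => ?_, fun g x y => ?_⟩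
  · rw [hτ, hτ, hτ, map_mul, RelIso.mul_apply, ← signedIco_add μ x (φ g x),
      signedIco_map_orderIso (hinv g)]
  · rw [hτ, hτ]
    linarith [signedIco_add μ x y (φ g y), signedIco_add μ x (φ g x) (φ g y),
      signedIco_map_orderIso (hinv g) x y]
end

section
/- (Dubrovina–Dubrovin for B₃.) Let G be the group with presentation ⟨a, b : b a² b = a⟩ (a presentation of the braid group B₃, where a = σ₁σ₂ and b = σ₂⁻¹). Let P be the subsemigroup of G generated by {a, b} and P′ the subsemigroup generated by {a⁻¹, b⁻¹}. Then G is the disjoint union of P, P′ and {1}. In particular, P is the positive cone of a left-invariant total order on B₃. -/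
/-- The relation `b a² b = a`, written as the word `b * a * a * b * a⁻¹`, in the free group
on two generators `a = of true` and `b = of false`. -/
def braidRels : Set (FreeGroup Bool) :=
  {FreeGroup.of false * FreeGroup.of true * FreeGroup.of true * FreeGroup.of false *
    (FreeGroup.of true)⁻¹}

/-- The braid group `B₃` presented as `⟨a, b : b a² b = a⟩` (with `a = σ₁σ₂`,
`b = σ₂⁻¹`). -/
abbrev BraidB3 : Type := PresentedGroup braidRels

section TwoGenerators

variable {G : Type*} [Group G] {a b : G}

theorem commute_pow_three_of_rel (h : b * a * a * b = a) (g : G)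
    (hg : g ∈ Subgroup.closure {a, b}) : Commute (a ^ 3) g := by
  have ha : Commute (a ^ 3) a := (Commute.refl a).pow_left 3
  have hb : Commute (a ^ 3) b := by
    have h₁ : a ^ 3 = b * a * a * b * a * a := by rw [h, pow_three']
    have h₂ : a ^ 3 = a * a * (b * a * a * b) := by rw [h, pow_three']
    change a ^ 3 * b = b * a ^ 3
    calc a ^ 3 * b = b * a * a * b * a * a * b := by rw [← h₁]
      _ = b * (a * a * (b * a * a * b)) := by group
      _ = b * a ^ 3 := by rw [← h₂]
  induction hg using Subgroup.closure_induction with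
  | mem x hx =>
    rcases hx with rfl | rfl
    · exact ha
    · exact hb
  | one => exact Commute.one_right _
  | mul x y _ _ hx hy => exact hx.mul_right hy
  | inv x _ hx => exact hx.inv_right

/-- `IsBraidReduced a b k p` says that `p` is either a power `a ^ n` with `k ≤ n`, or a product
`a ^ n * m * b * a ^ j` with `j ≤ 2` and `m` a product of factors `b` and `b * a`. -/
def IsBraidReduced (a b : G) (k : ℕ) (p : G) : Prop :=
  (∃ n, k ≤ n ∧ p = a ^ n) ∨
    ∃ n : ℕ, ∃ m ∈ Submonoid.closure {b, b * a}, ∃ j ≤ 2, p = a ^ n * m * b * a ^ j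

theorem IsBraidReduced.mono {k l : ℕ} {p : G} (hkl : k ≤ l) (hp : IsBraidReduced a b l p) :
    IsBraidReduced a b k p :=
  hp.imp_left fun ⟨n, hn, e⟩ => ⟨n, hkl.trans hn, e⟩

theorem IsBraidReduced.mul_fst (hc : ∀ g : G, Commute (a ^ 3) g) {p : G}
    (hp : IsBraidReduced a b 0 p) : IsBraidReduced a b 1 (p * a) := by
  rcases hp with ⟨n, -, rfl⟩ | ⟨n, m, hm, j, hj, rfl⟩
  · exact .inl ⟨n + 1, by lia, (pow_succ a n).symm⟩
  · rcases hj.lt_or_eq with hj | rfl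
    · exact .inr ⟨n, m, hm, j + 1, hj, by group⟩
    · refine .inr ⟨n + 3, m, hm, 0, by lia, ?_⟩
      calc a ^ n * m * b * a ^ 2 * a = a ^ n * (m * b * a ^ 3) := by group
        _ = a ^ n * (a ^ 3 * (m * b)) := by rw [(hc (m * b)).eq]
        _ = a ^ (n + 3) * m * b * a ^ 0 := by group

theorem IsBraidReduced.mul_snd (h : b * a * a * b = a) {p : G}
    (hp : IsBraidReduced a b 0 p) : IsBraidReduced a b 1 (p * b) := by
  have hb : b ∈ Submonoid.closure {b, b * a} := Submonoid.subset_closure (by simp)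
  have hba : b * a ∈ Submonoid.closure {b, b * a} := Submonoid.subset_closure (by simp)
  rcases hp with ⟨n, -, rfl⟩ | ⟨n, m, hm, j, hj, rfl⟩
  · exact .inr ⟨n, 1, one_mem _, 0, by lia, by group⟩
  · interval_cases j
    · exact .inr ⟨n, m * b, mul_mem hm hb, 0, by lia, by group⟩
    · exact .inr ⟨n, m * (b * a), mul_mem hm hba, 0, by lia, by group⟩
    · have e : a ^ n * m * b * a ^ 2 * b = a ^ n * m * a := by
        calc a ^ n * m * b * a ^ 2 * b = a ^ n * m * (b * a * a * b)
          := by rw [pow_two]; simp only [mul_assoc]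
          _ = a ^ n * m * a := by rw [h]
      rw [e]
      induction hm using Submonoid.closure_induction_right with
      | one => exact .inl ⟨n + 1, by lia, by group⟩
      | mul_right x hx y hy _ =>
        rcases hy with rfl | rfl
        · exact .inr ⟨n, x, hx, 1, by lia, by group⟩
        · exact .inr ⟨n, x, hx, 2, le_rfl, by rw [pow_two]; simp only [mul_assoc]⟩

theorem isBraidReduced_of_mem_closure (h : b * a * a * b = a) (hc : ∀ g : G, Commute (a ^ 3) g)
    {p : G} (hp : p ∈ Subsemigroup.closure {a, b}) : IsBraidReduced a b 1 p := by
  suffices H : ∀ q, IsBraidReduced a b 0 q → IsBraidReduced a b 1 (q * p) by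
    simpa using H 1 (.inl ⟨0, le_rfl, by simp⟩)
  induction hp using Subsemigroup.closure_induction with
  | mem x hx =>
    rcases hx with rfl | rfl
    · exact fun q hq => hq.mul_fst hc
    · exact fun q hq => hq.mul_snd h
  | mul x y _ _ hx hy =>
    intro q hq
    rw [← mul_assoc]
    exact hy _ ((hx q hq).mono zero_le_one)

theorem mem_closure_semigroup_or_eq_one {M : Type*} [Monoid M] {s : Set M} {x : M}
    (hx : x ∈ Submonoid.closure s) : x ∈ Subsemigroup.closure s ∨ x = 1 := by
  induction hx using Submonoid.closure_induction with
  | mem x hx => exact .inl (Subsemigroup.subset_closure hx)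
  | one => exact .inr rfl
  | mul x y _ _ hx hy =>
    rcases hx with hx | rfl
    · rcases hy with hy | rfl
      · exact .inl (mul_mem hx hy)
      · simpa using Or.inl hx
    · simpa using hy

theorem inv_mem_closure_pair_inv {x : G} (hx : x ∈ Subsemigroup.closure {a, b}) :
    x⁻¹ ∈ Subsemigroup.closure {a⁻¹, b⁻¹} := by
  induction hx using Subsemigroup.closure_induction with
  | mem x hx =>
    apply Subsemigroup.subset_closure
    rcases hx with rfl | rfl <;> simp
  | mul x y _ _ hx hy =>
    rw [mul_inv_rev]
    exact mul_mem hy hx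

theorem exists_inv_mul_eq_mul_of_mem_closure (h : b * a * a * b = a) {m : G}
    (hm : m ∈ Submonoid.closure {b, b * a}) :
    ∃ x ∈ Submonoid.closure {a, b}, m⁻¹ * a = a * x := by
  have ha : a ∈ Submonoid.closure {a, b} := Submonoid.subset_closure (by simp)
  have hb : b ∈ Submonoid.closure {a, b} := Submonoid.subset_closure (by simp)
  have hba : b⁻¹ * a = a * (a * b) := by
    rw [inv_mul_eq_iff_eq_mul]
    simpa only [mul_assoc] using h.symm
  induction hm using Submonoid.closure_induction_right with
  | one => exact ⟨1, one_mem _, by simp⟩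
  | mul_right m _ y hy ih =>
    obtain ⟨x, hx, e⟩ := ih
    rcases hy with rfl | rfl
    · refine ⟨a * y * x, mul_mem (mul_mem ha hb) hx, ?_⟩
      rw [mul_inv_rev, mul_assoc, e, ← mul_assoc, hba]
      group
    · refine ⟨b * x, mul_mem hb hx, ?_⟩
      calc (m * (b * a))⁻¹ * a = a⁻¹ * b⁻¹ * (m⁻¹ * a) := by group
        _ = a⁻¹ * (b⁻¹ * a) * x := by rw [e]; group
        _ = a * (b * x) := by rw [hba]; group

theorem mem_or_inv_mem_of_mul_pow_three_mem (h : b * a * a * b = a)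
    (hc : ∀ g : G, Commute (a ^ 3) g) {g : G}
    (hg : g * a ^ 3 ∈ Submonoid.closure {a, b}) :
    g ∈ Submonoid.closure {a, b} ∨ g⁻¹ ∈ Submonoid.closure {a, b} := by
  have ha : a ∈ Submonoid.closure {a, b} := Submonoid.subset_closure (by simp)
  have hb : b ∈ Submonoid.closure {a, b} := Submonoid.subset_closure (by simp)
  have hK : Submonoid.closure {b, b * a} ≤ Submonoid.closure {a, b} := by
    rw [Submonoid.closure_le]
    rintro x (rfl | rfl)
    · exact hb
    · exact mul_mem hb ha
  have hred : IsBraidReduced a b 0 (a ^ 3 * g) := by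
    rw [(hc g).eq]
    rcases mem_closure_semigroup_or_eq_one hg with hg | hg
    · exact (isBraidReduced_of_mem_closure h hc hg).mono zero_le_one
    · exact .inl ⟨0, le_rfl, by simpa using hg⟩
  rcases hred with ⟨n, -, e⟩ | ⟨n, m, hm, j, hj, e⟩
  · rcases le_total 3 n with hn | hn
    · obtain ⟨k, rfl⟩ := Nat.exists_eq_add_of_le hn
      rw [pow_add] at e
      exact .inl (mul_left_cancel e ▸ pow_mem ha k)
    · obtain ⟨k, hk⟩ := Nat.exists_eq_add_of_le hn
      refine .inr ?_
      have : g⁻¹ = a ^ k := by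
        rw [hk, pow_add, mul_assoc, mul_eq_left] at e
        exact inv_eq_of_mul_eq_one_left e
      exact this ▸ pow_mem ha k
  · rcases le_or_gt 3 n with hn | hn
    · obtain ⟨k, rfl⟩ := Nat.exists_eq_add_of_le hn
      rw [pow_add, mul_assoc, mul_assoc, mul_assoc] at e
      rw [mul_left_cancel e]
      exact .inl (mul_mem (pow_mem ha k) (mul_mem (hK hm) (mul_mem hb (pow_mem ha j))))
    · obtain ⟨k, hk⟩ := Nat.exists_eq_add_of_lt hn
      obtain ⟨i, hi⟩ := Nat.exists_eq_add_of_le hj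
      obtain ⟨z, hz, ez⟩ : ∃ z ∈ Submonoid.closure {a, b}, (m * b)⁻¹ * a = a ^ 2 * z := by
        obtain ⟨x, hx, ex⟩ := exists_inv_mul_eq_mul_of_mem_closure h hm
        refine ⟨b * x, mul_mem hb hx, ?_⟩
        have hba : b⁻¹ * a = a ^ 2 * b := by
          rw [inv_mul_eq_iff_eq_mul, pow_two]
          simpa only [mul_assoc] using h.symm
        rw [mul_inv_rev, mul_assoc, ex, ← mul_assoc, hba, mul_assoc]
      have hg' : g⁻¹ = a ^ i * z * a ^ k := by
        have h₁ : g = (a ^ 3)⁻¹ * (a ^ n * m * b * a ^ j) := by rw [← e]; group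
        calc g⁻¹ = (a ^ j)⁻¹ * (m * b)⁻¹ * (a ^ n)⁻¹ * a ^ 3 := by rw [h₁]; group
          _ = (a ^ j)⁻¹ * ((m * b)⁻¹ * a) * a ^ k := by rw [hk]; group
          _ = (a ^ j)⁻¹ * (a ^ 2 * z) * a ^ k := by rw [ez]
          _ = a ^ i * z * a ^ k := by rw [hi]; group
      rw [hg']
      exact .inr (mul_mem (mul_mem (pow_mem ha i) hz) (pow_mem ha k))

theorem exists_mul_pow_mem_closure (h : b * a * a * b = a) (hc : ∀ g : G, Commute (a ^ 3) g)
    {g : G} (hg : g ∈ Subgroup.closure {a, b}) :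
    ∃ n : ℕ, g * (a ^ 3) ^ n ∈ Submonoid.closure {a, b} := by
  have ha : a ∈ Submonoid.closure {a, b} := Submonoid.subset_closure (by simp)
  have hb : b ∈ Submonoid.closure {a, b} := Submonoid.subset_closure (by simp)
  induction hg using Subgroup.closure_induction_right with
  | one => exact ⟨0, by simp⟩
  | mul_right x _ y hy ih =>
    obtain ⟨n, hn⟩ := ih
    refine ⟨n, ?_⟩
    rw [mul_assoc, ← ((hc y).pow_left n).eq, ← mul_assoc]
    exact mul_mem hn (Submonoid.subset_closure hy)
  | mul_inv_cancel x _ y hy ih =>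
    obtain ⟨n, hn⟩ := ih
    refine ⟨n + 1, ?_⟩
    have e : x * y⁻¹ * (a ^ 3) ^ (n + 1) = x * (a ^ 3) ^ n * (y⁻¹ * a ^ 3) := by
      rw [pow_succ, mul_assoc, ← mul_assoc y⁻¹, ← ((hc y⁻¹).pow_left n).eq]
      group
    rw [e]
    refine mul_mem hn ?_
    rcases hy with rfl | rfl
    · have : y⁻¹ * y ^ 3 = y ^ 2 := by group
      exact this ▸ pow_mem ha 2
    · have : y⁻¹ * a ^ 3 = a * a * y * a * a := by
        rw [inv_mul_eq_iff_eq_mul]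
        calc a ^ 3 = a * a * a := pow_three' a
          _ = y * a * a * y * a * a := by rw [h]
          _ = y * (a * a * y * a * a) := by group
      rw [this]
      exact mul_mem (mul_mem (mul_mem (mul_mem ha ha) hb) ha) ha

theorem mem_or_inv_mem_closure (h : b * a * a * b = a) (hc : ∀ g : G, Commute (a ^ 3) g)
    {g : G} (hg : g ∈ Subgroup.closure {a, b}) :
    g ∈ Submonoid.closure {a, b} ∨ g⁻¹ ∈ Submonoid.closure {a, b} := by
  have ha : a ∈ Submonoid.closure {a, b} := Submonoid.subset_closure (by simp)
  obtain ⟨n, hn⟩ := exists_mul_pow_mem_closure h hc hg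
  clear hg
  suffices H : ∀ n : ℕ, ∀ g : G,
      (g * (a ^ 3) ^ n ∈ Submonoid.closure {a, b} ∨
        (g * (a ^ 3) ^ n)⁻¹ ∈ Submonoid.closure {a, b}) →
      g ∈ Submonoid.closure {a, b} ∨ g⁻¹ ∈ Submonoid.closure {a, b} from H n g (.inl hn)
  intro n
  induction n with
  | zero => simp
  | succ n ih =>
    intro g hg
    rw [pow_succ, ← mul_assoc] at hg
    refine ih g ?_
    rcases hg with hg | hg
    · exact mem_or_inv_mem_of_mul_pow_three_mem h hc hg
    · refine .inr ?_
      have := mul_mem (pow_mem ha 3) hg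
      rwa [mul_inv_rev, mul_inv_cancel_left] at this

end TwoGenerators

section MatrixRepresentation

open Matrix

theorem Matrix.SpecialLinearGroup.mul_apply_fin_two {R : Type*} [CommRing R]
    (x y : SpecialLinearGroup (Fin 2) R) (i j : Fin 2) :
    (x * y) i j = x i 0 * y 0 j + x i 1 * y 1 j :=
  (mul_apply (M := (x : Matrix (Fin 2) (Fin 2) R))).trans (Fin.sum_univ_two _)

theorem Matrix.SpecialLinearGroup.inv_apply_fin_two {R : Type*} [CommRing R]
    (x : SpecialLinearGroup (Fin 2) R) :
    x⁻¹ 0 1 = -x 0 1 ∧ x⁻¹ 1 0 = -x 1 0 := by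
  have h := adjugate_fin_two (x : Matrix (Fin 2) (Fin 2) R)
  exact ⟨congrFun₂ h 0 1, congrFun₂ h 1 0⟩

/-- The image of `a` under the representation of `B₃` on `SL(2, ℤ)`. -/
def braidMatA : SpecialLinearGroup (Fin 2) ℤ := ⟨!![0, -1; 1, 1], by simp [det_fin_two]⟩

/-- The image of `b` under the representation of `B₃` on `SL(2, ℤ)`. -/
def braidMatB : SpecialLinearGroup (Fin 2) ℤ := ⟨!![1, 1; 0, 1], by simp [det_fin_two]⟩

theorem braidMatA_apply : braidMatA 0 0 = 0 ∧ braidMatA 0 1 = -1 ∧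
    braidMatA 1 0 = 1 ∧ braidMatA 1 1 = 1 :=
  ⟨rfl, rfl, rfl, rfl⟩

theorem braidMatB_apply : braidMatB 0 0 = 1 ∧ braidMatB 0 1 = 1 ∧
    braidMatB 1 0 = 0 ∧ braidMatB 1 1 = 1 :=
  ⟨rfl, rfl, rfl, rfl⟩

theorem braidMat_rel : braidMatB * braidMatA * braidMatA * braidMatB = braidMatA := by
  decide

theorem braidMatA_pow_entries (n : ℕ) :
    (braidMatA ^ n) 0 1 = -(braidMatA ^ n) 1 0 ∧
      (braidMatA ^ n) 1 1 = (braidMatA ^ n) 0 0 + (braidMatA ^ n) 1 0 := by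
  induction n with
  | zero => exact ⟨rfl, rfl⟩
  | succ n ih =>
    simp only [pow_succ, SpecialLinearGroup.mul_apply_fin_two, braidMatA_apply]
    lia

theorem entries_of_mem_closure_braidMat {m : SpecialLinearGroup (Fin 2) ℤ}
    (hm : m ∈ Submonoid.closure {braidMatB, braidMatB * braidMatA}) :
    1 ≤ m 0 0 ∧ 0 ≤ m 0 1 ∧ 0 ≤ m 1 0 ∧ 1 ≤ m 1 1 := by
  induction hm using Submonoid.closure_induction_right with
  | one => simp
  | mul_right x _ y hy ih =>
    rcases hy with rfl | rfl <;>
    · simp only [SpecialLinearGroup.mul_apply_fin_two, braidMatA_apply, braidMatB_apply]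
      lia

theorem mul_braidMatB_mul_pow_ne_one {m : SpecialLinearGroup (Fin 2) ℤ}
    (hm : m ∈ Submonoid.closure {braidMatB, braidMatB * braidMatA}) (n : ℕ) :
    m * braidMatB * braidMatA ^ n ≠ 1 := by
  intro h
  have hA := (braidMatA_pow_entries n).1
  have hm := entries_of_mem_closure_braidMat hm
  have h_inv := SpecialLinearGroup.inv_apply_fin_two (m * braidMatB)
  rw [eq_inv_of_mul_eq_one_right h, h_inv.1, h_inv.2] at hA
  simp only [SpecialLinearGroup.mul_apply_fin_two, braidMatB_apply] at hA
  lia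

end MatrixRepresentation

namespace BraidB3

theorem rel : (PresentedGroup.of false * PresentedGroup.of true * PresentedGroup.of true *
    PresentedGroup.of false : BraidB3) = PresentedGroup.of true :=
  PresentedGroup.mk_eq_mk_of_mul_inv_mem (Set.mem_singleton _)

theorem exists_hom {H : Type*} [Group H] {x y : H} (h : y * x * x * y = x) :
    ∃ f : BraidB3 →* H, f (PresentedGroup.of true) = x ∧ f (PresentedGroup.of false) = y := by
  have hf : ∀ r ∈ braidRels, FreeGroup.lift (fun i : Bool => if i then x else y) r = 1 := by
    rintro r rfl
    simp [h]
  exact ⟨PresentedGroup.toGroup hf, by simp, by simp⟩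

theorem closure_eq_top : Subgroup.closure
    {(PresentedGroup.of true : BraidB3), PresentedGroup.of false} = ⊤ := by
  rw [← PresentedGroup.closure_range_of braidRels, ← Set.image_univ, Bool.univ_eq,
    Set.image_pair, Set.pair_comm]

theorem not_isBraidReduced_one :
    ¬ IsBraidReduced (PresentedGroup.of true) (PresentedGroup.of false) 1 (1 : BraidB3) := by
  rintro (⟨n, hn, e⟩ | ⟨n, m, hm, j, -, e⟩)
  · obtain ⟨f, hx, -⟩ := exists_hom (H := Multiplicative ℤ)
      (x := Multiplicative.ofAdd 2) (y := Multiplicative.ofAdd (-1)) (by decide)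
    have := congrArg (fun g => (f g).toAdd) e
    simp [hx] at this
    lia
  · obtain ⟨f, hx, hy⟩ := exists_hom braidMat_rel
    have hm' : f m ∈ Submonoid.closure {braidMatB, braidMatB * braidMatA} := by
      have := Submonoid.mem_map_of_mem f hm
      rwa [MonoidHom.map_mclosure, Set.image_pair, map_mul, hx, hy] at this
    apply mul_braidMatB_mul_pow_ne_one hm' (j + n)
    have := congrArg f e
    rw [map_one, map_mul, map_mul, map_mul, map_pow, map_pow, hx, hy, mul_assoc, mul_assoc] at this
    rw [pow_add, ← mul_assoc]
    exact mul_eq_one_comm.mp (by simpa only [mul_assoc] using this.symm)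

end BraidB3

/-- Dubrovina–Dubrovin for `B₃`. In `B₃ = ⟨a, b : b a² b = a⟩`, letting
`P` be the subsemigroup generated by `{a, b}` and `P'` the subsemigroup generated by
`{a⁻¹, b⁻¹}`, the group is the disjoint union of `P`, `P'` and `{1}`. In particular `P`
is the positive cone of a left-invariant total order on `B₃`. -/
theorem braid3_dubrovina_dubrovin_decomposition
    (a b : BraidB3) (ha : a = PresentedGroup.of true) (hb : b = PresentedGroup.of false)
    (P P' : Subsemigroup BraidB3)
    (hP : P = Subsemigroup.closure {a, b})
    (hP' : P' = Subsemigroup.closure {a⁻¹, b⁻¹}) :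
    (∀ g : BraidB3, g ∈ P ∨ g ∈ P' ∨ g = 1) ∧
    (∀ g : BraidB3, ¬(g ∈ P ∧ g ∈ P')) ∧
    (1 : BraidB3) ∉ P ∧ (1 : BraidB3) ∉ P' := by
  subst ha hb hP hP'
  have hc (g : BraidB3) : Commute (PresentedGroup.of true ^ 3) g :=
    commute_pow_three_of_rel BraidB3.rel g (BraidB3.closure_eq_top ▸ Subgroup.mem_top g)
  have h_one : (1 : BraidB3) ∉ Subsemigroup.closure
      {PresentedGroup.of true, PresentedGroup.of false} := fun h =>
    BraidB3.not_isBraidReduced_one (isBraidReduced_of_mem_closure BraidB3.rel hc h)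
  have h_inv {g : BraidB3} (hg : g ∈ Subsemigroup.closure
      {(PresentedGroup.of true)⁻¹, (PresentedGroup.of false)⁻¹}) :
      g⁻¹ ∈ Subsemigroup.closure {PresentedGroup.of true, PresentedGroup.of false} := by
    simpa using inv_mem_closure_pair_inv hg
  refine ⟨fun g => ?_, fun g ⟨hg, hg'⟩ => h_one ?_, h_one, fun h => h_one (by simpa using h_inv h)⟩
  · rcases mem_or_inv_mem_closure BraidB3.rel hc
      (BraidB3.closure_eq_top ▸ Subgroup.mem_top g) with hg | hg
    · rcases mem_closure_semigroup_or_eq_one hg with hg | hg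
      · exact .inl hg
      · exact .inr (.inr hg)
    · rcases mem_closure_semigroup_or_eq_one hg with hg | hg
      · exact .inr (.inl (by simpa using inv_mem_closure_pair_inv hg))
      · exact .inr (.inr (inv_eq_one.mp hg))
  · simpa using mul_mem hg (h_inv hg')
end

section
/- (Witte-Morris.) Let n ≥ 3 and let H be a finite-index subgroup of SL(n, ℤ). Then every group homomorphism from H to the group of order-preserving bijections of ℝ (equivalently, to the group of orientation-preserving homeomorphisms of the closed interval) is trivial: every element of H acts as the identity. -/
namespace OrderIso

variable {α : Type*} [LinearOrder α]

theorem strictMono_zpow_apply {c : α ≃o α} {x : α} (hc : x < c x) :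
    StrictMono fun p : ℤ => (c ^ p) x := by
  refine strictMono_int_of_lt_succ fun p => ?_
  simp only [zpow_add_one, RelIso.mul_apply]
  exact (c ^ p).strictMono hc

theorem le_pow_apply {a : α ≃o α} {x : α} (ha : x ≤ a x) (m : ℕ) : x ≤ (a ^ m) x := by
  induction m with
  | zero => simp
  | succ m ih =>
    rw [pow_succ, RelIso.mul_apply]
    exact ih.trans ((a ^ m).monotone ha)

theorem pow_apply_le_zpow_apply {a c : α ≃o α} (hca : Commute c a) {x : α} {p : ℤ}
    (ha : a x ≤ (c ^ p) x) (m : ℕ) : (a ^ m) x ≤ (c ^ (p * m)) x := by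
  induction m with
  | zero => simp
  | succ m ih =>
    have h1 : (a ^ (m + 1)) x ≤ (a * c ^ (p * m)) x := by
      rw [pow_succ', RelIso.mul_apply, RelIso.mul_apply]
      exact a.monotone ih
    rw [← (hca.zpow_left _).eq, RelIso.mul_apply] at h1
    refine (h1.trans ((c ^ (p * m)).monotone ha)).trans_eq ?_
    rw [← RelIso.mul_apply, ← zpow_add]
    push_cast
    ring_nf

/-- `Dominates x a c` says that the orbit of `x` under the powers of `c` is bounded above by some
point of the orbit of `x` under the powers of `a`. -/
def Dominates (x : α) (a c : α ≃o α) : Prop := ∃ q : ℤ, ∀ p : ℤ, (c ^ p) x < (a ^ q) x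

theorem Dominates.trans {x : α} {a b c : α ≃o α} (hab : Dominates x a b) (hbc : Dominates x b c) :
    Dominates x a c := by
  obtain ⟨q, hq⟩ := hab
  obtain ⟨r, hr⟩ := hbc
  exact ⟨q, fun p => (hr p).trans (hq r)⟩

theorem not_dominates_self (x : α) (a : α ≃o α) : ¬ Dominates x a a :=
  fun ⟨q, hq⟩ => (hq q).false

theorem Dominates.apply_ne {x : α} {a c : α ≃o α} (h : Dominates x a c) : a x ≠ x := by
  obtain ⟨q, hq⟩ := h
  intro hx
  have : (a ^ q) x = x :=
    MulAction.mem_stabilizer_iff.1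
      (zpow_mem (MulAction.mem_stabilizer_iff.2 hx : a ∈ MulAction.stabilizer (α ≃o α) x) q)
  exact ((hq 0).trans_eq this).ne (by simp)

theorem Dominates.inv_left {x : α} {a c : α ≃o α} (h : Dominates x a⁻¹ c) : Dominates x a c := by
  obtain ⟨q, hq⟩ := h
  exact ⟨-q, fun p => by simpa using hq p⟩

theorem Dominates.inv_right {x : α} {a c : α ≃o α} (h : Dominates x a c⁻¹) : Dominates x a c := by
  obtain ⟨q, hq⟩ := h
  exact ⟨q, fun p => by simpa using hq (-p)⟩

theorem exists_apply_le_of_not_dominates {x : α} {a c : α ≃o α} (h : ¬ Dominates x a c) :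
    ∃ p : ℤ, a x ≤ (c ^ p) x := by
  simp only [Dominates, not_exists, not_forall, not_lt] at h
  simpa using h 1

theorem pow_mul_pow_of_central {G : Type*} [Group G] {a b c : G} (hca : Commute c a)
    (hcb : Commute c b) {k : ℤ} (h : a * b = b * a * c ^ k) (m : ℕ) :
    a ^ m * b ^ m = b ^ m * a ^ m * c ^ (k * m * m) := by
  have h1 : SemiconjBy b (a * c ^ k) a := by
    rw [SemiconjBy, ← mul_assoc, h]
  have h2 := h1.pow_right m
  rw [((hca.zpow_left k).symm).mul_pow, SemiconjBy] at h2
  have h3 : SemiconjBy (a ^ m) b (b * c ^ (k * m)) := by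
    rw [SemiconjBy, ← h2, mul_assoc, (hca.zpow_left (k * m)).pow_right m |>.eq,
      zpow_mul, zpow_natCast]
  have h4 := h3.pow_right m
  rw [((hcb.zpow_left _).symm).mul_pow, SemiconjBy] at h4
  rw [h4, mul_assoc, mul_assoc, (hca.zpow_left (k * m)).pow_left m |>.pow_right m |>.eq,
    zpow_mul _ (k * m), zpow_natCast]

theorem not_heisenberg_of_apply_le {a b c : α ≃o α} (hca : Commute c a) (hcb : Commute c b)
    {k : ℤ} (hk : 0 < k) (h : a * b = b * a * c ^ k) {x : α} (hcx : x < c x) (hax : x ≤ a x)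
    (hbx : x ≤ b x) {p : ℤ} (hap : a x ≤ (c ^ p) x) (hbp : b x ≤ (c ^ p) x) : False := by
  have hc := strictMono_zpow_apply hcx
  have hp : 0 ≤ p := by
    by_contra! hp
    exact ((hax.trans hap).trans_lt (hc hp)).ne (by simp)
  obtain ⟨m, hm⟩ : ∃ m : ℕ, (m : ℤ) = 2 * p + 1 := ⟨(2 * p + 1).toNat, by omega⟩
  have upper : (a ^ m * b ^ m) x ≤ (c ^ (p * m + p * m)) x := by
    rw [RelIso.mul_apply]
    refine ((a ^ m).monotone (pow_apply_le_zpow_apply hcb hbp m)).trans ?_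
    rw [← RelIso.mul_apply, ← ((hca.zpow_left (p * m)).pow_right m).eq, RelIso.mul_apply, zpow_add,
      RelIso.mul_apply]
    exact (c ^ (p * m)).monotone (pow_apply_le_zpow_apply hca hap m)
  have lower : (c ^ (k * m * m)) x ≤ (a ^ m * b ^ m) x := by
    rw [pow_mul_pow_of_central hca hcb h,
      ← (((hcb.zpow_left (k * m * m)).pow_right m).mul_right
        ((hca.zpow_left (k * m * m)).pow_right m)).eq, RelIso.mul_apply, RelIso.mul_apply]
    exact (c ^ (k * m * m)).monotone
      ((le_pow_apply hbx m).trans ((b ^ m).monotone (le_pow_apply hax m)))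
  have := hc.le_iff_le.1 (lower.trans upper)
  nlinarith [mul_nonneg (show 0 ≤ k - 1 by omega) (mul_self_nonneg (m : ℤ)),
    congrArg (· * (m : ℤ)) hm]

theorem inv_mul_of_central {G : Type*} [Group G] {a b c : G} (hca : Commute c a)
    {k : ℤ} (h : a * b = b * a * c ^ k) : a⁻¹ * b = b * a⁻¹ * c ^ (-k) := by
  have h1 : a * b * c ^ (-k) = b * a := by rw [h]; simp
  have h2 : b * c ^ (-k) = a⁻¹ * b * a := by
    rw [mul_assoc a⁻¹, ← h1]; group
  rw [mul_assoc, ← ((hca.inv_right).zpow_left (-k)).eq, ← mul_assoc, h2]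
  group

/-- In an order-preserving action of a Heisenberg group, a central element that moves `x` is
dominated at `x` by one of the two generators. -/
theorem dominates_or_dominates_of_heisenberg {a b c : α ≃o α} (hca : Commute c a)
    (hcb : Commute c b) {k : ℤ} (hk : k ≠ 0) (h : a * b = b * a * c ^ k) {x : α} (hcx : c x ≠ x) :
    Dominates x a c ∨ Dominates x b c := by
  wlog hc : x < c x generalizing c k
  · have hc' : x < c⁻¹ x := by
      have := c⁻¹.strictMono (lt_of_le_of_ne (not_lt.1 hc) hcx)
      simpa [← RelIso.mul_apply] using this
    exact (this hca.inv_left hcb.inv_left (neg_ne_zero.2 hk) (by simpa using h) hc'.ne' hc').imp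
      Dominates.inv_right Dominates.inv_right
  wlog ha : x ≤ a x generalizing a k
  · have ha' : x ≤ a⁻¹ x := by
      have := a⁻¹.strictMono (not_le.1 ha)
      exact (by simpa [← RelIso.mul_apply] using this : x < a⁻¹ x).le
    exact (this hca.inv_right (neg_ne_zero.2 hk) (inv_mul_of_central hca h) ha').imp_left
      Dominates.inv_left
  wlog hb : x ≤ b x generalizing b k
  · have hb' : x ≤ b⁻¹ x := by
      have := b⁻¹.strictMono (not_le.1 hb)
      exact (by simpa [← RelIso.mul_apply] using this : x < b⁻¹ x).le
    refine (this hcb.inv_right (k := -k) (neg_ne_zero.2 hk) ?_ hb').imp_right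
      Dominates.inv_left
    have := inv_mul_of_central hcb (k := -k) (a := b) (b := a) (by rw [h]; simp)
    rw [this]; simp
  wlog hk0 : 0 < k generalizing a b k
  · exact (this hcb hb hca (k := -k) (neg_ne_zero.2 hk) (by rw [h]; simp) ha (by omega)).symm
  by_contra! hn
  obtain ⟨p, hp⟩ := exists_apply_le_of_not_dominates hn.1
  obtain ⟨q, hq⟩ := exists_apply_le_of_not_dominates hn.2
  have hmono := (strictMono_zpow_apply hc).monotone
  exact not_heisenberg_of_apply_le hca hcb hk0 h hc ha hb
    (hp.trans (hmono (le_max_left p q))) (hq.trans (hmono (le_max_right p q)))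

/-- Order automorphisms indexed by the roots of type `A` that satisfy the commutation relations of
elementary matrices are trivial, provided the rank is at least two. -/
theorem eq_one_of_elementary_relations {ι : Type*} [Finite ι]
    (hι : ∀ i j : ι, ∃ l, l ≠ i ∧ l ≠ j) (a : ι → ι → (α ≃o α)) {k : ℤ} (hk : k ≠ 0)
    (hrow : ∀ i j l, i ≠ j → i ≠ l → Commute (a i j) (a i l))
    (hcol : ∀ i j l, i ≠ j → l ≠ j → Commute (a i j) (a l j))
    (hrel : ∀ i j l, i ≠ j → l ≠ i → l ≠ j → a i l * a l j = a l j * a i l * a i j ^ k)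
    {i j : ι} (hij : i ≠ j) : a i j = 1 := by
  ext x
  let r : {p : ι × ι // p.1 ≠ p.2} → {p : ι × ι // p.1 ≠ p.2} → Prop :=
    fun p q => Dominates x (a p.1.1 p.1.2) (a q.1.1 q.1.2)
  have : IsTrans _ r := ⟨fun _ _ _ h₁ h₂ => h₁.trans h₂⟩
  have : Std.Irrefl r := ⟨fun _ => not_dominates_self _ _⟩
  have wf : WellFounded r := Finite.wellFounded_of_trans_of_irrefl r
  suffices ∀ p : {p : ι × ι // p.1 ≠ p.2}, a p.1.1 p.1.2 x = x from this ⟨(i, j), hij⟩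
  intro p
  induction p using wf.induction with
  | _ p ih =>
  by_contra hp
  obtain ⟨⟨i, j⟩, hij⟩ := p
  obtain ⟨l, hli, hlj⟩ := hι i j
  rcases dominates_or_dominates_of_heisenberg (hrow i j l hij hli.symm) (hcol i j l hij hlj) hk
    (hrel i j l hij hli hlj) hp with h | h
  · exact h.apply_ne (ih ⟨(i, l), hli.symm⟩ h)
  · exact h.apply_ne (ih ⟨(l, j), hlj⟩ h)

/-- The group of order automorphisms of a linear order is torsion-free. -/
theorem eq_one_of_pow_eq_one {a : α ≃o α} {m : ℕ} (hm : m ≠ 0) (h : a ^ m = 1) : a = 1 := by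
  have key : ∀ (b : α ≃o α) (x : α), b ^ m = 1 → ¬ x < b x := by
    intro b x hb hx
    have := strictMono_zpow_apply hx (show (0 : ℤ) < m by omega)
    simp [hb] at this
  ext x
  refine le_antisymm (not_lt.1 (key a x h)) (not_lt.1 fun hx => key a⁻¹ x (by simp [h]) ?_)
  simpa [← RelIso.mul_apply] using a⁻¹.strictMono hx

end OrderIso

namespace Matrix.SpecialLinearGroup

open scoped commutatorElement

variable {ι R : Type*} [DecidableEq ι] [Fintype ι] [CommRing R]

/-- The matrix `1 + v wᵀ`, for orthogonal vectors `v` and `w`, as an element of `SL`. -/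
def oneAddVecMulVec (v w : ι → R) (h : w ⬝ᵥ v = 0) : SpecialLinearGroup ι R :=
  ⟨1 + vecMulVec v w, by
    rw [vecMulVec_eq Unit, det_one_add_replicateCol_mul_replicateRow, h, add_zero]⟩

theorem coe_oneAddVecMulVec (v w : ι → R) (h : w ⬝ᵥ v = 0) :
    (oneAddVecMulVec v w h : Matrix ι ι R) = 1 + vecMulVec v w := rfl

theorem oneAddVecMulVec_add_right {v w w' : ι → R} (h : w ⬝ᵥ v = 0) (h' : w' ⬝ᵥ v = 0) :
    oneAddVecMulVec v (w + w') (by rw [add_dotProduct, h, h', add_zero]) =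
      oneAddVecMulVec v w h * oneAddVecMulVec v w' h' := by
  apply Subtype.ext
  simp [coe_oneAddVecMulVec, mul_add, add_mul, vecMulVec_mul_vecMulVec, h, vecMulVec_add,
    add_assoc]

theorem oneAddVecMulVec_add_left {v v' w : ι → R} (h : w ⬝ᵥ v = 0) (h' : w ⬝ᵥ v' = 0) :
    oneAddVecMulVec (v + v') w (by rw [dotProduct_add, h, h', add_zero]) =
      oneAddVecMulVec v w h * oneAddVecMulVec v' w h' := by
  apply Subtype.ext
  simp only [coe_mul, coe_oneAddVecMulVec, mul_add, add_mul, vecMulVec_mul_vecMulVec, h',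
    add_vecMulVec, mul_one, one_mul, zero_smul, vecMulVec_zero, add_zero]
  abel

theorem oneAddVecMulVec_single_single {i j : ι} (hij : i ≠ j) (a b : R)
    (h : Pi.single j b ⬝ᵥ Pi.single i a = 0) :
    oneAddVecMulVec (Pi.single i a) (Pi.single j b) h = transvection hij (a * b) := by
  apply Subtype.ext
  rw [coe_oneAddVecMulVec, transvection_coe, add_right_inj]
  ext x y
  simp only [vecMulVec_apply, single_apply, Pi.single_apply]
  grind

theorem oneAddVecMulVec_smul_left (c : R) (v w : ι → R) (h : w ⬝ᵥ c • v = 0)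
    (h' : c • w ⬝ᵥ v = 0) : oneAddVecMulVec (c • v) w h = oneAddVecMulVec v (c • w) h' := by
  apply Subtype.ext
  simp [coe_oneAddVecMulVec, smul_vecMulVec, vecMulVec_smul]

theorem conj_oneAddVecMulVec (g : SpecialLinearGroup ι R) (v w : ι → R) (h : w ⬝ᵥ v = 0) :
    g * oneAddVecMulVec v w h * g⁻¹ =
      oneAddVecMulVec (g.1 *ᵥ v) (w ᵥ* (g⁻¹).1) (by
        rw [← dotProduct_mulVec, mulVec_mulVec, ← coe_mul, inv_mul_cancel, coe_one, one_mulVec,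
          h]) := by
  apply Subtype.ext
  have : g.1 * (g⁻¹).1 = 1 := by rw [← coe_mul, mul_inv_cancel, coe_one]
  rw [coe_mul, coe_mul, coe_oneAddVecMulVec, coe_oneAddVecMulVec, mul_add, add_mul, mul_one,
    this, mul_vecMulVec, vecMulVec_mul]

theorem oneAddVecMulVec_mul_oneAddVecMulVec {v w : ι → R} {l : ι} (hv : v l = 0) (hw : w l = 0)
    (h : w ⬝ᵥ v = 0) :
    oneAddVecMulVec v (Pi.single l 1) (by simp [hv]) *
        oneAddVecMulVec (Pi.single l 1) w (by simp [hw]) =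
      oneAddVecMulVec v w h * oneAddVecMulVec (Pi.single l 1) w (by simp [hw]) *
        oneAddVecMulVec v (Pi.single l 1) (by simp [hv]) := by
  apply Subtype.ext
  simp only [coe_mul, coe_oneAddVecMulVec, mul_add, add_mul, vecMulVec_mul_vecMulVec, h, hw,
    mul_one, one_mul, dotProduct_single, zero_smul, vecMulVec_zero, add_zero, Pi.single_eq_same,
    one_smul]
  abel

theorem oneAddVecMulVec_single_left_mem {N : Subgroup (SpecialLinearGroup ι R)} {l : ι}
    {w : ι → R} (hw : w l = 0) (hN : ∀ a (h : l ≠ a), transvection h (w a) ∈ N) :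
    oneAddVecMulVec (Pi.single l 1) w (by simp [hw]) ∈ N := by
  suffices ∃ h : (∑ a, Pi.single a (w a)) ⬝ᵥ Pi.single l 1 = 0,
      oneAddVecMulVec (Pi.single l 1) (∑ a, Pi.single a (w a)) h ∈ N by
    simpa only [Finset.univ_sum_single, exists_prop_of_true, hw, dotProduct_single, mul_one]
      using this
  refine Finset.sum_induction _
    (fun w => ∃ h : w ⬝ᵥ Pi.single l 1 = 0, oneAddVecMulVec (Pi.single l 1) w h ∈ N) ?_ ?_ ?_
  · rintro w w' ⟨h, hm⟩ ⟨h', hm'⟩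
    exact ⟨_, oneAddVecMulVec_add_right h h' ▸ mul_mem hm hm'⟩
  · refine ⟨by simp, ?_⟩
    convert! one_mem N
    apply Subtype.ext
    simp [coe_oneAddVecMulVec]
  · intro a _
    rcases eq_or_ne l a with rfl | hla
    · refine ⟨by simp [hw], ?_⟩
      convert! one_mem N
      apply Subtype.ext
      simp [coe_oneAddVecMulVec, hw]
    · refine ⟨by simp [hla], ?_⟩
      rw [oneAddVecMulVec_single_single hla, one_mul]
      exact hN a hla

theorem oneAddVecMulVec_single_right_mem {N : Subgroup (SpecialLinearGroup ι R)} {l : ι}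
    {v : ι → R} (hv : v l = 0) (hN : ∀ a (h : a ≠ l), transvection h (v a) ∈ N) :
    oneAddVecMulVec v (Pi.single l 1) (by simp [hv]) ∈ N := by
  suffices ∃ h : Pi.single l 1 ⬝ᵥ (∑ a, Pi.single a (v a)) = 0,
      oneAddVecMulVec (∑ a, Pi.single a (v a)) (Pi.single l 1) h ∈ N by
    simpa only [Finset.univ_sum_single, exists_prop_of_true, hv, single_dotProduct, one_mul]
      using this
  refine Finset.sum_induction _
    (fun v => ∃ h : Pi.single l 1 ⬝ᵥ v = 0, oneAddVecMulVec v (Pi.single l 1) h ∈ N) ?_ ?_ ?_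
  · rintro v v' ⟨h, hm⟩ ⟨h', hm'⟩
    exact ⟨_, oneAddVecMulVec_add_left h h' ▸ mul_mem hm hm'⟩
  · refine ⟨by simp, ?_⟩
    convert! one_mem N
    apply Subtype.ext
    simp [coe_oneAddVecMulVec]
  · intro a _
    rcases eq_or_ne a l with rfl | hal
    · refine ⟨by simp [hv], ?_⟩
      convert! one_mem N
      apply Subtype.ext
      simp [coe_oneAddVecMulVec, hv]
    · refine ⟨by simp [hal.symm], ?_⟩
      rw [oneAddVecMulVec_single_single hal, mul_one]
      exact hN a hal

/-- A decomposition of a vector orthogonal to the unimodular vector `v` as a sum of vectors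
orthogonal to `v` with at most two nonzero entries. -/
theorem _root_.Matrix.eq_sum_of_dotProduct_eq_zero {u v w : ι → R} (hu : u ⬝ᵥ v = 1)
    (hw : w ⬝ᵥ v = 0) :
    w = ∑ p : ι × ι, (w p.1 * u p.2) • (v p.2 • Pi.single p.1 1 - v p.1 • Pi.single p.2 1) := by
  ext x
  simp only [Fintype.sum_prod_type, Finset.sum_apply, Pi.smul_apply, Pi.sub_apply, smul_eq_mul,
    mul_sub, Finset.sum_sub_distrib, Pi.single_apply, mul_ite, mul_one, mul_zero]
  rw [Finset.sum_comm]
  simp only [Finset.sum_ite_eq, Finset.mem_univ, if_true]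
  simp only [dotProduct] at hu hw
  have h1 : ∑ y, w x * u y * v y = w x * ∑ y, u y * v y := by
    rw [Finset.mul_sum]; simp only [mul_assoc]
  have h2 : ∑ y, w y * u x * v y = u x * ∑ y, w y * v y := by
    rw [Finset.mul_sum]; exact Finset.sum_congr rfl fun _ _ => by ring
  rw [h1, h2, hu, hw]
  ring

section Congruence

variable {S : Type*} [CommRing S] {f : R →+* S} {N : Subgroup (SpecialLinearGroup ι R)}

theorem mk_oneAddVecMulVec_eq_of_apply_eq_zero
    {v w : ι → R} (h : w ⬝ᵥ v = 0) {l : ι} (hw : w l = 0)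
    (hN : ∀ a (h : l ≠ a), transvection h (v l * w a) ∈ N) :
    (oneAddVecMulVec v w h : SpecialLinearGroup ι R ⧸ N) =
      oneAddVecMulVec (v - Pi.single l (v l)) w
        (by rw [dotProduct_sub, h, dotProduct_single, hw, zero_mul, sub_zero]) := by
  have hv : w ⬝ᵥ Pi.single l (v l) = 0 := by simp [hw]
  have h1 : oneAddVecMulVec (Pi.single l (v l)) w hv =
      oneAddVecMulVec (Pi.single l 1) (v l • w) (by simp [hw]) := by
    rw [← oneAddVecMulVec_smul_left _ _ _ (by simp [hw])]
    congr 1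
    simp [← Pi.single_smul]
  have h2 : oneAddVecMulVec v w h = oneAddVecMulVec (v - Pi.single l (v l)) w
        (by rw [dotProduct_sub, h, hv, sub_zero]) * oneAddVecMulVec (Pi.single l (v l)) w hv := by
    rw [← oneAddVecMulVec_add_left]
    simp only [sub_add_cancel]
  rw [h2, QuotientGroup.mk_mul_of_mem]
  rw [h1]
  exact oneAddVecMulVec_single_left_mem (by simp [hw]) hN

variable [N.Normal]

theorem mk_oneAddVecMulVec_eq_commutator {v w : ι → R} (h : w ⬝ᵥ v = 0) {l : ι}
    (hv : v l = 0) (hw : w l = 0) :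
    (oneAddVecMulVec v w h : SpecialLinearGroup ι R ⧸ N) =
      ⁅(oneAddVecMulVec v (Pi.single l 1) (by simp [hv]) : SpecialLinearGroup ι R ⧸ N),
        (oneAddVecMulVec (Pi.single l 1) w (by simp [hw]) : SpecialLinearGroup ι R ⧸ N)⁆ := by
  rw [commutatorElement_def, ← QuotientGroup.mk_mul, oneAddVecMulVec_mul_oneAddVecMulVec hv hw h]
  simp

variable (hN : ∀ (i j : ι) (h : i ≠ j) (a : R), f a = 0 → transvection h a ∈ N)
include hN

theorem oneAddVecMulVec_mem {v w : ι → R} (h : w ⬝ᵥ v = 0) {l : ι} (hw : w l = 0)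
    (hf : ∀ a, f (w a) = 0) : oneAddVecMulVec v w h ∈ N := by
  rw [← QuotientGroup.eq_one_iff, mk_oneAddVecMulVec_eq_of_apply_eq_zero h hw
    fun a hla => hN _ _ hla _ (by rw [map_mul, hf, mul_zero]),
    mk_oneAddVecMulVec_eq_commutator (l := l) _ (by simp) hw,
    (QuotientGroup.eq_one_iff _).2 (oneAddVecMulVec_single_left_mem hw
      fun a hla => hN _ _ hla _ (hf a)), commutatorElement_one_right]

theorem mk_oneAddVecMulVec_eq {v w : ι → R} (h : w ⬝ᵥ v = 0) {i j l : ι}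
    (hij : i ≠ j) (hli : l ≠ i) (hlj : l ≠ j) (hw : w l = 0)
    (hfv : f ∘ v = Pi.single i 1) (hfw : f ∘ w = Pi.single j 1) :
    (oneAddVecMulVec v w h : SpecialLinearGroup ι R ⧸ N) =
      (transvection hij 1 : SpecialLinearGroup ι R) := by
  have hfv' (a : ι) : f (v a) = (Pi.single i 1 : ι → S) a := congrFun hfv a
  have hfw' (a : ι) : f (w a) = (Pi.single j 1 : ι → S) a := congrFun hfw a
  rw [mk_oneAddVecMulVec_eq_of_apply_eq_zero h hw
    fun a hla => hN _ _ hla _ (by rw [map_mul, hfv', Pi.single_eq_of_ne hli, zero_mul])]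
  have hd : (Pi.single j 1 : ι → R) ⬝ᵥ Pi.single i 1 = 0 := by simp [hij.symm]
  rw [← one_mul (1 : R), ← oneAddVecMulVec_single_single hij 1 1 hd,
    mk_oneAddVecMulVec_eq_commutator (l := l) _ (by simp) hw,
    mk_oneAddVecMulVec_eq_commutator (l := l) hd (by simp [hli]) (by simp [hlj])]
  congr 1
  · have h1 : (v - Pi.single l (v l) - Pi.single i 1 : ι → R) l = 0 := by simp [hli]
    have h2 := oneAddVecMulVec_add_left (v := Pi.single i 1)
      (v' := v - Pi.single l (v l) - Pi.single i 1) (w := Pi.single l 1) (by simp [hli])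
      (by simp [hli])
    simp only [add_sub_cancel] at h2
    rw [h2, QuotientGroup.mk_mul_of_mem]
    refine oneAddVecMulVec_single_right_mem h1 fun a hal => hN _ _ hal _ ?_
    simp only [Pi.sub_apply, Pi.single_eq_of_ne hal, sub_zero, map_sub, hfv', Pi.single_apply]
    split_ifs <;> simp
  · have h1 : (w - Pi.single j 1 : ι → R) l = 0 := by simp [hlj, hw]
    have h2 := oneAddVecMulVec_add_right (w := Pi.single j 1)
      (w' := w - Pi.single j 1) (v := Pi.single l 1) (by simp [hlj]) (by simp [hlj, hw])
    simp only [add_sub_cancel] at h2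
    rw [h2, QuotientGroup.mk_mul_of_mem]
    refine oneAddVecMulVec_single_left_mem h1 fun a hla => hN _ _ hla _ ?_
    simp only [Pi.sub_apply, map_sub, hfw', Pi.single_apply]
    split_ifs <;> simp

theorem mk_oneAddVecMulVec_eq_of_dotProduct_eq_one (hι : ∀ i j : ι, ∃ l, l ≠ i ∧ l ≠ j)
    {u v w : ι → R} (hu : u ⬝ᵥ v = 1) (hw : w ⬝ᵥ v = 0) {i j : ι} (hij : i ≠ j)
    (hfu : ∀ a, f (u a) = if a = i then 1 else 0) (hfv : ∀ a, f (v a) = if a = i then 1 else 0)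
    (hfw : ∀ a, f (w a) = if a = j then 1 else 0) :
    (oneAddVecMulVec v w hw : SpecialLinearGroup ι R ⧸ N) =
      (transvection hij 1 : SpecialLinearGroup ι R) := by
  let t (p : ι × ι) : ι → R :=
    (w p.1 * u p.2) • (v p.2 • Pi.single p.1 1 - v p.1 • Pi.single p.2 1)
  have ht (p : ι × ι) : t p ⬝ᵥ v = 0 := by
    simp [t, mul_comm (v p.1)]
  have hsum : w = t (j, i) + ∑ p ∈ Finset.univ.erase (j, i), t p := by
    rw [Finset.add_sum_erase _ _ (Finset.mem_univ _)]
    exact eq_sum_of_dotProduct_eq_zero hu hw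
  obtain ⟨hrd, hr⟩ : ∃ h : (∑ p ∈ Finset.univ.erase (j, i), t p) ⬝ᵥ v = 0,
      oneAddVecMulVec v (∑ p ∈ Finset.univ.erase (j, i), t p) h ∈ N := by
    refine Finset.sum_induction _ (fun w => ∃ h : w ⬝ᵥ v = 0, oneAddVecMulVec v w h ∈ N) ?_ ?_ ?_
    · rintro w w' ⟨h, hm⟩ ⟨h', hm'⟩
      exact ⟨_, oneAddVecMulVec_add_right h h' ▸ mul_mem hm hm'⟩
    · refine ⟨by simp, ?_⟩
      convert! one_mem N
      apply Subtype.ext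
      simp [coe_oneAddVecMulVec]
    · rintro ⟨a, b⟩ hab
      obtain ⟨l, hla, hlb⟩ := hι a b
      refine ⟨ht _, oneAddVecMulVec_mem hN (l := l) _ (by simp [t, hla, hlb]) fun x => ?_⟩
      have : f (w a * u b) = 0 := by
        rw [map_mul, hfw, hfu]
        have : ¬ (a = j ∧ b = i) := by simpa using hab
        by_cases h : a = j <;> simp_all
      change f ((w a * u b) * _) = 0
      rw [map_mul, this, zero_mul]
  obtain ⟨l, hli, hlj⟩ := hι i j
  simp only [hsum]
  rw [oneAddVecMulVec_add_right (ht _) hrd, QuotientGroup.mk_mul_of_mem _ hr]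
  refine mk_oneAddVecMulVec_eq hN _ hij hli hlj (by simp [t, hli, hlj]) ?_ ?_
  · ext a
    simp [hfv, Pi.single_apply]
  · ext a
    simp only [t, Function.comp_apply, Pi.smul_apply, Pi.sub_apply, smul_eq_mul, map_mul, map_sub,
      hfv, hfu, hfw, Pi.single_apply]
    simp [hij.symm, apply_ite f]

/-- Modulo a normal subgroup that contains all the elementary matrices congruent to the identity,
a matrix congruent to the identity commutes with the elementary matrices. -/
theorem commute_mk_transvection (hι : ∀ i j : ι, ∃ l, l ≠ i ∧ l ≠ j)
    {g : SpecialLinearGroup ι R} (hg : map f g = 1) {i j : ι} (hij : i ≠ j) :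
    Commute (g : SpecialLinearGroup ι R ⧸ N) (transvection hij 1 : SpecialLinearGroup ι R) := by
  suffices (g * transvection hij 1 * g⁻¹ : SpecialLinearGroup ι R) =
      ((transvection hij 1 : SpecialLinearGroup ι R) : SpecialLinearGroup ι R ⧸ N) by
    rwa [QuotientGroup.mk_mul, QuotientGroup.mk_mul, QuotientGroup.mk_inv,
      mul_inv_eq_iff_eq_mul] at this
  have hgf (g : SpecialLinearGroup ι R) (hg : map f g = 1) (a b : ι) :
      f (g a b) = if a = b then 1 else 0 := by
    simpa [one_apply] using congrArg (fun h : SpecialLinearGroup ι S => h a b) hg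
  have hg' : map f g⁻¹ = 1 := by rw [map_inv, hg, inv_one]
  have hd : (Pi.single j 1 : ι → R) ⬝ᵥ Pi.single i 1 = 0 := by simp [hij.symm]
  conv_lhs =>
    rw [← one_mul (1 : R), ← oneAddVecMulVec_single_single hij 1 1 hd, conj_oneAddVecMulVec]
  have hu : (Pi.single i 1 ᵥ* (g⁻¹).1) ⬝ᵥ (g.1 *ᵥ Pi.single i 1) = 1 := by
    rw [← dotProduct_mulVec, mulVec_mulVec, ← coe_mul, inv_mul_cancel, coe_one, one_mulVec]
    simp
  have hw : (Pi.single j 1 ᵥ* (g⁻¹).1) ⬝ᵥ (g.1 *ᵥ Pi.single i 1) = 0 := by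
    rw [← dotProduct_mulVec, mulVec_mulVec, ← coe_mul, inv_mul_cancel, coe_one, one_mulVec, hd]
  have hfu (a : ι) : f ((Pi.single i 1 ᵥ* (g⁻¹).1) a) = if a = i then 1 else 0 := by
    simpa [eq_comm] using hgf _ hg' i a
  have hfw (a : ι) : f ((Pi.single j 1 ᵥ* (g⁻¹).1) a) = if a = j then 1 else 0 := by
    simpa [eq_comm] using hgf _ hg' j a
  have hfv (a : ι) : f ((g.1 *ᵥ Pi.single i 1) a) = if a = i then 1 else 0 := by
    simpa using hgf _ hg a i
  exact mk_oneAddVecMulVec_eq_of_dotProduct_eq_one hN hι hu hw hij hfu hfv hfw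

end Congruence

end Matrix.SpecialLinearGroup

namespace Matrix.SpecialLinearGroup

section Generation

variable {ι R : Type*} [DecidableEq ι] [Fintype ι] [CommRing R]

theorem transvection_zpow {i j : ι} (hij : i ≠ j) (a : R) (m : ℤ) :
    transvection hij a ^ m = transvection hij (m * a) := by
  let F : Multiplicative R →* SpecialLinearGroup ι R :=
    { toFun := fun c => transvection hij c.toAdd
      map_one' := transvection_coeff_zero hij
      map_mul' := fun _ _ => transvection_add hij _ _ }
  simpa [F] using (map_zpow F (Multiplicative.ofAdd a) m).symm

theorem transvection_mulVec {i j : ι} (hij : i ≠ j) (c : R) (v : ι → R) :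
    (transvection hij c).1 *ᵥ v = v + Pi.single i (c * v j) := by
  rw [transvection_coe, add_mulVec, one_mulVec, single_mulVec]
  ext x
  simp [Function.update_apply, Pi.single_apply]

variable {K : Subgroup (SpecialLinearGroup ι R)}

theorem exists_mulVec_eq_of_transvection {v w : ι → R} {i j : ι} {hij : i ≠ j} {c : R}
    (hK : transvection hij c ∈ K)
    (h : ∃ B ∈ K, B.1 *ᵥ (v + Pi.single i (c * v j)) = w) : ∃ B ∈ K, B.1 *ᵥ v = w := by
  obtain ⟨B, hB, h⟩ := h
  refine ⟨B * transvection hij c, mul_mem hB hK, ?_⟩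
  rw [coe_mul, ← mulVec_mulVec, transvection_mulVec, h]

theorem exists_mulVec_eq_single_of_apply_eq_one {m : ι}
    (hK : ∀ a (h : a ≠ m) (c : R), transvection h c ∈ K) {v : ι → R} (hv : v m = 1) :
    ∃ B ∈ K, B.1 *ᵥ v = Pi.single m 1 := by
  refine ⟨_, oneAddVecMulVec_single_right_mem (N := K) (v := Pi.single m 1 - v) (by simp [hv])
    fun a h => hK a h _, ?_⟩
  rw [coe_oneAddVecMulVec, add_mulVec, one_mulVec, vecMulVec_mulVec]
  simp [hv]

theorem exists_mulVec_eq_single_of_isUnit {s : Finset ι}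
    (hK : ∀ i, ∀ j ∈ s, ∀ (h : i ≠ j) (c : R), transvection h c ∈ K) {m l i : ι} (hm : m ∈ s)
    (hl : l ∈ s) (hlm : l ≠ m) (hi : i ∈ s) {v : ι → R} (hv : IsUnit (v i)) :
    ∃ B ∈ K, B.1 *ᵥ v = Pi.single m 1 := by
  have key {i : ι} (hi : i ∈ s) (him : i ≠ m) {v : ι → R} (hv : IsUnit (v i)) :
      ∃ B ∈ K, B.1 *ᵥ v = Pi.single m 1 := by
    obtain ⟨u, hu⟩ := hv.exists_left_inv
    refine exists_mulVec_eq_of_transvection (hK m i hi him.symm ((1 - v m) * u))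
      (exists_mulVec_eq_single_of_apply_eq_one (fun a h c => hK a m hm h c) ?_)
    simp [mul_assoc, hu]
  rcases eq_or_ne i m with rfl | him
  · obtain ⟨u, hu⟩ := hv.exists_left_inv
    refine exists_mulVec_eq_of_transvection (hK l i hi hlm ((1 - v l) * u)) (key hl hlm ?_)
    simp [mul_assoc, hu]
  · exact key hi him hv

theorem exists_mulVec_eq_single {K : Subgroup (SpecialLinearGroup ι ℤ)} {s : Finset ι}
    (hK : ∀ i, ∀ j ∈ s, ∀ (h : i ≠ j) (c : ℤ), transvection h c ∈ K) {m l : ι} (hm : m ∈ s)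
    (hl : l ∈ s) (hlm : l ≠ m) {v : ι → ℤ} (hv : ∀ d : ℤ, (∀ i ∈ s, d ∣ v i) → IsUnit d) :
    ∃ B ∈ K, B.1 *ᵥ v = Pi.single m 1 := by
  induction hn : ∑ i ∈ s, (v i).natAbs using Nat.strong_induction_on generalizing v with
  | _ n ih =>
  subst hn
  by_cases h : ∃ i ∈ s, ∃ j ∈ s, i ≠ j ∧ v j ≠ 0 ∧ (v j).natAbs ≤ (v i).natAbs
  · obtain ⟨i, hi, j, hj, hij, hvj, hle⟩ := h
    refine exists_mulVec_eq_of_transvection (hK i j hj hij (-(v i / v j))) (ih _ ?_ ?_ rfl)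
    · have h1 : (v + Pi.single i (-(v i / v j) * v j) : ι → ℤ) i = v i % v j := by
        simp only [Pi.add_apply, Pi.single_eq_same, Int.emod_def]
        ring
      refine Finset.sum_lt_sum (fun a _ => ?_) ⟨i, hi, ?_⟩
      · rcases eq_or_ne a i with rfl | hai
        · rw [h1]
          have := Int.emod_lt_abs (v a) hvj
          rw [Int.abs_eq_natAbs] at this
          have := Int.emod_nonneg (v a) hvj
          omega
        · simp [hai]
      · rw [h1]
        have := Int.emod_lt_abs (v i) hvj
        rw [Int.abs_eq_natAbs] at this
        have := Int.emod_nonneg (v i) hvj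
        omega
    · intro d hd
      have hdj : d ∣ v j := by simpa [hij.symm] using hd j hj
      refine hv d fun a ha => ?_
      rcases eq_or_ne a i with rfl | hai
      · have := hd a ha
        rw [Pi.add_apply, Pi.single_eq_same] at this
        exact (dvd_add_left (hdj.mul_left _)).1 this
      · simpa [hai] using hd a ha
  · push Not at h
    obtain ⟨i, hi, hvi⟩ : ∃ i ∈ s, v i ≠ 0 := by
      by_contra! h0
      exact not_isUnit_zero (hv 0 fun i hi => by rw [h0 i hi])
    refine exists_mulVec_eq_single_of_isUnit hK hm hl hlm hi (hv _ fun j hj => ?_)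
    rcases eq_or_ne i j with rfl | hij
    · exact dvd_rfl
    · have : v j = 0 := by
        by_contra h0
        have := h i hi j hj hij h0
        have := h j hj i hi hij.symm hvi
        omega
      simp [this]

theorem mem_of_mulVec_single_eq {E : Subgroup (SpecialLinearGroup ι ℤ)}
    (hE : ∀ (i j : ι) (h : i ≠ j) (c : ℤ), transvection h c ∈ E) (s : Finset ι) :
    ∀ A : SpecialLinearGroup ι ℤ,
      (∀ j ∉ s, A.1 *ᵥ Pi.single j 1 = Pi.single j 1) → A ∈ E := by
  induction s using Finset.induction with
  | empty =>
    intro A hA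
    convert! one_mem E
    apply Subtype.ext
    rw [coe_one]
    refine ext_of_mulVec_single fun j => ?_
    rw [hA j (by simp), one_mulVec]
  | insert m s hms ih =>
    intro A hA
    let T : Set (SpecialLinearGroup ι ℤ) :=
      {g | ∃ i, ∃ j ∈ insert m s, ∃ (h : i ≠ j) (c : ℤ), g = transvection h c}
    have hK : ∀ i, ∀ j ∈ insert m s, ∀ (h : i ≠ j) (c : ℤ),
        transvection h c ∈ Subgroup.closure T :=
      fun i j hj h c => Subgroup.subset_closure ⟨i, j, hj, h, c, rfl⟩
    have hKE : Subgroup.closure T ≤ E := by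
      rw [Subgroup.closure_le]
      rintro _ ⟨i, j, hj, h, c, rfl⟩
      exact hE i j h c
    have hKfix : ∀ B ∈ Subgroup.closure T, ∀ j ∉ insert m s,
        B.1 *ᵥ Pi.single j 1 = Pi.single j 1 := by
      intro B hB a ha
      suffices Subgroup.closure T ≤ MulAction.stabilizer (SpecialLinearGroup ι ℤ)
          (Pi.single a 1 : ι → ℤ) from MulAction.mem_stabilizer_iff.1 (this hB)
      rw [Subgroup.closure_le]
      rintro _ ⟨i, j, hj, h, c, rfl⟩
      refine MulAction.mem_stabilizer_iff.2 ((transvection_mulVec h c _).trans ?_)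
      have : j ≠ a := fun h => ha (h ▸ hj)
      simp [this]
    suffices ∃ B ∈ Subgroup.closure T, B.1 *ᵥ (A.1 *ᵥ Pi.single m 1) = Pi.single m 1 by
      obtain ⟨B, hB, hBA⟩ := this
      refine (mul_mem_cancel_left (hKE hB)).1 (ih (B * A) fun j hj => ?_)
      rw [coe_mul, ← mulVec_mulVec]
      rcases eq_or_ne j m with rfl | hjm
      · exact hBA
      · have : j ∉ insert m s := by simp [hj, hjm]
        rw [hA j this, hKfix B hB j this]
    rcases s.eq_empty_or_nonempty with rfl | ⟨l, hl⟩
    · refine exists_mulVec_eq_single_of_apply_eq_one (fun a h c => hK a m (by simp) h c) ?_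
      have : A.1 = 1 + vecMulVec (A.1 *ᵥ Pi.single m 1 - Pi.single m 1) (Pi.single m 1) := by
        refine ext_of_mulVec_single fun j => ?_
        rw [add_mulVec, one_mulVec, vecMulVec_mulVec]
        rcases eq_or_ne j m with rfl | hjm
        · simp
        · rw [hA j (by simp [hjm])]
          simp [hjm.symm]
      have hdet := A.2
      rw [this, vecMulVec_eq Unit, det_one_add_replicateCol_mul_replicateRow] at hdet
      simp at hdet ⊢
      omega
    · refine exists_mulVec_eq_single hK (m := m) (l := l) (by simp) (by simp [hl])
        (fun h => hms (h ▸ hl)) fun d hd => ?_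
      have hu : (Pi.single m 1 ᵥ* (A⁻¹).1) ⬝ᵥ (A.1 *ᵥ Pi.single m 1) = 1 := by
        rw [← dotProduct_mulVec, mulVec_mulVec, ← coe_mul, inv_mul_cancel, coe_one, one_mulVec]
        simp
      rw [isUnit_iff_dvd_one, ← hu]
      refine Finset.dvd_sum fun i _ => ?_
      by_cases hi : i ∈ insert m s
      · exact (hd i hi).mul_left _
      · have : A⁻¹.1 *ᵥ Pi.single i 1 = Pi.single i 1 := by
          conv_lhs => rw [← hA i hi]
          rw [mulVec_mulVec, ← coe_mul, inv_mul_cancel, coe_one, one_mulVec]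
        have h0 := congrFun this m
        have him : m ≠ i := fun h => hi (by simp [h])
        rw [Pi.single_eq_of_ne him] at h0
        simp at h0 ⊢
        simp [h0]

/-- The group `SL(n, ℤ)` is generated by the elementary matrices. -/
theorem closure_transvection_int :
    Subgroup.closure {g : SpecialLinearGroup ι ℤ | ∃ (i j : ι) (h : i ≠ j), g = transvection h 1} =
      ⊤ := by
  refine (Subgroup.eq_top_iff' _).2 fun A =>
    mem_of_mulVec_single_eq (fun i j h c => ?_) Finset.univ A (by simp)
  have hc := transvection_zpow h (1 : ℤ) c
  rw [mul_one, Int.cast_id] at hc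
  exact hc ▸ zpow_mem (Subgroup.subset_closure (Set.mem_ofPred.2 ⟨i, j, h, rfl⟩)) c

end Generation

end Matrix.SpecialLinearGroup

theorem Subgroup.pow_index_center_eq_one {G : Type*} [Group G] [Group.IsPerfect G]
    [(Subgroup.center G).FiniteIndex] (g : G) : g ^ (Subgroup.center G).index = 1 := by
  have := Group.IsPerfect.range (MonoidHom.transferCenterPow G)
  have : Subsingleton (MonoidHom.transferCenterPow G).range :=
    Group.IsPerfect.subsingleton_of_isMulCommutative
  rw [← MonoidHom.transferCenterPow_apply]
  exact congrArg (fun x : (MonoidHom.transferCenterPow G).range => ((x : center G) : G))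
    (Subsingleton.elim ⟨_, g, rfl⟩ 1)

theorem Subgroup.exists_pow_mem_of_commute_mk {G : Type*} [Group G] [Group.IsPerfect G]
    {N : Subgroup G} [N.Normal] (K : Subgroup G) [hK : K.FiniteIndex]
    (h : ∀ g ∈ K, ∀ x : G, Commute (g : G ⧸ N) (x : G ⧸ N)) :
    ∃ m : ℕ, m ≠ 0 ∧ ∀ g : G, g ^ m ∈ N := by
  have hker : K.map (QuotientGroup.mk' N) ≤ Subgroup.center (G ⧸ N) := by
    rintro _ ⟨g, hg, rfl⟩
    refine Subgroup.mem_center_iff.2 fun x => ?_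
    obtain ⟨x, rfl⟩ := QuotientGroup.mk'_surjective N x
    exact (h g hg x).symm.eq
  have : (K.map (QuotientGroup.mk' N)).FiniteIndex :=
    ⟨fun h => hK.index_ne_zero (Nat.eq_zero_of_zero_dvd
      (h ▸ Subgroup.index_map_dvd _ (QuotientGroup.mk'_surjective N)))⟩
  have hfin : (Subgroup.center (G ⧸ N)).FiniteIndex := Subgroup.finiteIndex_of_le hker
  refine ⟨_, hfin.index_ne_zero, fun g => ?_⟩
  rw [← QuotientGroup.eq_one_iff, QuotientGroup.mk_pow]
  exact Subgroup.pow_index_center_eq_one _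

namespace Matrix.SpecialLinearGroup

variable {ι : Type*} [DecidableEq ι] [Fintype ι]

section Relations

variable {R : Type*} [CommRing R]

theorem commute_transvection_of_left_eq {i j l : ι} (hij : i ≠ j) (hil : i ≠ l) (a b : R) :
    Commute (transvection hij a) (transvection hil b) := by
  apply Subtype.ext
  simp only [coe_mul, transvection_coe, mul_add, add_mul, mul_one, one_mul,
    single_mul_single_of_ne _ _ _ _ hij.symm, single_mul_single_of_ne _ _ _ _ hil.symm]
  abel

theorem commute_transvection_of_right_eq {i j l : ι} (hij : i ≠ j) (hlj : l ≠ j) (a b : R) :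
    Commute (transvection hij a) (transvection hlj b) := by
  apply Subtype.ext
  simp only [coe_mul, transvection_coe, mul_add, add_mul, mul_one, one_mul,
    single_mul_single_of_ne _ _ _ _ hij.symm, single_mul_single_of_ne _ _ _ _ hlj.symm]
  abel

theorem transvection_mul_transvection {i j l : ι} (hij : i ≠ j) (hil : i ≠ l) (hlj : l ≠ j)
    (a b : R) :
    transvection hil a * transvection hlj b =
      transvection hlj b * transvection hil a * transvection hij (a * b) := by
  apply Subtype.ext
  simp only [coe_mul, transvection_coe, mul_add, add_mul, mul_one, one_mul, single_mul_single_same,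
    single_mul_single_of_ne _ _ _ _ hij.symm, single_mul_single_of_ne _ _ _ _ hil.symm]
  simp
  abel

end Relations

theorem apply_transvection_eq_one {α : Type*} [LinearOrder α]
    (hι : ∀ i j : ι, ∃ l, l ≠ i ∧ l ≠ j) {N : Subgroup (SpecialLinearGroup ι ℤ)} {k : ℤ}
    (hk : k ≠ 0) (hN : ∀ (i j : ι) (h : i ≠ j), transvection h k ∈ N) (ψ : N →* (α ≃o α))
    {i j : ι} (hij : i ≠ j) : ψ ⟨transvection hij k, hN i j hij⟩ = 1 := by
  let a (i j : ι) : α ≃o α := if h : i ≠ j then ψ ⟨transvection h k, hN i j h⟩ else 1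
  have ha {i j : ι} (h : i ≠ j) : a i j = ψ ⟨transvection h k, hN i j h⟩ := dif_pos h
  rw [← ha hij]
  refine OrderIso.eq_one_of_elementary_relations hι a hk ?_ ?_ ?_ hij
  · intro i j l hij hil
    rw [ha hij, ha hil]
    exact Commute.map (Subtype.ext (commute_transvection_of_left_eq hij hil k k).eq) ψ
  · intro i j l hij hlj
    rw [ha hij, ha hlj]
    exact Commute.map (Subtype.ext (commute_transvection_of_right_eq hij hlj k k).eq) ψ
  · intro i j l hij hli hlj
    rw [ha hij, ha hli.symm, ha hlj, ← map_zpow, ← map_mul, ← map_mul, ← map_mul]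
    refine congrArg ψ (Subtype.ext ?_)
    simp only [Subgroup.coe_mul, Subgroup.coe_zpow, transvection_zpow]
    exact transvection_mul_transvection hij hli.symm hlj k k

theorem isPerfect_int (hι : ∀ i j : ι, ∃ l, l ≠ i ∧ l ≠ j) :
    Group.IsPerfect (SpecialLinearGroup ι ℤ) := by
  rw [Group.isPerfect_def, eq_top_iff, ← closure_transvection_int, Subgroup.closure_le]
  rintro _ ⟨i, j, hij, rfl⟩
  obtain ⟨l, hli, hlj⟩ := hι i j
  have h := transvection_mul_transvection hij hli.symm hlj (1 : ℤ) 1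
  rw [mul_one] at h
  rw [← inv_mul_cancel_left (transvection hlj (1 : ℤ) * transvection hli.symm 1)
    (transvection hij 1), ← h]
  have := Subgroup.commutator_mem_commutator
    (Subgroup.mem_top (transvection hli.symm (1 : ℤ))⁻¹)
    (Subgroup.mem_top (transvection hlj (1 : ℤ))⁻¹)
  rw [commutatorElement_def] at this
  rw [commutator_def]
  simpa [mul_assoc] using this

/-- A normal subgroup of `SL(n, ℤ)`, `n ≥ 3`, that contains the `k`-th powers of the elementary
matrices has a quotient of finite exponent. -/
theorem exists_pow_mem_of_transvection_mem (hι : ∀ i j : ι, ∃ l, l ≠ i ∧ l ≠ j)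
    {N : Subgroup (SpecialLinearGroup ι ℤ)} [N.Normal] {k : ℕ} (hk : k ≠ 0)
    (hN : ∀ (i j : ι) (h : i ≠ j), transvection h (k : ℤ) ∈ N) :
    ∃ m : ℕ, m ≠ 0 ∧ ∀ g : SpecialLinearGroup ι ℤ, g ^ m ∈ N := by
  have : NeZero k := ⟨hk⟩
  have := Subgroup.finiteIndex_ker (map (n := ι) (Int.castRingHom (ZMod k)))
  have := isPerfect_int hι
  refine Subgroup.exists_pow_mem_of_commute_mk
    (map (n := ι) (Int.castRingHom (ZMod k))).ker fun g hg x => ?_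
  have hx : x ∈ Subgroup.closure
      {g : SpecialLinearGroup ι ℤ | ∃ (i j : ι) (h : i ≠ j), g = transvection h 1} := by
    rw [closure_transvection_int]
    exact Subgroup.mem_top x
  induction hx using Subgroup.closure_induction with
  | mem x hx =>
    obtain ⟨i, j, hij, rfl⟩ := hx
    refine commute_mk_transvection (f := Int.castRingHom (ZMod k)) (fun i j h a ha => ?_) hι hg hij
    obtain ⟨b, rfl⟩ := (ZMod.intCast_zmod_eq_zero_iff_dvd a k).1 ha
    have hb := transvection_zpow h (k : ℤ) b
    rw [Int.cast_id] at hb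
    rw [mul_comm, ← hb]
    exact zpow_mem (hN i j h) b
  | one => exact Commute.one_right _
  | mul x y _ _ hx hy => exact hx.mul_right hy
  | inv x _ hx => exact hx.inv_right

end Matrix.SpecialLinearGroup


/-- Witte-Morris. For `n ≥ 3`, every action of a finite-index subgroup
of `SL(n, ℤ)` on the real line by order-preserving bijections (equivalently, every action
on the interval by orientation-preserving homeomorphisms) is trivial: every group
homomorphism from such a subgroup to `ℝ ≃o ℝ` is trivial. -/
theorem witte_morris_SL_n_Z_no_line_action
    (n : ℕ) (hn : 3 ≤ n)
    (H : Subgroup (Matrix.SpecialLinearGroup (Fin n) ℤ)) (hH : H.FiniteIndex)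
    (φ : H →* (ℝ ≃o ℝ)) :
    ∀ h : H, φ h = 1 := by
  intro h
  have hι (i j : Fin n) : ∃ l, l ≠ i ∧ l ≠ j := by
    obtain ⟨l, hl⟩ := Finset.exists_mem_notMem_of_card_lt_card
      (s := {i, j}) (t := (Finset.univ : Finset (Fin n)))
      (Finset.card_le_two.trans_lt (by rwa [Finset.card_univ, Fintype.card_fin]))
    exact ⟨l, by simpa using hl⟩
  have hk : H.normalCore.index ≠ 0 := Subgroup.FiniteIndex.index_ne_zero
  have hN (i j : Fin n) (h : i ≠ j) :
      Matrix.SpecialLinearGroup.transvection h (H.normalCore.index : ℤ) ∈ H.normalCore := by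
    have := H.normalCore.pow_index_mem (Matrix.SpecialLinearGroup.transvection h (1 : ℤ))
    rw [← zpow_natCast, Matrix.SpecialLinearGroup.transvection_zpow, mul_one] at this
    simpa using this
  let E : Subgroup (Matrix.SpecialLinearGroup (Fin n) ℤ) := Subgroup.normalClosure
    {g | ∃ (i j : Fin n) (h : i ≠ j),
      g = Matrix.SpecialLinearGroup.transvection h (H.normalCore.index : ℤ)}
  have hE : E ≤ φ.ker.map H.subtype := by
    refine (Subgroup.closure_le _).2 fun x hx => ?_
    obtain ⟨_, ⟨i, j, hij, rfl⟩, hx⟩ := Group.mem_conjugatesOfSet_iff.1 hx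
    obtain ⟨g, rfl⟩ := isConj_iff.1 hx
    have := Matrix.SpecialLinearGroup.apply_transvection_eq_one hι (Int.natCast_ne_zero.2 hk) hN
      ((φ.comp (Subgroup.inclusion H.normalCore_le)).comp (MulAut.conjNormal g).toMonoidHom) hij
    exact ⟨_, this, rfl⟩
  obtain ⟨m, hm, hpow⟩ := Matrix.SpecialLinearGroup.exists_pow_mem_of_transvection_mem
    hι (N := E) hk fun i j h => Subgroup.subset_normalClosure ⟨i, j, h, rfl⟩
  obtain ⟨x, hx, hxh⟩ := hE (hpow h)
  refine OrderIso.eq_one_of_pow_eq_one hm ?_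
  rw [← map_pow, ← show x = h ^ m from Subtype.ext hxh]
  exact hx
end
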